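/- Murnaghan–Nakayama rule for k-Schur functions in partition form: with the data below, for every 1 ≤ r ≤ k and every λ ∈ 𝒫_k, one has p^R_r s^{(k)}_λ = Σ_μ ( Σ_{i=0}^{r−1} (−1)^i |V^{r,μ}_{i,c}| ) s^{(k)}_μ, where V^{r,μ}_{i,c} = {u ∈ V^r_{i,c} : u · λ = μ} (dot action on k-bounded partitions), and the sum runs over those μ ∈ 𝒫_k satisfying: (k0) λ ⊆ μ and λ^{(k)} ⊆ μ^{(k)}; (k1) |μ/λ| = r; (k2) 𝔭^{-1}(μ)/𝔭^{-1}(λ) is a ribbon; (k3) supp(𝔭^{-1}(μ)/𝔭^{-1}(λ)) is k-connected; (k4) ht(μ/λ) + ht(μ^{(k)}/λ^{(k)}) = r − 1. (In particular the coefficient of s^{(k)}_μ vanishes for every μ failing one of (k0)–(k4).) -/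

import Mathlib

open scoped BigOperators Classical

noncomputable section

namespace MN

/-! ## Residues, words, canonical cyclic intervals -/

/-- The residues `ℤ/(k+1)ℤ`. -/
abbrev Idx (k : ℕ) := ZMod (k + 1)

/-- A word in the generators, recorded by its list of indices. -/
abbrev Word (k : ℕ) := List (Idx k)

/-- The support of a word. -/
def supp (k : ℕ) (u : Word k) : Finset (Idx k) := u.toFinset

/-- The smallest `a ∈ {0,…,k}` (as a natural number) with `(a : ℤ/(k+1)) ∉ S`. -/
def gapNat (k : ℕ) (S : Finset (Idx k)) : ℕ :=
  if h : ∃ m : ℕ, m ≤ k ∧ (m : Idx k) ∉ S then Nat.find h else 0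

/-- The gap element `a` of a proper subset `S`. -/
def gap (k : ℕ) (S : Finset (Idx k)) : Idx k := (gapNat k S : Idx k)

/-- Position of a residue `i` in the canonical cyclic interval
`I_S : a+1 < a+2 < ⋯ < k < 0 < ⋯ < a−1` (the gap `a` itself gets the junk position `k`). -/
def pos (k : ℕ) (S : Finset (Idx k)) (i : Idx k) : ℕ := (i - gap k S - 1).val

/-- The list of positions of the letters of `u` in the canonical cyclic interval of its support. -/
def posList (k : ℕ) (u : Word k) : List ℕ := u.map (pos k (supp k u))

/-- A weak hook word of hook type V:
`i₁ > ⋯ > i_j < i_{j+1} < ⋯ < i_m` with respect to `I_{supp u}`. -/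
def IsHookV (k : ℕ) (u : Word k) : Prop :=
  supp k u ≠ Finset.univ ∧
    ∃ (ds as : List ℕ) (v : ℕ),
      posList k u = ds ++ v :: as ∧
        List.Chain' (· > ·) (ds ++ [v]) ∧ List.Chain' (· < ·) (v :: as)

/-- A weak hook word of hook type U:
`i₁ > ⋯ > i_j = i_{j+1} < ⋯ < i_m` with respect to `I_{supp u}`. -/
def IsHookU (k : ℕ) (u : Word k) : Prop :=
  supp k u ≠ Finset.univ ∧
    ∃ (ds as : List ℕ) (v : ℕ),
      posList k u = ds ++ v :: v :: as ∧
        List.Chain' (· > ·) (ds ++ [v]) ∧ List.Chain' (· < ·) (v :: as)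

/-- A weak hook word. -/
def IsWeakHook (k : ℕ) (u : Word k) : Prop := IsHookV k u ∨ IsHookU k u

/-- The number of ascents `i_t < i_{t+1}` of a word. -/
def asc (k : ℕ) (u : Word k) : ℕ :=
  ((posList k u).zip (posList k u).tail).countP fun p => decide (p.1 < p.2)

/-- The candidates `c` in the definition of `u_min`: letters `c` of `u` for which there is a
letter `a` of `u` with `a < c` in `I_{supp u}`, `a + 1 ≠ c`, and no letter `b` of `u` satisfies
`a < b < c`. -/
def uminCands (k : ℕ) (u : Word k) : Finset (Idx k) :=
  (supp k u).filter fun c =>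
    ∃ a ∈ supp k u,
      pos k (supp k u) a < pos k (supp k u) c ∧ a + 1 ≠ c ∧
        ∀ b ∈ supp k u,
          ¬(pos k (supp k u) a < pos k (supp k u) b ∧
            pos k (supp k u) b < pos k (supp k u) c)

/-- The letter `u_min` of `u` (junk value `0` if there is no candidate). -/
def umin (k : ℕ) (u : Word k) : Idx k :=
  if h : (uminCands k u).Nonempty then
    ((uminCands k u).exists_min_image (pos k (supp k u)) h).choose
  else 0

/-- The number of occurrences of `u_min` in `u` (`0` if there is no candidate). -/
def uminCount (k : ℕ) (u : Word k) : ℕ :=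
  if (uminCands k u).Nonempty then u.count (umin k u) else 0

/-- A set of residues is `k`-connected if it is a proper subset of `{0,…,k}` which is an
interval with respect to its canonical cyclic interval order. -/
def IsKConnectedSet (k : ℕ) (S : Finset (Idx k)) : Prop :=
  S ≠ Finset.univ ∧
    ∀ i ∈ S, ∀ j ∈ S, ∀ m : Idx k,
      pos k S i ≤ pos k S m → pos k S m ≤ pos k S j → m ∈ S

/-- A word is `k`-connected if its support is. -/
def IsKConnected (k : ℕ) (u : Word k) : Prop := IsKConnectedSet k (supp k u)

/-- A word is `k`-weak connected if `u_min` occurs `0` or `2` times in it. -/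
def IsWeakConnected (k : ℕ) (u : Word k) : Prop :=
  uminCount k u = 0 ∨ uminCount k u = 2

/-- The letter `c` lies on the left side (the maximal strictly decreasing initial segment) of
the hook form of `u`: equivalently, it occurs in some strictly decreasing initial segment. -/
def OnLeftSide (k : ℕ) (u : Word k) (c : Idx k) : Prop :=
  ∃ p q : Word k, u = p ++ q ∧
    List.Chain' (fun a b => pos k (supp k u) b < pos k (supp k u) a) p ∧ c ∈ p

/-- The letter `c` lies on the right side (the maximal strictly increasing final segment) of
the hook form of `u`. -/
def OnRightSide (k : ℕ) (u : Word k) (c : Idx k) : Prop :=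
  ∃ p q : Word k, u = p ++ q ∧
    List.Chain' (fun a b => pos k (supp k u) a < pos k (supp k u) b) q ∧ c ∈ q

/-! ## The sets `X^r_i` and their refinements (indexed by `i : ℤ`, empty for `i < 0`) -/

/-- `V^r_i`: weak hook words of hook type V, weak length `r`, `asc = i`. -/
def VSet (k r : ℕ) (i : ℤ) : Set (Word k) :=
  {u | IsHookV k u ∧ u.length = r ∧ (asc k u : ℤ) = i}

/-- `U^r_i`. -/
def USet (k r : ℕ) (i : ℤ) : Set (Word k) :=
  {u | IsHookU k u ∧ u.length = r ∧ (asc k u : ℤ) = i}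

/-- `V^r_{i,wc}`: the `k`-weak connected members of `V^r_i`. -/
def VSetWC (k r : ℕ) (i : ℤ) : Set (Word k) := {u ∈ VSet k r i | IsWeakConnected k u}

/-- `U^r_{i,wc}`. -/
def USetWC (k r : ℕ) (i : ℤ) : Set (Word k) := {u ∈ USet k r i | IsWeakConnected k u}

/-- `V^r_{i,c}`: the `k`-connected members of `V^r_i`. -/
def VSetC (k r : ℕ) (i : ℤ) : Set (Word k) := {u ∈ VSet k r i | IsKConnected k u}

/-- `V^r_{i,w̄c,left}`. -/
def VSetNWCL (k r : ℕ) (i : ℤ) : Set (Word k) :=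
  {u ∈ VSet k r i | ¬IsWeakConnected k u ∧ OnLeftSide k u (umin k u)}

/-- `V^r_{i,w̄c,right}`. -/
def VSetNWCR (k r : ℕ) (i : ℤ) : Set (Word k) :=
  {u ∈ VSet k r i | ¬IsWeakConnected k u ∧ OnRightSide k u (umin k u)}

/-- `U^r_{i,w̄c,left}`. -/
def USetNWCL (k r : ℕ) (i : ℤ) : Set (Word k) :=
  {u ∈ USet k r i | ¬IsWeakConnected k u ∧ OnLeftSide k u (umin k u)}

/-- `U^r_{i,w̄c,right}`. -/
def USetNWCR (k r : ℕ) (i : ℤ) : Set (Word k) :=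
  {u ∈ USet k r i | ¬IsWeakConnected k u ∧ OnRightSide k u (umin k u)}

/-! ## The algebras `𝒜_k`, `ℋ_k`, `𝒩_k` -/

/-- The defining relations of `𝒜_k`. -/
inductive AkRel (k : ℕ) : FreeAlgebra ℤ (Idx k) → FreeAlgebra ℤ (Idx k) → Prop
  | braid (i : Idx k) :
      AkRel k (FreeAlgebra.ι ℤ i * FreeAlgebra.ι ℤ (i + 1) * FreeAlgebra.ι ℤ i)
        (FreeAlgebra.ι ℤ (i + 1) * FreeAlgebra.ι ℤ i * FreeAlgebra.ι ℤ (i + 1))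
  | comm (i j : Idx k) (h1 : i - j ≠ 1) (h2 : j - i ≠ 1) :
      AkRel k (FreeAlgebra.ι ℤ i * FreeAlgebra.ι ℤ j)
        (FreeAlgebra.ι ℤ j * FreeAlgebra.ι ℤ i)

/-- The algebra `𝒜_k`. -/
abbrev Ak (k : ℕ) := RingQuot (AkRel k)

/-- The generator `A_i` of `𝒜_k`. -/
def Agen (k : ℕ) (i : Idx k) : Ak k := RingQuot.mkAlgHom ℤ (AkRel k) (FreeAlgebra.ι ℤ i)

/-- The element `A_{i₁} ⋯ A_{i_m}` of `𝒜_k` associated to a word. -/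
def Aword (k : ℕ) (u : Word k) : Ak k := (u.map (Agen k)).prod

/-- The defining relations of the 0-Hecke algebra `ℋ_k`. -/
inductive HkRel (k : ℕ) : FreeAlgebra ℤ (Idx k) → FreeAlgebra ℤ (Idx k) → Prop
  | braid (i : Idx k) :
      HkRel k (FreeAlgebra.ι ℤ i * FreeAlgebra.ι ℤ (i + 1) * FreeAlgebra.ι ℤ i)
        (FreeAlgebra.ι ℤ (i + 1) * FreeAlgebra.ι ℤ i * FreeAlgebra.ι ℤ (i + 1))
  | comm (i j : Idx k) (h1 : i - j ≠ 1) (h2 : j - i ≠ 1) :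
      HkRel k (FreeAlgebra.ι ℤ i * FreeAlgebra.ι ℤ j)
        (FreeAlgebra.ι ℤ j * FreeAlgebra.ι ℤ i)
  | sq (i : Idx k) :
      HkRel k (FreeAlgebra.ι ℤ i * FreeAlgebra.ι ℤ i) (-(FreeAlgebra.ι ℤ i))

/-- The 0-Hecke algebra `ℋ_k`. -/
abbrev Hk (k : ℕ) := RingQuot (HkRel k)

/-- The generator `H_i`. -/
def Hgen (k : ℕ) (i : Idx k) : Hk k := RingQuot.mkAlgHom ℤ (HkRel k) (FreeAlgebra.ι ℤ i)

/-- The element `H_{i₁} ⋯ H_{i_m}`. -/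
def Hword (k : ℕ) (u : Word k) : Hk k := (u.map (Hgen k)).prod

/-- The defining relations of the nilCoxeter algebra `𝒩_k`. -/
inductive NkRel (k : ℕ) : FreeAlgebra ℤ (Idx k) → FreeAlgebra ℤ (Idx k) → Prop
  | braid (i : Idx k) :
      NkRel k (FreeAlgebra.ι ℤ i * FreeAlgebra.ι ℤ (i + 1) * FreeAlgebra.ι ℤ i)
        (FreeAlgebra.ι ℤ (i + 1) * FreeAlgebra.ι ℤ i * FreeAlgebra.ι ℤ (i + 1))
  | comm (i j : Idx k) (h1 : i - j ≠ 1) (h2 : j - i ≠ 1) :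
      NkRel k (FreeAlgebra.ι ℤ i * FreeAlgebra.ι ℤ j)
        (FreeAlgebra.ι ℤ j * FreeAlgebra.ι ℤ i)
  | sq (i : Idx k) :
      NkRel k (FreeAlgebra.ι ℤ i * FreeAlgebra.ι ℤ i) 0

/-- The nilCoxeter algebra `𝒩_k`. -/
abbrev Nk (k : ℕ) := RingQuot (NkRel k)

/-- The generator `N_i`. -/
def Ngen (k : ℕ) (i : Idx k) : Nk k := RingQuot.mkAlgHom ℤ (NkRel k) (FreeAlgebra.ι ℤ i)

/-- The element `N_{i₁} ⋯ N_{i_m}`. -/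
def Nword (k : ℕ) (u : Word k) : Nk k := (u.map (Ngen k)).prod

/-! ## The affine symmetric group -/

/-- The relators of the affine symmetric group `S̃_{k+1}`. -/
def CoxRels (k : ℕ) : Set (FreeGroup (Idx k)) :=
  {g | (∃ i : Idx k, g = FreeGroup.of i * FreeGroup.of i) ∨
    (∃ i : Idx k,
      g = FreeGroup.of i * FreeGroup.of (i + 1) * FreeGroup.of i *
        (FreeGroup.of (i + 1) * FreeGroup.of i * FreeGroup.of (i + 1))⁻¹) ∨
    (∃ i j : Idx k, i - j ≠ 1 ∧ j - i ≠ 1 ∧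
      g = FreeGroup.of i * FreeGroup.of j * (FreeGroup.of j * FreeGroup.of i)⁻¹)}

/-- The affine symmetric group `S̃_{k+1}`. -/
abbrev AffS (k : ℕ) := PresentedGroup (CoxRels k)

/-- The generator `s_i`. -/
def sgen (k : ℕ) (i : Idx k) : AffS k := PresentedGroup.of i

/-- The product `s_{i₁} ⋯ s_{i_m}`. -/
def sword (k : ℕ) (u : Word k) : AffS k := (u.map (sgen k)).prod

/-- The Coxeter length of `w ∈ S̃_{k+1}`. -/
def len (k : ℕ) (w : AffS k) : ℕ :=
  sInf {m | ∃ u : Word k, u.length = m ∧ sword k u = w}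

/-- `u` is a reduced word. -/
def IsReducedWord (k : ℕ) (u : Word k) : Prop := len k (sword k u) = u.length

/-- The finite symmetric group `S_{k+1} = ⟨s_1, …, s_k⟩` inside `S̃_{k+1}`. -/
def FinSub (k : ℕ) : Subgroup (AffS k) :=
  Subgroup.closure {g | ∃ i : Idx k, i ≠ 0 ∧ g = sgen k i}

/-- `w` is a minimal-length coset representative of `S̃_{k+1}/S_{k+1}` (a Grassmannian
element). -/
def IsGrassmannian (k : ℕ) (w : AffS k) : Prop :=
  ∀ v : AffS k, w⁻¹ * v ∈ FinSub k → len k w ≤ len k v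

/-! ## Anti-weak hook words -/

/-- Anti-weak hook word, first form: `i₁ < ⋯ < i_j > i_{j+1} > ⋯ > i_m`. -/
def IsAntiHookV (k : ℕ) (u : Word k) : Prop :=
  supp k u ≠ Finset.univ ∧
    ∃ (ds as : List ℕ) (v : ℕ),
      posList k u = ds ++ v :: as ∧
        List.Chain' (· < ·) (ds ++ [v]) ∧ List.Chain' (· > ·) (v :: as)

/-- Anti-weak hook word, second form: `i₁ < ⋯ < i_j = i_{j+1} > ⋯ > i_m`. -/
def IsAntiHookU (k : ℕ) (u : Word k) : Prop :=
  supp k u ≠ Finset.univ ∧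
    ∃ (ds as : List ℕ) (v : ℕ),
      posList k u = ds ++ v :: v :: as ∧
        List.Chain' (· < ·) (ds ++ [v]) ∧ List.Chain' (· > ·) (v :: as)

/-- Anti-weak hook word. -/
def IsAntiWeakHook (k : ℕ) (u : Word k) : Prop := IsAntiHookV k u ∨ IsAntiHookU k u

/-- Length of the maximal strictly increasing (w.r.t. `I_{supp u}`) initial segment of `u`
(= the left side of an anti-weak hook word). -/
def incPrefixLen (k : ℕ) (u : Word k) : ℕ :=
  sSup {n | n ≤ u.length ∧
    List.Chain' (fun a b => pos k (supp k u) a < pos k (supp k u) b) (u.take n)}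

/-- Length of the maximal strictly increasing (w.r.t. `I_{supp u}`) final segment of `u`
(= the right side of a weak hook word). -/
def incSuffixLen (k : ℕ) (u : Word k) : ℕ :=
  sSup {n | n ≤ u.length ∧
    List.Chain' (fun a b => pos k (supp k u) a < pos k (supp k u) b)
      (u.drop (u.length - n))}

/-! ## Noncommutative symmetric functions in `𝒜_k` -/

/-- The word underlying the cyclically decreasing element `d_A` (letters of `A` in decreasing
position order, so that `A_{i+1}` occurs before `A_i` whenever `i, i+1 ∈ A`). -/
def dwordOf (k : ℕ) (A : Finset (Idx k)) : Word k :=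
  (((A.image (pos k A)).sort (· ≤ ·)).reverse).map fun n => gap k A + 1 + (n : Idx k)

/-- The word underlying the cyclically increasing element `i_A`. -/
def iwordOf (k : ℕ) (A : Finset (Idx k)) : Word k :=
  ((A.image (pos k A)).sort (· ≤ ·)).map fun n => gap k A + 1 + (n : Idx k)

/-- The noncommutative homogeneous symmetric function `h_r = Σ_{|A| = r} d_A`. -/
def hFun (k r : ℕ) : Ak k :=
  ∑ A ∈ Finset.powersetCard r (Finset.univ : Finset (Idx k)), Aword k (dwordOf k A)

/-- The noncommutative elementary symmetric function `e_r = Σ_{|A| = r} i_A`. -/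
def eFun (k r : ℕ) : Ak k :=
  ∑ A ∈ Finset.powersetCard r (Finset.univ : Finset (Idx k)), Aword k (iwordOf k A)

/-- The noncommutative hook Schur function `s_{(r−i,1^i)}`. -/
def sHookFun (k r i : ℕ) : Ak k :=
  ∑ j ∈ Finset.range (i + 1), ((-1 : ℤ) ^ j) • (hFun k (r - i + j) * eFun k (i - j))

/-- The noncommutative power sum `p_r`. -/
def pFun (k r : ℕ) : Ak k :=
  ∑ i ∈ Finset.range r, ((-1 : ℤ) ^ i) • sHookFun k r i

/-! ## Actions on the affine symmetric group -/

/-- The star action of a generator: `A_i * w = s_i w` if `l(s_i w) > l(w)`, else `w`. -/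
def starG (k : ℕ) (i : Idx k) (w : AffS k) : AffS k :=
  if len k w < len k (sgen k i * w) then sgen k i * w else w

/-- The star action of a word: `A_{i₁}⋯A_{i_m} * w = A_{i₁} * (⋯ * (A_{i_m} * w))`. -/
def starW (k : ℕ) (u : Word k) (w : AffS k) : AffS k := u.foldr (starG k) w

/-- The dot action of a generator, with values in `S̃_{k+1} ∪ {0}`. -/
def dotG (k : ℕ) (i : Idx k) : Option (AffS k) → Option (AffS k)
  | none => none
  | some w => if len k w < len k (sgen k i * w) then some (sgen k i * w) else none

/-- The dot action of a word. -/
def dotW (k : ℕ) (u : Word k) (o : Option (AffS k)) : Option (AffS k) :=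
  u.foldr (dotG k) o

/-- Extension of an action datum `act : generator → S̃ → S̃ ∪ {0}` to `S̃ ∪ {0}`. -/
def actExt (k : ℕ) (act : Idx k → AffS k → Option (AffS k)) (i : Idx k) :
    Option (AffS k) → Option (AffS k)
  | none => none
  | some w => act i w

/-- Extension of an action datum to words. -/
def actW (k : ℕ) (act : Idx k → AffS k → Option (AffS k)) (u : Word k)
    (o : Option (AffS k)) : Option (AffS k) :=
  u.foldr (actExt k act) o

/-! ## Rings and coefficients -/

/-- `(−1)^n` for an integer exponent `n`, in any ring. -/
def msign (R : Type*) [Ring R] (n : ℤ) : R := (((-1 : Rˣ) ^ n : Rˣ) : R)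

/-- The power sum `p^R_r = Σ_{i=0}^{r−1} Σ_{j=0}^{i} (−1)^{i+j} h^R_{r−i+j} e^R_{i−j}` built from
Pieri data in a commutative ring. -/
def pR {R : Type*} [CommRing R] (h e : ℕ → R) (r : ℕ) : R :=
  ∑ i ∈ Finset.range r, ∑ j ∈ Finset.range (i + 1),
    ((-1 : ℤ) ^ (i + j)) • (h (r - i + j) * e (i - j))

/-- The integer coefficient
`Σ_{i=0}^{r−1} (−1)^i |V^r_{i,wc} ∩ P| + Σ_{i=1}^{r−1} (−1)^i (r−i) |U^r_{i−1,wc} ∩ P|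
 + Σ_{i=1}^{r−2} (−1)^i |U^r_{i−1,w̄c,left} ∩ P|`. -/
def MNcoeff (k r : ℕ) (P : Word k → Prop) : ℤ :=
  (∑ i ∈ Finset.range r, (-1 : ℤ) ^ i * ({u ∈ VSetWC k r (i : ℤ) | P u}.ncard : ℤ)) +
    (∑ i ∈ Finset.Icc 1 (r - 1),
      (-1 : ℤ) ^ i * ((r : ℤ) - i) * ({u ∈ USetWC k r ((i : ℤ) - 1) | P u}.ncard : ℤ)) +
    ∑ i ∈ Finset.Icc 1 (r - 2),
      (-1 : ℤ) ^ i * ({u ∈ USetNWCL k r ((i : ℤ) - 1) | P u}.ncard : ℤ)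

/-- The integer coefficient `Σ_{i=0}^{r−1} (−1)^i |V^r_{i,c} ∩ P|`. -/
def kcoeff (k r : ℕ) (P : Word k → Prop) : ℤ :=
  ∑ i ∈ Finset.range r, (-1 : ℤ) ^ i * ({u ∈ VSetC k r (i : ℤ) | P u}.ncard : ℤ)

/-! ## Partitions, cores, bounded partitions -/

/-- A cell of a Young diagram: (row, column), `0`-indexed. -/
abbrev Cell := ℕ × ℕ

/-- A (finite) Young diagram, as a finite lower set of cells. -/
def IsYoung (S : Set Cell) : Prop :=
  S.Finite ∧ ∀ p ∈ S, ∀ q : Cell, q.1 ≤ p.1 → q.2 ≤ p.2 → q ∈ S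

/-- The `(k+1)`-residue of a cell `(i,j)`, i.e. `j − i mod (k+1)`. -/
def res (k : ℕ) (c : Cell) : Idx k := (c.2 : Idx k) - (c.1 : Idx k)

/-- The hook length of a cell: arm + leg + 1. -/
def hookLen (S : Set Cell) (c : Cell) : ℕ :=
  {j | c.2 < j ∧ (c.1, j) ∈ S}.ncard + {i | c.1 < i ∧ (i, c.2) ∈ S}.ncard + 1

/-- A `(k+1)`-core: a partition with no cell of hook length `k+1`. -/
def IsCore (k : ℕ) (S : Set Cell) : Prop :=
  IsYoung S ∧ ∀ c ∈ S, hookLen S c ≠ k + 1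

/-- A `k`-bounded partition: every part is at most `k`. -/
def IsBounded (k : ℕ) (S : Set Cell) : Prop :=
  IsYoung S ∧ ∀ c ∈ S, c.2 < k

/-- A removable corner of `S`. -/
def Removable (S : Set Cell) (c : Cell) : Prop :=
  c ∈ S ∧ (c.1 + 1, c.2) ∉ S ∧ (c.1, c.2 + 1) ∉ S

/-- An addable corner of `S`: a cell not in `S` whose addition yields a partition. -/
def Addable (S : Set Cell) (c : Cell) : Prop :=
  c ∉ S ∧ IsYoung (S ∪ {c})

/-- The map `𝔭` from `(k+1)`-cores to `k`-bounded partitions: row `i` of `𝔭(κ)` has as many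
cells as there are cells of hook length at most `k` in row `i` of `κ`. -/
def pMap (k : ℕ) (S : Set Cell) : Set Cell :=
  {c | c.2 < {j | (c.1, j) ∈ S ∧ hookLen S (c.1, j) ≤ k}.ncard}

/-- The inverse bijection `𝔭^{-1}` from `k`-bounded partitions to `(k+1)`-cores. -/
def pInv (k : ℕ) (lam : Set Cell) : Set Cell :=
  Function.invFunOn (pMap k) {S | IsCore k S} lam

/-- The transpose (conjugate) of a diagram. -/
def transposeSet (S : Set Cell) : Set Cell := {c | (c.2, c.1) ∈ S}

/-- The `k`-conjugate `λ^{(k)} = 𝔭((𝔭^{-1} λ)^t)`. -/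
def kconj (k : ℕ) (lam : Set Cell) : Set Cell := pMap k (transposeSet (pInv k lam))

/-- A skew shape is a ribbon if it contains no `2×2` square. -/
def IsRibbon (D : Set Cell) : Prop :=
  ∀ c : Cell, ¬((c.1, c.2) ∈ D ∧ (c.1 + 1, c.2) ∈ D ∧
    (c.1, c.2 + 1) ∈ D ∧ (c.1 + 1, c.2 + 1) ∈ D)

/-- A vertical strip: no two cells in the same row. -/
def IsVStrip (D : Set Cell) : Prop :=
  ∀ c ∈ D, ∀ c' ∈ D, c.1 = c'.1 → c = c'

/-- A horizontal strip: no two cells in the same column. -/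
def IsHStrip (D : Set Cell) : Prop :=
  ∀ c ∈ D, ∀ c' ∈ D, c.2 = c'.2 → c = c'

/-- The height of a skew shape: the number of occupied rows minus the number of connected
components; each connected component is counted by its unique last occupied row, i.e. an
occupied row sharing no column with the next row. -/
def htSkew (D : Set Cell) : ℕ :=
  {i : ℕ | ∃ j, (i, j) ∈ D}.ncard -
    {i : ℕ | (∃ j, (i, j) ∈ D) ∧ ¬∃ j, (i, j) ∈ D ∧ (i + 1, j) ∈ D}.ncard

/-- The set of `(k+1)`-residues of the cells of a skew shape. -/
def residSupp (k : ℕ) (D : Set Cell) : Finset (Idx k) :=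
  Set.Finite.toFinset (Set.toFinite (res k '' D))

/-! ## Star and dot actions on cores and on `k`-bounded partitions -/

/-- The star action of `A_i` on `(k+1)`-cores together with `0`. -/
def starC (k : ℕ) (i : Idx k) : Option (Set Cell) → Option (Set Cell)
  | none => none
  | some S =>
    if ∃ c, Addable S c ∧ res k c = i then some (S ∪ {c | Addable S c ∧ res k c = i})
    else if ∃ c, Removable S c ∧ res k c = i then some S
    else none

/-- The star action of a word on cores. -/
def starCW (k : ℕ) (u : Word k) (o : Option (Set Cell)) : Option (Set Cell) :=
  u.foldr (starC k) o

/-- The star action of a word on `k`-bounded partitions, transported through `𝔭`. -/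
def starB (k : ℕ) (u : Word k) (lam : Set Cell) : Option (Set Cell) :=
  (starCW k u (some (pInv k lam))).map (pMap k)

/-- The dot action of `A_i` on `(k+1)`-cores together with `0`. -/
def dotC (k : ℕ) (i : Idx k) : Option (Set Cell) → Option (Set Cell)
  | none => none
  | some S =>
    if ∃ c, Addable S c ∧ res k c = i then some (S ∪ {c | Addable S c ∧ res k c = i})
    else none

/-- The dot action of a word on cores. -/
def dotCW (k : ℕ) (u : Word k) (o : Option (Set Cell)) : Option (Set Cell) :=
  u.foldr (dotC k) o

/-- The dot action of a word on `k`-bounded partitions, transported through `𝔭`. -/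
def dotB (k : ℕ) (u : Word k) (lam : Set Cell) : Option (Set Cell) :=
  (dotCW k u (some (pInv k lam))).map (pMap k)

/-- The number of maximal segments of consecutive letters (w.r.t. the positions for `S`) of a
word `V`. -/
def numSegments (k : ℕ) (S : Finset (Idx k)) (V : Word k) : ℕ :=
  if V.length = 0 then 0
  else ((V.zip V.tail).countP fun p => decide (pos k S p.2 ≠ pos k S p.1 + 1)) + 1

/-- Conditions (K0)–(K4) of the Murnaghan–Nakayama rule for `K`-`k`-Schur functions. -/
def Kconds (k r : ℕ) (lam mu : Set Cell) : Prop :=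
  lam ⊆ mu ∧ kconj k lam ⊆ kconj k mu ∧
    (mu \ lam).ncard ≤ r ∧
    IsRibbon (pInv k mu \ pInv k lam) ∧
    (IsKConnectedSet k (residSupp k (pInv k mu \ pInv k lam)) ∨
      (residSupp k (pInv k mu \ pInv k lam)).card < r) ∧
    htSkew (mu \ lam) + htSkew (kconj k mu \ kconj k lam) < r

/-- Conditions (k0)–(k4) of the Murnaghan–Nakayama rule for `k`-Schur functions. -/
def kconds (k r : ℕ) (lam mu : Set Cell) : Prop :=
  lam ⊆ mu ∧ kconj k lam ⊆ kconj k mu ∧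
    (mu \ lam).ncard = r ∧
    IsRibbon (pInv k mu \ pInv k lam) ∧
    IsKConnectedSet k (residSupp k (pInv k mu \ pInv k lam)) ∧
    htSkew (mu \ lam) + htSkew (kconj k mu \ kconj k lam) = r - 1


/-! ## bead sequences -/

def Ad (k : ℕ) (c : Idx k) (f : ℕ → ℤ) (i : ℕ) : Prop :=
  ((f i : ℤ) : Idx k) = c ∧ f i + 1 ∉ Set.range f

def mv (k : ℕ) (c : Idx k) (f : ℕ → ℤ) : ℕ → ℤ :=
  fun i => if Ad k c f i then f i + 1 else f i

def stepF (k : ℕ) (c : Idx k) : Option (ℕ → ℤ) → Option (ℕ → ℤ)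
  | none => none
  | some f => if ∃ i, Ad k c f i then some (mv k c f) else none

def actF (k : ℕ) (u : Word k) (o : Option (ℕ → ℤ)) : Option (ℕ → ℤ) := u.foldr (stepF k) o

lemma one_ne (k : ℕ) (hk : 1 ≤ k) : (1 : Idx k) ≠ 0 := by
  have : Fact (1 < k + 1) := ⟨by omega⟩
  exact one_ne_zero

lemma mem_mv_off {k : ℕ} {c : Idx k} {f : ℕ → ℤ} {z : ℤ} (h1 : (z : Idx k) ≠ c)
    (h2 : (z : Idx k) ≠ c + 1) : z ∈ Set.range (mv k c f) ↔ z ∈ Set.range f := by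
  constructor
  · rintro ⟨i, hi⟩
    unfold mv at hi
    split_ifs at hi with h
    · exfalso; apply h2; rw [← hi, ← h.1]; push_cast; ring
    · exact ⟨i, hi⟩
  · rintro ⟨i, hi⟩
    refine ⟨i, ?_⟩
    unfold mv
    rw [if_neg, hi]
    intro h
    exact h1 (hi ▸ h.1)

lemma mem_mv_c {k : ℕ} (hk : 1 ≤ k) {c : Idx k} {f : ℕ → ℤ} {z : ℤ} (h1 : (z : Idx k) = c) :
    z ∈ Set.range (mv k c f) ↔ z ∈ Set.range f ∧ z + 1 ∈ Set.range f := by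
  have h10 := one_ne k hk
  constructor
  · rintro ⟨i, hi⟩
    unfold mv at hi
    split_ifs at hi with h
    · exfalso
      have := h.1
      rw [← hi] at h1; push_cast at h1
      rw [this] at h1
      simp [h10] at h1
    · refine ⟨⟨i, hi⟩, ?_⟩
      by_contra h3
      exact h ⟨hi ▸ h1, hi ▸ h3⟩
  · rintro ⟨⟨i, hi⟩, h3⟩
    refine ⟨i, ?_⟩
    unfold mv
    rw [if_neg, hi]
    intro h
    exact h.2 (hi ▸ h3)

lemma mem_mv_c1 {k : ℕ} (hk : 1 ≤ k) {c : Idx k} {f : ℕ → ℤ} {z : ℤ} (h1 : (z : Idx k) = c) :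
    z + 1 ∈ Set.range (mv k c f) ↔ z ∈ Set.range f ∨ z + 1 ∈ Set.range f := by
  have h10 := one_ne k hk
  constructor
  · rintro ⟨i, hi⟩
    unfold mv at hi
    split_ifs at hi with h
    · left; exact ⟨i, by linarith⟩
    · right; exact ⟨i, hi⟩
  · intro h
    by_cases h3 : z + 1 ∈ Set.range f
    · obtain ⟨i, hi⟩ := h3
      refine ⟨i, ?_⟩
      unfold mv
      rw [if_neg, hi]
      intro h
      have := h.1
      rw [hi] at this; push_cast at this
      rw [h1] at this
      simp [h10] at this
    · obtain ⟨i, hi⟩ := h.resolve_right h3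
      refine ⟨i, ?_⟩
      unfold mv
      rw [if_pos, hi]
      exact ⟨hi ▸ h1, hi ▸ h3⟩

lemma Ad_mv {k : ℕ} {c d : Idx k} (hcd : c ≠ d) (h1 : d ≠ c + 1) (h2 : c ≠ d + 1)
    (f : ℕ → ℤ) (i : ℕ) : Ad k d (mv k c f) i ↔ Ad k d f i := by
  by_cases h : Ad k c f i
  · have e : mv k c f i = f i + 1 := by simp [mv, h]
    constructor
    · intro h3; exfalso
      have := h3.1
      rw [e] at this; push_cast at this; rw [h.1] at this
      exact h1 this.symm
    · intro h3; exfalso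
      exact hcd (h.1.symm.trans h3.1)
  · have e : mv k c f i = f i := by simp [mv, h]
    unfold Ad
    rw [e]
    constructor
    · rintro ⟨a, b⟩
      refine ⟨a, fun h4 => b ?_⟩
      rw [mem_mv_off]
      · exact h4
      · push_cast; rw [a]; exact fun h => h2 h.symm
      · push_cast; rw [a]; intro h; exact hcd (add_right_cancel h).symm
    · rintro ⟨a, b⟩
      refine ⟨a, fun h4 => b ?_⟩
      rw [mem_mv_off] at h4
      · exact h4
      · push_cast; rw [a]; exact fun h => h2 h.symm
      · push_cast; rw [a]; intro h; exact hcd (add_right_cancel h).symm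

def NA {k : ℕ} (c d : Idx k) : Prop := d ≠ c + 1 ∧ c ≠ d + 1

lemma stepF_comm {k : ℕ} {c d : Idx k} (h : NA c d) (o : Option (ℕ → ℤ)) :
    stepF k c (stepF k d o) = stepF k d (stepF k c o) := by
  by_cases hcd : c = d
  · rw [hcd]
  rcases o with _ | f
  · rfl
  have A1 := Ad_mv hcd h.1 h.2 f
  have A2 := Ad_mv (Ne.symm hcd) h.2 h.1 f
  have E : mv k c (mv k d f) = mv k d (mv k c f) := by
    funext i
    have a1 := A1 i
    have a2 := A2 i
    have n12 : ¬ (Ad k c f i ∧ Ad k d f i) := fun h => hcd (h.1.1.symm.trans h.2.1)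
    show (if Ad k c (mv k d f) i then mv k d f i + 1 else mv k d f i) =
      (if Ad k d (mv k c f) i then mv k c f i + 1 else mv k c f i)
    simp only [a1, a2]
    unfold mv
    by_cases b1 : Ad k c f i <;> by_cases b2 : Ad k d f i <;> simp [b1, b2]
  by_cases e1 : ∃ i, Ad k c f i <;> by_cases e2 : ∃ i, Ad k d f i <;>
    simp [stepF, e1, e2, A1, A2, E]

lemma stepF_sq {k : ℕ} (hk : 1 ≤ k) (c : Idx k) (o : Option (ℕ → ℤ)) :
    stepF k c (stepF k c o) = none := by
  rcases o with _ | f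
  · rfl
  by_cases e1 : ∃ i, Ad k c f i
  · simp only [stepF, e1, if_true]
    rw [if_neg]
    rintro ⟨i, h1, h2⟩
    rw [mem_mv_c1 hk h1] at h2
    apply h2; left
    exact ((mem_mv_c hk h1).1 ⟨i, rfl⟩).1
  · simp [stepF, e1]

lemma actF_append {k : ℕ} (u v : Word k) (o) : actF k (u ++ v) o = actF k u (actF k v o) := by
  simp [actF, List.foldr_append]

lemma actF_cons {k : ℕ} (c) (v : Word k) (o) : actF k (c :: v) o = stepF k c (actF k v o) := rfl

lemma actF_none {k : ℕ} (v : Word k) : actF k v none = none := by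
  induction v with
  | nil => rfl
  | cons c v ih => rw [actF_cons, ih]; rfl

lemma actF_comm1 {k : ℕ} {c : Idx k} {v : Word k} (h : ∀ d ∈ v, NA c d) (o) :
    actF k (c :: v) o = actF k (v ++ [c]) o := by
  induction v with
  | nil => rfl
  | cons d v ih =>
    rw [actF_cons, actF_cons, stepF_comm (h d (by simp)), ← actF_cons c,
      ih (fun d hd => h d (by simp [hd]))]
    rfl

lemma actF_comm {k : ℕ} {u v : Word k} (h : ∀ c ∈ u, ∀ d ∈ v, NA c d) (o) :
    actF k (u ++ v) o = actF k (v ++ u) o := by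
  induction u generalizing o with
  | nil => simp
  | cons c u ih =>
    rw [List.cons_append, actF_cons, ih (fun c hc => h c (by simp [hc])), ← actF_cons,
      ← List.cons_append, actF_append, actF_comm1 (h c (by simp)), ← actF_append]
    simp

/-! ## window counts -/

def Dg (f : ℕ → ℤ) (z : ℤ) : ℤ := if z ∈ Set.range f then 0 else 1

def FF (k : ℕ) (f : ℕ → ℤ) (x : ℤ) : ℤ := ∑ t ∈ Finset.range (k + 1), Dg f (x - 1 - t)

lemma FF_succ (k : ℕ) (f : ℕ → ℤ) (x : ℤ) :
    FF k f (x + 1) = FF k f x + Dg f x - Dg f (x - (k + 1)) := by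
  unfold FF
  rw [Finset.sum_range_succ', Finset.sum_range_succ]
  have : ∀ t : ℕ, (x + 1 - 1 - ((t + 1 : ℕ) : ℤ)) = x - 1 - t := by intro t; push_cast; ring
  simp only [this]
  have e1 : x + 1 - 1 - ((0 : ℕ) : ℤ) = x := by simp
  have e2 : x - 1 - (k : ℤ) = x - (k + 1) := by ring
  rw [e1, e2]; ring

lemma Dg_of_mem {f : ℕ → ℤ} {z : ℤ} (h : z ∈ Set.range f) : Dg f z = 0 := by simp only [Dg, h, if_true]
lemma Dg_of_not {f : ℕ → ℤ} {z : ℤ} (h : z ∉ Set.range f) : Dg f z = 1 := by simp only [Dg, h, if_false]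
lemma Dg_nonneg (f : ℕ → ℤ) (z : ℤ) : 0 ≤ Dg f z := by unfold Dg; split_ifs <;> simp
lemma Dg_le (f : ℕ → ℤ) (z : ℤ) : Dg f z ≤ 1 := by unfold Dg; split_ifs <;> simp

lemma cast_n (k : ℕ) : (((k : ℤ) + 1 : ℤ) : Idx k) = 0 := by
  have := ZMod.natCast_self (k + 1)
  push_cast at *; exact this

lemma cast_sub_n (k : ℕ) (z : ℤ) : ((z - (k + 1) : ℤ) : Idx k) = z := by
  rw [Int.cast_sub, cast_n]; simp

lemma FF_mv {k : ℕ} (hk : 1 ≤ k) (c : Idx k) (f : ℕ → ℤ) (x : ℤ) (hx : (x : Idx k) ≠ c + 1)  :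
    FF k (mv k c f) x = FF k f x := by
  have h10 := one_ne k hk
  rw [← sub_eq_zero]
  unfold FF
  rw [← Finset.sum_sub_distrib]
  let z : ℕ → ℤ := fun t => x - 1 - t
  refine Finset.sum_involution
    (fun t _ => if ((z t : ℤ) : Idx k) = c then t - 1 else if ((z t : ℤ) : Idx k) = c + 1 then t + 1 else t)
    ?_ ?_ ?_ ?_
  · intro t ht
    by_cases h1 : ((z t : ℤ) : Idx k) = c
    · have ht0 : t ≠ 0 := by
        rintro rfl
        apply hx; rw [← h1]; simp [z]
      have e : z (t - 1) = z t + 1 := by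
        simp only [z]; rw [Nat.cast_sub (by omega)]; push_cast; ring
      simp only [h1, if_true]
      show Dg _ (z t) - Dg _ (z t) + (Dg _ (z (t-1)) - Dg _ (z (t-1))) = 0
      rw [e]
      unfold Dg
      simp only [mem_mv_c hk h1, mem_mv_c1 hk h1]
      by_cases a : z t ∈ Set.range f <;> by_cases b : z t + 1 ∈ Set.range f <;> simp [a, b]
    · by_cases h2 : ((z t : ℤ) : Idx k) = c + 1
      · have h1' : ((z t - 1 : ℤ) : Idx k) = c := by push_cast; rw [h2]; ring
        have e : z (t + 1) = z t - 1 := by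
          simp only [z]; push_cast; ring
        simp only [h2, if_true]
        rw [if_neg (by simpa using h10)]
        show Dg _ (z t) - Dg _ (z t) + (Dg _ (z (t+1)) - Dg _ (z (t+1))) = 0
        rw [e]
        have e3 : z t = (z t - 1) + 1 := by ring
        unfold Dg
        have m1 := mem_mv_c (f := f) hk h1'
        have m2 := mem_mv_c1 (f := f) hk h1'
        rw [← e3] at m1 m2
        simp only [m1, m2]
        by_cases a : z t ∈ Set.range f <;> by_cases b : z t - 1 ∈ Set.range f <;> simp [a, b]
      · simp only [h1, h2, if_false]
        show Dg _ (z t) - Dg _ (z t) + (Dg _ (z t) - Dg _ (z t)) = 0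
        unfold Dg
        simp only [mem_mv_off h1 h2]
        simp
  · intro t ht hne
    by_cases h1 : ((z t : ℤ) : Idx k) = c
    · have ht0 : t ≠ 0 := by
        rintro rfl
        apply hx; rw [← h1]; simp [z]
      simp only [h1, if_true]; omega
    · by_cases h2 : ((z t : ℤ) : Idx k) = c + 1
      · simp only [h2, if_true]
        rw [if_neg (by simpa using h10)]; omega
      · exfalso; apply hne
        show Dg _ (z t) - Dg _ (z t) = 0
        unfold Dg
        simp only [mem_mv_off h1 h2]
        simp
  · intro t ht
    rw [Finset.mem_range] at ht ⊢
    split_ifs with h1 h2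
    · omega
    · by_contra h3
      have : t = k := by omega
      subst this
      apply hx
      rw [← h2]
      simp only [z]
      rw [show x - 1 - (t : ℤ) = x - (t + 1) by ring, cast_sub_n]
    · omega
  · intro t ht
    by_cases h1 : ((z t : ℤ) : Idx k) = c
    · have ht0 : t ≠ 0 := by
        rintro rfl
        apply hx; rw [← h1]; simp [z]
      have e : z (t - 1) = z t + 1 := by
        simp only [z]; rw [Nat.cast_sub (by omega)]; push_cast; ring
      simp only [h1, if_true]
      rw [e]
      push_cast; rw [h1]
      rw [if_neg (by simpa using h10)]
      simp; omega
    · by_cases h2 : ((z t : ℤ) : Idx k) = c + 1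
      · have h1' : ((z t - 1 : ℤ) : Idx k) = c := by push_cast; rw [h2]; ring
        have e : z (t + 1) = z t - 1 := by
          simp only [z]; push_cast; ring
        have h3 : ¬ (c + 1 = c) := by simpa using h10
        simp only [h2, if_true, h3, if_false]
        rw [e, h1']; simp
      · simp only [h1, h2, if_false]

/-- bounded partition row -/
def PP (k : ℕ) (f : ℕ → ℤ) (i : ℕ) : ℤ := FF k f (f i)

structure Bd (k : ℕ) (f : ℕ → ℤ) : Prop where
  anti : StrictAnti f
  ev : ∃ N : ℕ, ∀ i ≥ N, f i = -(i : ℤ)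
  core : ∀ z ∈ Set.range f, z - (k + 1) ∈ Set.range f

lemma Bd.core_mul {k : ℕ} {f : ℕ → ℤ} (h : Bd k f) {z : ℤ} (hz : z ∈ Set.range f) (m : ℕ) :
    z - m * (k + 1) ∈ Set.range f := by
  induction m with
  | zero => simpa using hz
  | succ m ih =>
    have := h.core _ ih
    convert this using 1; push_cast; ring

lemma Bd.core_le {k : ℕ} {f : ℕ → ℤ} (h : Bd k f) {z w : ℤ} (hz : z ∈ Set.range f)
    (hw : (w : Idx k) = z) (hle : w ≤ z) : w ∈ Set.range f := by
  have h1 : ((z - w : ℤ) : ZMod (k+1)) = 0 := by push_cast; rw [hw]; ring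
  rw [ZMod.intCast_zmod_eq_zero_iff_dvd] at h1
  obtain ⟨m, hm⟩ := h1
  push_cast at hm
  have hm0 : 0 ≤ m := by
    by_contra h
    push Not at h
    nlinarith
  obtain ⟨m', rfl⟩ := Int.eq_ofNat_of_zero_le hm0
  have := h.core_mul hz m'
  convert this using 1; linarith

lemma Bd.dich {k : ℕ} {f : ℕ → ℤ} (h : Bd k f) {c : Idx k} (he : ∃ i, Ad k c f i) {z : ℤ}
    (hz : (z : Idx k) = c) (h1 : z + 1 ∈ Set.range f) : z ∈ Set.range f := by
  obtain ⟨i, hi1, hi2⟩ := he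
  by_cases hle : z ≤ f i
  · exact h.core_le ⟨i, rfl⟩ (hz.trans hi1.symm) hle
  · exfalso; apply hi2
    apply h.core_le h1
    · push_cast; rw [hz, hi1]
    · linarith

lemma Ad_mv_pos {k : ℕ} {c : Idx k} {f : ℕ → ℤ} {i : ℕ} (h : Ad k c f i) : mv k c f i = f i + 1 := by
  simp [mv, h]
lemma Ad_mv_neg {k : ℕ} {c : Idx k} {f : ℕ → ℤ} {i : ℕ} (h : ¬ Ad k c f i) : mv k c f i = f i := by
  simp [mv, h]

lemma PP_mv {k : ℕ} (hk : 1 ≤ k) {c : Idx k} {f : ℕ → ℤ} (h : Bd k f) (he : ∃ i, Ad k c f i) (j : ℕ) :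
    PP k (mv k c f) j =
      PP k f j + if Ad k c f j ∧ f j + 1 - (k + 1) ∈ Set.range f then 1 else 0 := by
  have h10 := one_ne k hk
  unfold PP
  by_cases hj : Ad k c f j
  · rw [Ad_mv_pos hj, FF_succ, FF_mv hk _ _ _ (by rw [hj.1]; simpa using h10)]
    have m1 : f j ∉ Set.range (mv k c f) := by
      rw [mem_mv_c hk hj.1]; exact fun h => hj.2 h.2
    rw [Dg_of_not m1]
    have e : f j + 1 - ((k : ℤ) + 1) = f j - (k + 1) + 1 := by ring
    have m2 := mem_mv_c (f := f) hk (show ((f j - (k + 1) : ℤ) : Idx k) = c by rw [cast_sub_n]; exact hj.1)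
    have m3 := h.core _ ⟨j, rfl⟩
    simp only [m3, true_and] at m2
    rw [e]
    unfold Dg
    simp only [m2, hj, true_and]
    split_ifs <;> ring
  · rw [Ad_mv_neg hj]
    simp only [hj, false_and, if_false, add_zero]
    by_cases hc : ((f j : ℤ) : Idx k) = c + 1
    · have e : f j = (f j - 1) + 1 := by ring
      have hc' : ((f j - 1 : ℤ) : Idx k) = c := by push_cast; rw [hc]; ring
      rw [e, FF_succ, FF_succ, FF_mv hk _ _ _ (by rw [hc']; simpa using h10)]
      have a1 : f j - 1 ∈ Set.range f := h.dich he hc' ⟨j, by ring⟩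
      have a2 := h.core _ a1
      have b1 : f j - 1 ∈ Set.range (mv k c f) := (mem_mv_c hk hc').2 ⟨a1, ⟨j, by ring⟩⟩
      have b2 : f j - 1 - (k + 1) ∈ Set.range (mv k c f) := by
        rw [mem_mv_c hk (by rw [cast_sub_n]; exact hc')]
        refine ⟨a2, ?_⟩
        have := h.core _ (⟨j, rfl⟩ : f j ∈ Set.range f)
        convert this using 1; ring
      rw [Dg_of_mem a1, Dg_of_mem a2, Dg_of_mem b1, Dg_of_mem b2]
    · rw [FF_mv hk _ _ _ hc]

lemma Bd.low {k : ℕ} {f : ℕ → ℤ} (h : Bd k f) (i : ℕ) : -(i : ℤ) ≤ f i := by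
  obtain ⟨N, hN⟩ := h.ev
  have key : ∀ m : ℕ, f (i + m) ≤ f i - m := by
    intro m
    induction m with
    | zero => simp
    | succ m ih =>
      have := h.anti (show i + m < i + (m + 1) by omega)
      push_cast; linarith
  have := key N
  rw [hN (i + N) (by omega)] at this
  push_cast at this; linarith

lemma Bd.anti_le {k : ℕ} {f : ℕ → ℤ} (h : Bd k f) {i j : ℕ} (hij : i ≤ j) : f j + (j - i : ℤ) ≤ f i := by
  obtain ⟨m, rfl⟩ := Nat.exists_eq_add_of_le hij
  induction m with
  | zero => simp
  | succ m ih =>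
    have := h.anti (show i + m < i + (m + 1) by omega)
    have := ih (by omega)
    push_cast at *; linarith

lemma Bd.mv {k : ℕ} (hk : 1 ≤ k) {c : Idx k} {f : ℕ → ℤ} (h : Bd k f) (he : ∃ i, Ad k c f i) :
    Bd k (mv k c f) := by
  have h10 := one_ne k hk
  constructor
  · intro i j hij
    have h1 := h.anti hij
    by_cases hj : Ad k c f j
    · rw [Ad_mv_pos hj]
      have h2 : f j + 1 ≠ f i := fun h => hj.2 ⟨i, h.symm⟩
      by_cases hi : Ad k c f i
      · rw [Ad_mv_pos hi]; linarith
      · rw [Ad_mv_neg hi]; omega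
    · rw [Ad_mv_neg hj]
      by_cases hi : Ad k c f i
      · rw [Ad_mv_pos hi]; linarith
      · rw [Ad_mv_neg hi]; omega
  · obtain ⟨N, hN⟩ := h.ev
    refine ⟨N + 1, fun i hi => ?_⟩
    rw [Ad_mv_neg, hN i (by omega)]
    intro h
    apply h.2
    refine ⟨i - 1, ?_⟩
    rw [hN i (by omega), hN (i - 1) (by omega), Nat.cast_sub (by omega)]; push_cast; ring
  · intro z hz
    by_cases h1 : (z : Idx k) = c
    · rw [mem_mv_c hk h1] at hz
      rw [mem_mv_c hk (by rw [cast_sub_n]; exact h1)]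
      refine ⟨h.core _ hz.1, ?_⟩
      have := h.core _ hz.2
      convert this using 1; ring
    · by_cases h2 : (z : Idx k) = c + 1
      · have hc' : ((z - 1 : ℤ) : Idx k) = c := by push_cast; rw [h2]; ring
        have := mem_mv_c1 (f := f) hk hc'
        rw [sub_add_cancel] at this
        rw [this] at hz
        have := mem_mv_c1 (f := f) hk (show ((z - 1 - (k + 1) : ℤ) : Idx k) = c by rw [cast_sub_n]; exact hc')
        rw [show z - 1 - ((k : ℤ) + 1) + 1 = z - (k + 1) by ring] at this
        rw [this]
        rcases hz with hz | hz
        · left; exact h.core _ hz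
        · right; exact h.core _ hz
      · rw [mem_mv_off h1 h2] at hz
        rw [mem_mv_off (by rw [cast_sub_n]; exact h1) (by rw [cast_sub_n]; exact h2)]
        exact h.core _ hz

/-- the row of the lowest addable `c`-corner -/
def Low (k : ℕ) (c : Idx k) (f : ℕ → ℤ) (i : ℕ) : Prop :=
  Ad k c f i ∧ f i + 1 - (k + 1) ∈ Set.range f

lemma Low_unique {k : ℕ} {c : Idx k} {f : ℕ → ℤ} (h : Bd k f) {i j : ℕ}
    (hi : Low k c f i) (hj : Low k c f j) : i = j := by
  have key : ∀ i j, Low k c f i → Low k c f j → ¬ i < j := by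
    intro i j hi hj hij
    have h1 := h.anti hij
    apply hj.1.2
    apply h.core_le hi.2
    · rw [cast_sub_n]; push_cast; rw [hi.1.1, hj.1.1]
    · have h2 : ((f i - f j : ℤ) : ZMod (k+1)) = 0 := by push_cast; rw [hi.1.1, hj.1.1]; ring
      rw [ZMod.intCast_zmod_eq_zero_iff_dvd] at h2
      have := Int.le_of_dvd (by linarith) h2
      push_cast at this
      linarith
  have a := key i j hi hj
  have b := key j i hj hi
  omega

lemma Low_exists {k : ℕ} {c : Idx k} {f : ℕ → ℤ} (h : Bd k f) (he : ∃ i, Ad k c f i) :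
    ∃ i, Low k c f i := by
  obtain ⟨N, hN⟩ := h.ev
  have hb : ∀ i, Ad k c f i → i ≤ N := by
    intro i hi
    by_contra hlt
    apply hi.2
    refine ⟨i - 1, ?_⟩
    rw [hN i (by omega), hN (i - 1) (by omega), Nat.cast_sub (by omega)]; push_cast; ring
  obtain ⟨i0, hi0⟩ := he
  let i := Nat.findGreatest (Ad k c f) N
  have hi : Ad k c f i := Nat.findGreatest_spec (hb i0 hi0) hi0
  refine ⟨i, hi, ?_⟩
  obtain ⟨j, hj⟩ := h.core _ (⟨i, rfl⟩ : f i ∈ Set.range f)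
  have hij : i < j := by
    by_contra h1
    have := h.anti.antitone (show j ≤ i by omega)
    linarith
  by_contra h2
  have : Ad k c f j := by
    refine ⟨?_, ?_⟩
    · rw [hj, cast_sub_n]; exact hi.1
    · rw [hj]; convert h2 using 2; ring
  have := Nat.le_findGreatest (hb j this) this
  omega

lemma PP_mv_low {k : ℕ} (hk : 1 ≤ k) {c : Idx k} {f : ℕ → ℤ} (h : Bd k f) {i : ℕ} (hi : Low k c f i) (j : ℕ) :
    PP k (MN.mv k c f) j = PP k f j + if j = i then 1 else 0 := by
  rw [PP_mv hk h ⟨i, hi.1⟩]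
  congr 1
  by_cases hj : j = i
  · subst hj; rw [if_pos rfl]; exact if_pos hi
  · rw [if_neg hj, if_neg]
    intro h2; exact hj (Low_unique h h2 hi)

/-! ## monotonicity of rows, injectivity, surjectivity -/

lemma FF_congr {k : ℕ} {f g : ℕ → ℤ} {x : ℤ} (h : ∀ z < x, z ∈ Set.range f ↔ z ∈ Set.range g) :
    FF k f x = FF k g x := by
  unfold FF
  refine Finset.sum_congr rfl fun t _ => ?_
  unfold Dg
  simp only [h (x - 1 - t) (by omega)]

lemma FF_after {k : ℕ} {f : ℕ → ℤ} (h : Bd k f) (i : ℕ) : FF k f (f i + 1) = PP k f i := by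
  rw [FF_succ, Dg_of_mem ⟨i, rfl⟩, Dg_of_mem (h.core _ ⟨i, rfl⟩)]
  unfold PP; ring

lemma FF_mono {k : ℕ} {f : ℕ → ℤ} {x y : ℤ} (hxy : x ≤ y) (hg : ∀ z, x ≤ z → z < y → z ∉ Set.range f) :
    FF k f x ≤ FF k f y := by
  obtain ⟨m, rfl⟩ := Int.le.dest hxy
  induction m with
  | zero => simp
  | succ m ih =>
    have h1 := ih (by omega) (fun z h1 h2 => hg z h1 (by push_cast; omega))
    have h2 : x + ((m + 1 : ℕ) : ℤ) = (x + m) + 1 := by push_cast; ring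
    rw [h2, FF_succ, Dg_of_not (hg (x + m) (by omega) (by push_cast; omega))]
    have := Dg_le f (x + m - (k + 1))
    linarith

lemma Bd.gap_between {k : ℕ} {f : ℕ → ℤ} (h : Bd k f) {i : ℕ} {z : ℤ} (h1 : f (i + 1) < z) (h2 : z < f i) :
    z ∉ Set.range f := by
  rintro ⟨j, rfl⟩
  have a := h.anti.lt_iff_gt.1 h1
  have b := h.anti.lt_iff_gt.1 h2
  omega

lemma PP_anti {k : ℕ} {f : ℕ → ℤ} (h : Bd k f) : Antitone (PP k f) := by
  refine antitone_nat_of_succ_le fun i => ?_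
  rw [← FF_after h]
  apply FF_mono
  · have := h.anti (Nat.lt_succ_self i); simp only [Nat.succ_eq_add_one] at this; omega
  · intro z h1 h2
    exact h.gap_between (by omega) h2

lemma FF_nonneg (k : ℕ) (f : ℕ → ℤ) (x : ℤ) : 0 ≤ FF k f x :=
  Finset.sum_nonneg fun _ _ => Dg_nonneg _ _

lemma PP_nonneg (k : ℕ) (f : ℕ → ℤ) (i : ℕ) : 0 ≤ PP k f i := FF_nonneg _ _ _

lemma PP_le {k : ℕ} {f : ℕ → ℤ} (h : Bd k f) (i : ℕ) : PP k f i ≤ k := by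
  unfold PP FF
  rw [Finset.sum_range_succ, Dg_of_mem]
  · calc _ ≤ ∑ t ∈ Finset.range k, (1 : ℤ) + 0 := by
          gcongr with t; exact Dg_le _ _
      _ = k := by simp
  · have := h.core _ (⟨i, rfl⟩ : f i ∈ Set.range f)
    convert this using 1; ring

lemma PP_zero {k : ℕ} {f : ℕ → ℤ} {N : ℕ} (hN : ∀ i ≥ N, f i = -(i : ℤ)) (i : ℕ) (hi : N ≤ i) :
    PP k f i = 0 := by
  unfold PP FF
  refine Finset.sum_eq_zero fun t _ => Dg_of_mem ⟨i + 1 + t, ?_⟩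
  rw [hN i hi, hN _ (by omega)]; push_cast; ring

lemma PP_inj {k : ℕ} {f g : ℕ → ℤ} (hf : Bd k f) (hg : Bd k g) (h : PP k f = PP k g) : f = g := by
  obtain ⟨N, hN⟩ := hf.ev
  obtain ⟨M, hM⟩ := hg.ev
  have step : ∀ (f g : ℕ → ℤ), Bd k f → Bd k g → PP k f = PP k g → ∀ i, (∀ j > i, f j = g j) →
      ¬ f i < g i := by
    intro f g hf hg h i hj hlt
    have h1 : f (i + 1) < f i := hf.anti (Nat.lt_succ_self i)
    have a : FF k g (f i) = FF k f (f i) := by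
      apply FF_congr
      intro z hz
      constructor
      · rintro ⟨j, rfl⟩
        have : i < j := hg.anti.lt_iff_gt.1 (by linarith)
        exact ⟨j, hj j this⟩
      · rintro ⟨j, rfl⟩
        have : i < j := hf.anti.lt_iff_gt.1 (by linarith)
        exact ⟨j, (hj j this).symm⟩
    have gapz : ∀ z, f i ≤ z → z < g i → z ∉ Set.range g := by
      intro z h2 h3
      apply hg.gap_between (i := i) _ h3
      rw [← hj (i + 1) (by omega)]; linarith
    have b := FF_succ k g (f i)
    rw [Dg_of_not (gapz _ le_rfl hlt), Dg_of_mem] at b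
    · have c := FF_mono (k := k) (f := g) (show f i + 1 ≤ g i by omega)
        (fun z h1 h2 => gapz z (by omega) h2)
      have d := congrFun h i
      unfold PP at d
      linarith
    · obtain ⟨j, hj'⟩ := hf.core _ (⟨i, rfl⟩ : f i ∈ Set.range f)
      have : i < j := hf.anti.lt_iff_gt.1 (by rw [hj']; linarith)
      exact ⟨j, by rw [← hj j this, hj']⟩
  have key : ∀ m : ℕ, ∀ j, max N M - m ≤ j → f j = g j := by
    intro m
    induction m with
    | zero => intro j hj; rw [hN j (by omega), hM j (by omega)]
    | succ m ih =>
      intro j hj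
      by_cases hc : max N M - m ≤ j
      · exact ih j hc
      · have h1 := step f g hf hg h j (fun j' hj' => ih j' (by omega))
        have h2 := step g f hg hf h.symm j (fun j' hj' => (ih j' (by omega)).symm)
        omega
  funext j
  exact key (max N M) j (by omega)

lemma shift_mem {f : ℕ → ℤ} {y : ℤ} {z : ℤ} (hz : z < y) :
    (z ∈ Set.range (fun i : ℕ => Nat.casesOn i y (fun i => f i - 1) : ℕ → ℤ)) ↔ z + 1 ∈ Set.range f := by
  constructor
  · rintro ⟨i, hi⟩
    rcases i with _ | i
    · simp at hi; omega
    · exact ⟨i, by simp at hi; omega⟩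
  · rintro ⟨i, hi⟩
    exact ⟨i + 1, by simp; omega⟩

lemma PP_surj {k : ℕ} (N : ℕ) : ∀ (l : ℕ → ℤ), Antitone l → (∀ i, 0 ≤ l i) → (∀ i, l i ≤ k) → (∀ i ≥ N, l i = 0) →
    ∃ f, Bd k f ∧ PP k f = l := by
  induction N with
  | zero =>
    intro l _ _ _ h0
    refine ⟨fun i => -(i : ℤ), ⟨?_, ⟨0, fun i _ => rfl⟩, ?_⟩, ?_⟩
    · intro i j hij; simp; exact hij
    · rintro z ⟨i, rfl⟩
      exact ⟨i + (k + 1), by push_cast; ring⟩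
    · funext i
      rw [PP_zero (N := 0) (fun i _ => rfl) i (by omega), h0 i (by omega)]
  | succ N ih =>
    intro l hl h0 hk h00
    obtain ⟨f, hf, hP⟩ := ih (fun i => l (i + 1)) (fun i j hij => hl (by omega)) (fun i => h0 _)
      (fun i => hk _) (fun i hi => h00 _ (by omega))
    have top : ∀ z, f 0 < z → z ∉ Set.range f := by
      rintro z hz ⟨j, rfl⟩
      have := hf.anti.lt_iff_gt.1 hz; omega
    -- find y
    have hend : FF k f (f 0 + k + 1) = k := by
      unfold FF
      rw [Finset.sum_range_succ, Dg_of_mem ⟨0, by ring⟩]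
      rw [Finset.sum_congr rfl (g := fun _ => (1 : ℤ))]
      · simp
      · intro t ht
        rw [Finset.mem_range] at ht
        exact Dg_of_not (top _ (by omega))
    have hst : FF k f (f 0 + 1) = l 1 := by
      rw [FF_after hf, hP]
    obtain ⟨y, hy1, hy2, hy3⟩ : ∃ y, f 0 < y ∧ y - (k + 1) ∈ Set.range f ∧ FF k f y = l 0 := by
      let Q : ℕ → Prop := fun m => FF k f (f 0 + 1 + m) ≤ l 0
      have hQ0 : Q 0 := by
        show FF k f (f 0 + 1 + (0 : ℕ)) ≤ l 0
        simp only [Nat.cast_zero, add_zero]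
        rw [hst]; exact hl (by omega)
      let m := Nat.findGreatest Q k
      have hm : Q m := Nat.findGreatest_spec (P := Q) (Nat.zero_le k) hQ0
      have hmk : m ≤ k := Nat.findGreatest_le k
      by_cases hmk' : m = k
      · refine ⟨f 0 + k + 1, by omega, ⟨0, by ring⟩, ?_⟩
        have : FF k f (f 0 + 1 + m) ≤ l 0 := hm
        rw [hmk', show f 0 + 1 + (k : ℤ) = f 0 + k + 1 by ring, hend] at this
        rw [hend]; exact le_antisymm this (hk 0)
      · have hn : ¬ Q (m + 1) := Nat.findGreatest_is_greatest (Nat.lt_succ_self m) (by omega)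
        have hn' : ¬ FF k f (f 0 + 1 + ((m + 1 : ℕ) : ℤ)) ≤ l 0 := hn
        have hm' : FF k f (f 0 + 1 + m) ≤ l 0 := hm
        rw [show f 0 + 1 + ((m + 1 : ℕ) : ℤ) = (f 0 + 1 + m) + 1 by push_cast; ring, FF_succ,
          Dg_of_not (top _ (by omega))] at hn'
        by_cases hr : f 0 + 1 + (m : ℤ) - (k + 1) ∈ Set.range f
        · rw [Dg_of_mem hr] at hn'
          exact ⟨f 0 + 1 + m, by omega, hr, by omega⟩
        · rw [Dg_of_not hr] at hn'; omega
    refine ⟨fun i => Nat.casesOn i (y - 1 + 1 - 1) (fun i => f i - 1), ⟨?_, ?_, ?_⟩, ?_⟩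
    · refine strictAnti_nat_of_succ_lt fun i => ?_
      rcases i with _ | i
      · simp; omega
      · simp; exact hf.anti (Nat.lt_succ_self i)
    · obtain ⟨M, hM⟩ := hf.ev
      refine ⟨M + 1, fun i hi => ?_⟩
      rcases i with _ | i
      · omega
      · simp only; rw [hM i (by omega)]; push_cast; ring
    · rintro z ⟨i, rfl⟩
      have key : ∀ z : ℤ, z ≤ y - 1 → z - (k + 1) + 1 ∈ Set.range f → z - (k + 1) ∈
        (Set.range (fun i : ℕ => Nat.casesOn i (y - 1 + 1 - 1) (fun i => f i - 1) : ℕ → ℤ)) := by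
        intro z hz hh
        rw [shift_mem (by omega)]; exact hh
      rcases i with _ | i
      · apply key
        · simp
        · show y - 1 + 1 - 1 - ((k : ℤ) + 1) + 1 ∈ Set.range f
          convert hy2 using 1; ring
      · apply key
        · have := hf.anti.antitone (Nat.zero_le i)
          show f i - 1 ≤ y - 1
          omega
        · have := hf.core _ ⟨i, rfl⟩
          convert this using 1; simp; ring
    · have key : ∀ z : ℤ, z ≤ y - 1 →
          FF k (fun i : ℕ => Nat.casesOn i (y - 1 + 1 - 1) (fun i => f i - 1) : ℕ → ℤ) z = FF k f (z + 1) := by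
        intro z hz
        unfold FF
        refine Finset.sum_congr rfl fun t _ => ?_
        unfold Dg
        have := shift_mem (f := f) (y := y - 1 + 1 - 1) (z := z - 1 - t) (by omega)
        simp only [this]
        rw [show z - 1 - (t : ℤ) + 1 = z + 1 - 1 - t by ring]
      funext i
      rcases i with _ | i
      · show FF k _ (y - 1 + 1 - 1) = l 0
        rw [key _ (by omega), ← hy3]; congr 1; ring
      · have := hf.anti.antitone (Nat.zero_le i)
        show FF k _ (f i - 1) = l (i + 1)
        rw [key _ (by omega)]
        have := congrFun hP i
        rw [← this]; unfold PP; congr 1; ring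

/-! ## diagrams -/

def SS (f : ℕ → ℤ) : Set Cell := {c | (c.2 : ℤ) - c.1 < f c.1}

structure Bd0 (f : ℕ → ℤ) : Prop where
  anti : StrictAnti f
  ev : ∃ N : ℕ, ∀ i ≥ N, f i = -(i : ℤ)

lemma Bd.toBd0 {k : ℕ} {f : ℕ → ℤ} (h : Bd k f) : Bd0 f := ⟨h.anti, h.ev⟩

lemma Bd0.anti_le {f : ℕ → ℤ} (h : Bd0 f) {i j : ℕ} (hij : i ≤ j) : f j + (j - i : ℤ) ≤ f i := by
  obtain ⟨m, rfl⟩ := Nat.exists_eq_add_of_le hij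
  induction m with
  | zero => simp
  | succ m ih =>
    have := h.anti (show i + m < i + (m + 1) by omega)
    have := ih (by omega)
    push_cast at *; linarith

lemma Bd0.low {f : ℕ → ℤ} (h : Bd0 f) (i : ℕ) : -(i : ℤ) ≤ f i := by
  obtain ⟨N, hN⟩ := h.ev
  have := h.anti_le (show i ≤ i + N by omega)
  rw [hN (i + N) (by omega)] at this
  push_cast at this; linarith

/-- row length -/
def rho (f : ℕ → ℤ) (i : ℕ) : ℕ := (f i + i).toNat

lemma Bd0.rho_eq {f : ℕ → ℤ} (h : Bd0 f) (i : ℕ) : (rho f i : ℤ) = f i + i := by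
  have := h.low i
  unfold rho; omega

lemma Bd0.mem_SS {f : ℕ → ℤ} (h : Bd0 f) (i j : ℕ) : (i, j) ∈ SS f ↔ j < rho f i := by
  have := h.rho_eq i
  show (j : ℤ) - i < f i ↔ _
  omega

lemma Bd0.rho_anti {f : ℕ → ℤ} (h : Bd0 f) : Antitone (rho f) := by
  intro i j hij
  have := h.rho_eq i
  have := h.rho_eq j
  have := h.anti_le hij
  omega

lemma young_of_rows (l : ℕ → ℕ) (hl : Antitone l) (N : ℕ) (hN : ∀ i ≥ N, l i = 0) :
    IsYoung {c : Cell | c.2 < l c.1} := by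
  constructor
  · refine Set.Finite.subset (Set.Finite.prod (Set.finite_lt_nat N) (Set.finite_lt_nat (l 0))) ?_
    rintro ⟨i, j⟩ h
    simp only [Set.mem_ofPred_eq] at h
    have := hl (Nat.zero_le i)
    refine ⟨?_, ?_⟩
    · by_contra h2
      simp only [Set.mem_ofPred_eq] at h2
      rw [hN i (by omega)] at h; omega
    · show j < l 0
      omega
  · rintro ⟨i, j⟩ h ⟨i', j'⟩ h1 h2
    simp only [Set.mem_ofPred_eq] at *
    have := hl h1
    omega

lemma Bd0.SS_eq {f : ℕ → ℤ} (h : Bd0 f) : SS f = {c : Cell | c.2 < rho f c.1} := by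
  ext ⟨i, j⟩; exact h.mem_SS i j

lemma Bd0.rho_zero {f : ℕ → ℤ} (h : Bd0 f) : ∃ N, ∀ i ≥ N, rho f i = 0 := by
  obtain ⟨N, hN⟩ := h.ev
  refine ⟨N, fun i hi => ?_⟩
  have := h.rho_eq i
  rw [hN i hi] at this; omega

lemma Bd0.young {f : ℕ → ℤ} (h : Bd0 f) : IsYoung (SS f) := by
  rw [h.SS_eq]
  obtain ⟨N, hN⟩ := h.rho_zero
  exact young_of_rows _ h.rho_anti N hN

lemma rows_of_young {S : Set Cell} (h : IsYoung S) : ∃ l : ℕ → ℕ, Antitone l ∧ (∃ N, ∀ i ≥ N, l i = 0) ∧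
    S = {c : Cell | c.2 < l c.1} := by
  obtain ⟨hfin, hlow⟩ := h
  have hrow : ∀ i, {j | (i, j) ∈ S}.Finite := by
    intro i
    refine Set.Finite.subset (hfin.image Prod.snd) ?_
    intro j hj; exact ⟨(i, j), hj, rfl⟩
  have hex : ∀ i, ∃ m, ∀ j, (i, j) ∈ S ↔ j < m := by
    intro i
    have hb : ∃ j, (i, j) ∉ S := by
      obtain ⟨j, hj⟩ := (hrow i).exists_notMem
      exact ⟨j, hj⟩
    refine ⟨Nat.find hb, fun j => ⟨fun hj => ?_, fun hj => ?_⟩⟩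
    · by_contra h2
      exact Nat.find_spec hb (hlow _ hj (i, Nat.find hb) le_rfl (by simpa using h2))
    · by_contra h2; exact Nat.find_min hb hj h2
  choose l hl using hex
  refine ⟨l, ?_, ?_, ?_⟩
  · intro i i' hii
    by_contra h2
    have h3 : (i', l i) ∈ S := (hl i' (l i)).2 (by omega)
    have := hlow _ h3 (i, l i) hii le_rfl
    rw [hl] at this; omega
  · obtain ⟨N, hN⟩ := (hfin.image Prod.fst).exists_notMem
    refine ⟨N, fun i hi => ?_⟩
    by_contra h2
    apply hN
    refine ⟨(N, 0), ?_, rfl⟩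
    exact hlow (i, 0) ((hl i 0).2 (by omega)) _ hi le_rfl
  · ext ⟨i, j⟩; exact hl i j

lemma SS_of_young {S : Set Cell} (h : IsYoung S) : ∃ f, Bd0 f ∧ SS f = S := by
  obtain ⟨l, hl, ⟨N, hN⟩, rfl⟩ := rows_of_young h
  refine ⟨fun i => (l i : ℤ) - i, ⟨?_, N, fun i hi => by simp [hN i hi]⟩, ?_⟩
  · intro i j hij
    have := hl hij.le
    simp only; omega
  · ext ⟨i, j⟩
    simp only [SS, Set.mem_ofPred_eq]; omega

lemma Bd0.col_ex {f : ℕ → ℤ} (h : Bd0 f) (j : ℕ) : ∃ i, rho f i ≤ j := by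
  obtain ⟨N, hN⟩ := h.rho_zero
  exact ⟨N, by rw [hN N le_rfl]; omega⟩

/-- column length -/
def colL (f : ℕ → ℤ) (j : ℕ) : ℕ := sInf {i | rho f i ≤ j}

lemma Bd0.lt_col {f : ℕ → ℤ} (h : Bd0 f) (i j : ℕ) : i < colL f j ↔ j < rho f i := by
  constructor
  · intro h1
    have := Nat.notMem_of_lt_sInf h1
    simpa using this
  · intro h1
    by_contra h2
    have h3 : rho f (colL f j) ≤ j := Nat.sInf_mem (h.col_ex j)
    have := h.rho_anti (show colL f j ≤ i by omega)
    omega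

def gg (f : ℕ → ℤ) (j : ℕ) : ℤ := (j : ℤ) - colL f j + 1

lemma Bd0.gg_lt {f : ℕ → ℤ} (h : Bd0 f) (i j : ℕ) : gg f j < f i ↔ j < rho f i := by
  have h1 := h.lt_col i j
  have h2 := h.rho_eq i
  unfold gg
  by_cases hc : j < rho f i
  · have := h1.2 hc; omega
  · have : ¬ (i < colL f j) := fun h => hc (h1.1 h)
    omega

lemma Bd0.gg_ne {f : ℕ → ℤ} (h : Bd0 f) (j : ℕ) : gg f j ∉ Set.range f := by
  rintro ⟨i, hi⟩
  have h1 := h.lt_col i j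
  have h2 := h.rho_eq i
  unfold gg at hi
  by_cases hc : j < rho f i
  · have := h1.2 hc; omega
  · have : ¬ (i < colL f j) := fun h => hc (h1.1 h)
    omega

lemma Bd0.gg_surj {f : ℕ → ℤ} (h : Bd0 f) {z : ℤ} (hz : z ∉ Set.range f) : ∃ j, gg f j = z := by
  have hex : ∃ i, f i < z := by
    obtain ⟨N, hN⟩ := h.ev
    refine ⟨N + (1 - z).toNat, ?_⟩
    rw [hN _ (by omega)]; push_cast; omega
  let i := Nat.find hex
  have hi : f i < z := Nat.find_spec hex
  have hlt : ∀ i' < i, z < f i' := by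
    intro i' hi'
    have := Nat.find_min hex hi'
    have h2 : f i' ≠ z := fun h => hz ⟨i', h⟩
    omega
  have h2 := h.rho_eq i
  refine ⟨(z + i - 1).toNat, ?_⟩
  have hcol : colL f (z + i - 1).toNat = i := by
    apply le_antisymm
    · by_contra h3
      have := (h.lt_col i (z + i - 1).toNat).1 (by omega)
      omega
    · by_contra h3
      push Not at h3
      have h5 := h.lt_col (i - 1) (z + i - 1).toNat
      have h4 := hlt (i - 1) (by omega)
      have h6 := h.rho_eq (i - 1)
      have := h5.2 (by omega)
      omega
  unfold gg
  rw [hcol]; omega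

lemma Bd0.gg_mono {f : ℕ → ℤ} (h : Bd0 f) : StrictMono (gg f) := by
  refine strictMono_nat_of_lt_succ fun j => ?_
  have : colL f (j + 1) ≤ colL f j := by
    by_contra h1
    have := (h.lt_col (colL f j) (j + 1)).1 (by omega)
    have := (h.lt_col (colL f j) j).2 (by omega)
    omega
  unfold gg; push_cast; omega

lemma Bd0.hook {f : ℕ → ℤ} (h : Bd0 f) {i j : ℕ} (hij : j < rho f i) :
    (hookLen (SS f) (i, j) : ℤ) = f i - gg f j := by
  unfold hookLen
  have e1 : {j' | (i, j).2 < j' ∧ ((i, j).1, j') ∈ SS f} = ↑(Finset.Ioo j (rho f i)) := by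
    ext j'; simp [h.mem_SS]
  have e2 : {i' | (i, j).1 < i' ∧ (i', (i, j).2) ∈ SS f} = ↑(Finset.Ioo i (colL f j)) := by
    ext i'; simp [h.mem_SS, h.lt_col]
  rw [e1, e2, Set.ncard_coe_finset, Set.ncard_coe_finset]
  simp only [Nat.card_Ioo]
  have := (h.lt_col i j).2 hij
  have := h.rho_eq i
  unfold gg; omega

lemma core_iff {k : ℕ} {f : ℕ → ℤ} (h : Bd0 f) : IsCore k (SS f) ↔ Bd k f := by
  constructor
  · rintro ⟨_, h2⟩
    refine ⟨h.anti, h.ev, ?_⟩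
    rintro z ⟨i, rfl⟩
    by_contra hz
    obtain ⟨j, hj⟩ := h.gg_surj hz
    have h3 := (h.gg_lt i j).1 (by rw [hj]; omega)
    have h4 := h.hook h3
    apply h2 (i, j) ((h.mem_SS i j).2 h3)
    rw [hj] at h4
    omega
  · intro hb
    refine ⟨h.young, ?_⟩
    rintro ⟨i, j⟩ hc he
    rw [h.mem_SS] at hc
    have h4 := h.hook hc
    rw [he] at h4
    apply h.gg_ne j
    have := hb.core _ ⟨i, rfl⟩
    convert this using 1; push_cast at h4; linarith

lemma pMap_SS {k : ℕ} {f : ℕ → ℤ} (hb : Bd k f) : pMap k (SS f) = {c | (c.2 : ℤ) < PP k f c.1} := by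
  have h := hb.toBd0
  ext ⟨i, j⟩
  have key : ((({j | (i, j) ∈ SS f ∧ hookLen (SS f) (i, j) ≤ k}.ncard : ℕ)) : ℤ) = PP k f i := by
    unfold PP FF Dg
    have e : {j | (i, j) ∈ SS f ∧ hookLen (SS f) (i, j) ≤ k}.ncard
        = ((Finset.range (k + 1)).filter (fun t : ℕ => f i - 1 - t ∉ Set.range f)).card := by
      rw [← Set.ncard_image_of_injective _ h.gg_mono.injective, ← Finset.card_image_of_injective
        (f := fun t : ℕ => f i - 1 - (t : ℤ)), ← Set.ncard_coe_finset]
      · congr 1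
        ext z
        simp only [Set.mem_image, Finset.coe_image, Finset.coe_filter, Finset.mem_range, Set.mem_ofPred_eq]
        constructor
        · rintro ⟨j, ⟨h1, h2⟩, rfl⟩
          rw [h.mem_SS] at h1
          have h3 := h.hook h1
          have h4 := (h.gg_lt i j).2 h1
          refine ⟨(f i - 1 - gg f j).toNat, ⟨by omega, ?_⟩, by omega⟩
          have : f i - 1 - (((f i - 1 - gg f j).toNat : ℕ) : ℤ) = gg f j := by omega
          rw [this]; exact h.gg_ne j
        · rintro ⟨t, ⟨h1, h2⟩, rfl⟩
          obtain ⟨j, hj⟩ := h.gg_surj h2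
          have h4 := (h.gg_lt i j).1 (by omega)
          refine ⟨j, ⟨(h.mem_SS i j).2 h4, ?_⟩, hj⟩
          have h3 := h.hook h4
          have h5 : t ≠ k := by
            rintro rfl
            apply h2
            have := hb.core _ ⟨i, rfl⟩
            convert this using 1; ring
          omega
      · intro a b hab; simp at hab; exact hab
    rw [e, Finset.card_filter]
    push_cast
    refine Finset.sum_congr rfl fun t _ => ?_
    split_ifs <;> rfl
  show j < _ ↔ (j : ℤ) < PP k f i
  rw [← key]
  norm_cast

lemma pMap_bounded {k : ℕ} {f : ℕ → ℤ} (hb : Bd k f) : IsBounded k (pMap k (SS f)) := by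
  rw [pMap_SS hb]
  obtain ⟨N, hN⟩ := hb.ev
  constructor
  · have := young_of_rows (fun i => (PP k f i).toNat) (fun i j hij => by
      have := PP_anti hb hij
      simp only; omega) N (fun i hi => by rw [PP_zero hN i hi]; rfl)
    convert this using 1
    ext ⟨i, j⟩
    have := PP_nonneg k f i
    simp only [Set.mem_ofPred_eq]; omega
  · rintro ⟨i, j⟩ hc
    have := PP_le hb i
    simp only [Set.mem_ofPred_eq] at hc ⊢
    omega

lemma rows_ext {l m : ℕ → ℤ} (hl : ∀ i, 0 ≤ l i) (hm : ∀ i, 0 ≤ m i)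
    (h : {c : Cell | (c.2 : ℤ) < l c.1} = {c : Cell | (c.2 : ℤ) < m c.1}) : l = m := by
  funext i
  have h1 : ∀ j : ℕ, (j : ℤ) < l i ↔ (j : ℤ) < m i := by
    intro j
    have := Set.ext_iff.1 h (i, j)
    simpa using this
  have a := hl i
  have b := hm i
  have c := h1 (l i).toNat
  have d := h1 (m i).toNat
  omega

lemma pMap_inj {k : ℕ} {S T : Set Cell} (hS : IsCore k S) (hT : IsCore k T) (h : pMap k S = pMap k T) : S = T := by
  obtain ⟨f, hf, rfl⟩ := SS_of_young hS.1
  obtain ⟨g, hg, rfl⟩ := SS_of_young hT.1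
  rw [core_iff hf] at hS
  rw [core_iff hg] at hT
  rw [pMap_SS hS, pMap_SS hT] at h
  rw [PP_inj hS hT (rows_ext (PP_nonneg k f) (PP_nonneg k g) h)]

lemma pInv_pMap {k : ℕ} {S : Set Cell} (hS : IsCore k S) : pInv k (pMap k S) = S := by
  have h : ∃ a ∈ {S | IsCore k S}, pMap k a = pMap k S := ⟨S, hS, rfl⟩
  exact pMap_inj (Function.invFunOn_mem h) hS (Function.invFunOn_eq h)

lemma bounded_surj {k : ℕ} {lam : Set Cell} (h : IsBounded k lam) : ∃ f, Bd k f ∧ pMap k (SS f) = lam := by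
  obtain ⟨l, hl, ⟨N, hN⟩, rfl⟩ := rows_of_young h.1
  obtain ⟨f, hf, hP⟩ := PP_surj (k := k) N (fun i => (l i : ℤ)) (fun i j hij => by
    show ((l j : ℕ) : ℤ) ≤ (l i : ℕ)
    exact_mod_cast hl hij) (fun i => by simp)
    (fun i => by
      by_contra h2
      have := h.2 (i, k) (show k < l i by exact_mod_cast (not_le.1 h2))
      simp at this)
    (fun i hi => by simp [hN i hi])
  refine ⟨f, hf, ?_⟩
  rw [pMap_SS hf, hP]
  ext ⟨i, j⟩; simp

/-! ## the dot action -/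

lemma Bd0.addable {f : ℕ → ℤ} (h : Bd0 f) (i j : ℕ) :
    Addable (SS f) (i, j) ↔ j = rho f i ∧ f i + 1 ∉ Set.range f := by
  constructor
  · rintro ⟨h1, h2⟩
    rw [h.mem_SS] at h1
    have hj : j = rho f i := by
      by_contra h3
      have := h2.2 (i, j) (by simp) (i, rho f i) le_rfl (by simp only; omega)
      rcases this with h4 | h4
      · rw [h.mem_SS] at h4; omega
      · simp at h4; omega
    refine ⟨hj, ?_⟩
    rintro ⟨i', hi'⟩
    have h5 : i' < i := h.anti.lt_iff_gt.1 (by omega)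
    have := h2.2 (i, j) (by simp) (i', j) h5.le le_rfl
    rcases this with h4 | h4
    · rw [h.mem_SS] at h4
      have a := h.rho_eq i
      have b := h.rho_eq i'
      omega
    · simp at h4; omega
  · rintro ⟨rfl, h2⟩
    refine ⟨by rw [h.mem_SS]; omega, h.young.1.union (Set.finite_singleton _), ?_⟩
    rintro ⟨a, b⟩ (hp | hp) ⟨i', j'⟩ h3 h4
    · left; exact h.young.2 _ hp _ h3 h4
    · simp only [Set.mem_singleton_iff, Prod.mk.injEq] at hp
      obtain ⟨rfl, rfl⟩ := hp
      simp only at h3 h4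
      by_cases h5 : i' = a
      · subst h5
        by_cases h6 : j' = rho f i'
        · right; simp [h6]
        · left; rw [h.mem_SS]; omega
      · left
        rw [h.mem_SS]
        have e1 := h.anti_le (show i' ≤ a - 1 by omega)
        have e2 := h.anti (show a - 1 < a by omega)
        have e3 : f (a - 1) ≠ f a + 1 := fun h => h2 ⟨_, h⟩
        have e4 := h.rho_eq i'
        have e5 := h.rho_eq a
        omega

lemma dotC_SS {k : ℕ} {f : ℕ → ℤ} (h : Bd0 f) (c : Idx k) :
    dotC k c (some (SS f)) = (stepF k c (some f)).map SS := by
  have hA : ∀ i j, (Addable (SS f) (i, j) ∧ res k (i, j) = c) ↔ (j = rho f i ∧ Ad k c f i) := by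
    intro i j
    rw [h.addable]
    unfold Ad res
    constructor
    · rintro ⟨⟨rfl, h1⟩, h2⟩
      refine ⟨rfl, ?_, h1⟩
      have := h.rho_eq i
      have h3 : f i = (rho f i : ℤ) - i := by linarith
      rw [h3]; push_cast; exact h2
    · rintro ⟨rfl, h1, h2⟩
      refine ⟨⟨rfl, h2⟩, ?_⟩
      have := h.rho_eq i
      have h3 : f i = (rho f i : ℤ) - i := by linarith
      rw [h3] at h1; push_cast at h1; exact h1
  have hex : (∃ x, Addable (SS f) x ∧ res k x = c) ↔ ∃ i, Ad k c f i := by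
    constructor
    · rintro ⟨⟨i, j⟩, h1⟩; exact ⟨i, ((hA i j).1 h1).2⟩
    · rintro ⟨i, h1⟩; exact ⟨(i, rho f i), (hA i _).2 ⟨rfl, h1⟩⟩
  unfold dotC stepF
  simp only [hex]
  split_ifs with he
  · simp only [Option.map_some]
    congr 1
    ext ⟨i, j⟩
    simp only [Set.mem_union, Set.mem_ofPred_eq, hA]
    rw [h.mem_SS]
    show _ ↔ (j : ℤ) - i < mv k c f i
    have := h.rho_eq i
    by_cases hi : Ad k c f i
    · rw [Ad_mv_pos hi]; simp only [hi, and_true]; omega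
    · rw [Ad_mv_neg hi]; simp only [hi, and_false, or_false]; omega
  · rfl

lemma stepF_Bd {k : ℕ} (hk : 1 ≤ k) {c : Idx k} {f g : ℕ → ℤ} (h : Bd k f) (he : stepF k c (some f) = some g) :
    (∃ i, Ad k c f i) ∧ g = mv k c f ∧ Bd k g := by
  unfold stepF at he
  simp only at he
  split_ifs at he with h1
  have : mv k c f = g := by simpa using he
  subst this
  exact ⟨h1, rfl, h.mv hk h1⟩

lemma actF_cons_some {k : ℕ} {c : Idx k} {u : Word k} {f g : ℕ → ℤ} (h : actF k (c :: u) (some f) = some g) :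
    ∃ g', actF k u (some f) = some g' ∧ stepF k c (some g') = some g := by
  rw [actF_cons] at h
  rcases h1 : actF k u (some f) with _ | g'
  · rw [h1] at h; simp [stepF] at h
  · exact ⟨g', rfl, by rw [← h1]; exact h⟩

lemma actF_append_some {k : ℕ} {u v : Word k} {f g : ℕ → ℤ} (h : actF k (u ++ v) (some f) = some g) :
    ∃ g', actF k v (some f) = some g' ∧ actF k u (some g') = some g := by
  rw [actF_append] at h
  rcases h1 : actF k v (some f) with _ | g'
  · rw [h1, actF_none] at h; simp at h
  · exact ⟨g', rfl, by rw [← h1]; exact h⟩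

lemma actF_Bd {k : ℕ} (hk : 1 ≤ k) {u : Word k} {f g : ℕ → ℤ} (h : Bd k f) (he : actF k u (some f) = some g) :
    Bd k g := by
  induction u generalizing g with
  | nil => simp [actF] at he; exact he ▸ h
  | cons c u ih =>
    obtain ⟨g', h1, h2⟩ := actF_cons_some he
    exact (stepF_Bd hk (ih h1) h2).2.2

lemma dotCW_SS {k : ℕ} (hk : 1 ≤ k) {f : ℕ → ℤ} (h : Bd k f) (u : Word k) :
    dotCW k u (some (SS f)) = (actF k u (some f)).map SS := by
  induction u with
  | nil => rfl
  | cons c u ih =>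
    show dotC k c (dotCW k u (some (SS f))) = _
    rw [ih, actF_cons]
    rcases h1 : actF k u (some f) with _ | g
    · rfl
    · exact dotC_SS (actF_Bd hk h h1).toBd0 c

lemma dotB_eq {k : ℕ} (hk : 1 ≤ k) {f : ℕ → ℤ} (h : Bd k f) (u : Word k) :
    dotB k u (pMap k (SS f)) = (actF k u (some f)).map (fun g => pMap k (SS g)) := by
  unfold dotB
  rw [pInv_pMap ((core_iff h.toBd0).2 h), dotCW_SS hk h, Option.map_map]
  rfl

/-! ## transpose -/

lemma transpose_young {S : Set Cell} (h : IsYoung S) : IsYoung (transposeSet S) := by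
  constructor
  · have : transposeSet S = Prod.swap '' S := by
      ext ⟨i, j⟩; simp [transposeSet]
    rw [this]; exact h.1.image _
  · rintro ⟨i, j⟩ hp ⟨i', j'⟩ h1 h2
    exact h.2 (j, i) hp (j', i') h2 h1

lemma transpose_transpose (S : Set Cell) : transposeSet (transposeSet S) = S := by
  ext ⟨i, j⟩; rfl

lemma transpose_core {k : ℕ} {S : Set Cell} (h : IsCore k S) : IsCore k (transposeSet S) := by
  refine ⟨transpose_young h.1, ?_⟩
  rintro ⟨i, j⟩ hc
  have := h.2 (j, i) hc
  unfold hookLen at this ⊢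
  rw [add_comm {j_1 | _}.ncard] at this
  exact this

lemma transpose_addable (S : Set Cell) (i j : ℕ) : Addable (transposeSet S) (i, j) ↔ Addable S (j, i) := by
  have e : transposeSet S ∪ {(i, j)} = transposeSet (S ∪ {(j, i)}) := by
    ext ⟨a, b⟩
    simp [transposeSet, and_comm]
  have e2 : IsYoung (transposeSet (S ∪ {(j, i)})) ↔ IsYoung (S ∪ {(j, i)}) :=
    ⟨fun h => by rw [← transpose_transpose (S ∪ {(j, i)})]; exact transpose_young h, transpose_young⟩
  unfold Addable
  rw [e, e2]
  rfl

lemma dotC_transpose {k : ℕ} (c : Idx k) (o : Option (Set Cell)) :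
    dotC k (-c) (o.map transposeSet) = (dotC k c o).map transposeSet := by
  rcases o with _ | S
  · rfl
  have hA : ∀ i j, (Addable (transposeSet S) (i, j) ∧ res k (i, j) = -c) ↔ (Addable S (j, i) ∧ res k (j, i) = c) := by
    intro i j
    rw [transpose_addable]
    unfold res
    simp only
    rw [← neg_inj (a := (j : Idx k) - i), neg_neg, neg_sub]
  have hex : (∃ x, Addable (transposeSet S) x ∧ res k x = -c) ↔ (∃ x, Addable S x ∧ res k x = c) := by
    constructor
    · rintro ⟨⟨i, j⟩, h1⟩; exact ⟨(j, i), (hA i j).1 h1⟩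
    · rintro ⟨⟨i, j⟩, h1⟩; exact ⟨(j, i), (hA j i).2 h1⟩
  simp only [Option.map_some, dotC, hex]
  split_ifs with he
  · simp only [Option.map_some]
    congr 1
    ext ⟨i, j⟩
    simp only [Set.mem_union, Set.mem_ofPred_eq, hA]
    rfl
  · rfl

lemma dotCW_transpose {k : ℕ} (u : Word k) (o : Option (Set Cell)) :
    dotCW k (u.map (fun c => -c)) (o.map transposeSet) = (dotCW k u o).map transposeSet := by
  induction u with
  | nil => rfl
  | cons c u ih =>
    show dotC k (-c) (dotCW k (u.map (fun c => -c)) (o.map transposeSet)) = (dotC k c (dotCW k u o)).map _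
    rw [ih, dotC_transpose]

lemma SS_inj {f g : ℕ → ℤ} (hf : Bd0 f) (hg : Bd0 g) (h : SS f = SS g) : f = g := by
  funext i
  have h1 : ∀ j : ℕ, j < rho f i ↔ j < rho g i := by
    intro j
    rw [← hf.mem_SS, ← hg.mem_SS, h]
  have a := hf.rho_eq i
  have b := hg.rho_eq i
  have c := h1 (rho f i)
  have d := h1 (rho g i)
  omega

/-- transposed bead sequences -/
lemma transpose_run {k : ℕ} (hk : 1 ≤ k) {u : Word k} {f g : ℕ → ℤ} (h : Bd k f) (he : actF k u (some f) = some g) :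
    ∃ f' g', Bd k f' ∧ Bd k g' ∧ SS f' = transposeSet (SS f) ∧ SS g' = transposeSet (SS g) ∧
      actF k (u.map (fun c => -c)) (some f') = some g' := by
  have hg := actF_Bd hk h he
  have c1 := transpose_core ((core_iff h.toBd0).2 h)
  obtain ⟨f', hf', e1⟩ := SS_of_young c1.1
  have hb1 : Bd k f' := by rw [← core_iff hf', e1]; exact c1
  have e : dotCW k (u.map (fun c => -c)) (some (SS f')) = some (transposeSet (SS g)) := by
    have := dotCW_transpose u (some (SS f))
    rw [dotCW_SS hk h, he] at this
    rw [e1]; exact this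
  rw [dotCW_SS hk hb1] at e
  rcases h1 : actF k (u.map (fun c => -c)) (some f') with _ | g'
  · rw [h1] at e; simp at e
  · rw [h1] at e
    exact ⟨f', g', hb1, actF_Bd hk hb1 h1, e1, by simpa using e, h1⟩

/-- letter at position `p` for the gap `a` -/
def LL (k : ℕ) (a : Idx k) (p : ℕ) : Idx k := a + 1 + (p : Idx k)

lemma LL_succ {k : ℕ} (a : Idx k) (p : ℕ) : LL k a p + 1 = LL k a (p + 1) := by
  unfold LL; push_cast; ring

lemma LL_inj {k : ℕ} {a : Idx k} {p q : ℕ} (hp : p ≤ k) (hq : q ≤ k) (h : LL k a p = LL k a q) : p = q := by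
  unfold LL at h
  have h1 := add_left_cancel h
  rw [ZMod.natCast_eq_natCast_iff] at h1
  exact Nat.ModEq.eq_of_lt_of_lt h1 (by omega) (by omega)

lemma run_mono {k : ℕ} (hk : 1 ≤ k) {u : Word k} {f g : ℕ → ℤ} (h : Bd k f) (he : actF k u (some f) = some g) (i : ℕ) :
    f i ≤ g i ∧ PP k f i ≤ PP k g i ∧ PP k g i - PP k f i ≤ g i - f i := by
  induction u generalizing g with
  | nil => cases he; simp
  | cons c u ih =>
    obtain ⟨g', h1, h2⟩ := actF_cons_some he
    have hb := actF_Bd hk h h1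
    obtain ⟨hA, rfl, -⟩ := stepF_Bd hk hb h2
    have := ih h1
    rw [PP_mv hk hb hA]
    by_cases hi : Ad k c g' i
    · rw [Ad_mv_pos hi]; split_ifs <;> omega
    · rw [Ad_mv_neg hi, if_neg (fun hh => hi hh.1)]; omega

lemma P1a {k : ℕ} (hk : 1 ≤ k) {a : Idx k} {ps : List ℕ} (hps : ps.Pairwise (· < ·)) (hlt : ∀ p ∈ ps, p < k)
    {f g : ℕ → ℤ} (h : Bd k f) (he : actF k (ps.map (LL k a)) (some f) = some g) (i : ℕ) :
    g i = f i ∨ (g i = f i + 1 ∧ ∃ q ∈ ps, ((f i : ℤ) : Idx k) = LL k a q) := by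
  induction ps generalizing g with
  | nil => cases he; simp
  | cons p ps ih =>
    rw [List.map_cons] at he
    obtain ⟨g', h1, h2⟩ := actF_cons_some he
    have hb := actF_Bd hk h h1
    obtain ⟨hA, rfl, -⟩ := stepF_Bd hk hb h2
    rw [List.pairwise_cons] at hps
    have := ih hps.2 (fun q hq => hlt q (by simp [hq])) h1
    by_cases hi : Ad k (LL k a p) g' i
    · rw [Ad_mv_pos hi]
      rcases this with h3 | ⟨h3, q, hq, h4⟩
      · right
        refine ⟨by rw [h3], p, by simp, ?_⟩
        rw [← h3]; exact hi.1
      · exfalso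
        have h5 := hi.1
        rw [h3] at h5
        push_cast at h5
        rw [h4, LL_succ] at h5
        have := LL_inj (by have := hlt q (by simp [hq]); omega) (by have := hlt p (by simp); omega) h5
        have := hps.1 q hq
        omega
    · rw [Ad_mv_neg hi]
      rcases this with h3 | ⟨h3, q, hq, h4⟩
      · exact Or.inl h3
      · exact Or.inr ⟨h3, q, by simp [hq], h4⟩

lemma P1b {k : ℕ} (hk : 1 ≤ k) {a : Idx k} {ps : List ℕ} (hps : ps.Pairwise (· < ·)) (hlt : ∀ p ∈ ps, p < k)
    {f g : ℕ → ℤ} (h : Bd k f) (he : actF k (ps.map (LL k a)) (some f) = some g) :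
    ∃ J : Finset ℕ, J.card = ps.length ∧ (∀ i, PP k g i = PP k f i + if i ∈ J then 1 else 0) ∧
      ∀ i ∈ J, ∃ p1 q p2 g0, ps = p1 ++ q :: p2 ∧ actF k (p2.map (LL k a)) (some f) = some g0 ∧ Low k (LL k a q) g0 i := by
  induction ps generalizing g with
  | nil => cases he; exact ⟨∅, by simp⟩
  | cons p ps ih =>
    have he0 := he
    rw [List.map_cons] at he
    obtain ⟨g', h1, h2⟩ := actF_cons_some he
    have hb := actF_Bd hk h h1
    obtain ⟨hA, rfl, -⟩ := stepF_Bd hk hb h2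
    obtain ⟨i0, hi0⟩ := Low_exists hb hA
    obtain ⟨J, hJ1, hJ2, hJ3⟩ := ih (List.pairwise_cons.1 hps).2 (fun q hq => hlt q (by simp [hq])) h1
    have hn : i0 ∉ J := by
      intro hmem
      have e1 := hJ2 i0
      rw [if_pos hmem] at e1
      have e2 := (run_mono hk h h1 i0).2.2
      have e3 := P1a hk hps hlt h he0 i0
      rw [Ad_mv_pos hi0.1] at e3
      rcases e3 with e3 | ⟨e3, -⟩ <;> omega
    refine ⟨insert i0 J, by simp [hn, hJ1], ?_, ?_⟩
    · intro i
      rw [PP_mv_low hk hb hi0, hJ2]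
      by_cases hi : i = i0
      · subst hi; simp [hn]
      · simp [hi]
    · intro i hi
      rw [Finset.mem_insert] at hi
      rcases hi with rfl | hi
      · exact ⟨[], p, ps, g', rfl, h1, hi0⟩
      · obtain ⟨p1, q, p2, g0, e1, e2, e3⟩ := hJ3 i hi
        exact ⟨p :: p1, q, p2, g0, by simp [e1], e2, e3⟩

lemma P2 {k : ℕ} (hk : 1 ≤ k) {a : Idx k} {ps : List ℕ} (hps : ps.Pairwise (· > ·)) (hlt : ∀ p ∈ ps, p < k)
    {f g : ℕ → ℤ} (h : Bd k f) (he : actF k (ps.map (LL k a)) (some f) = some g) :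
    (∀ x ≤ k, (∀ q ∈ ps, q + 1 < x) → ∀ z : ℤ, (z : Idx k) = LL k a x → (z ∈ Set.range g ↔ z ∈ Set.range f)) ∧
    (∀ i, g (i + 1) < f i) ∧ ∀ i, PP k g (i + 1) = FF k f (g (i + 1) + 1) := by
  induction ps generalizing g with
  | nil => cases he; exact ⟨fun _ _ _ _ _ => Iff.rfl, fun i => h.anti (by omega), fun i => (FF_after h _).symm⟩
  | cons p ps ih =>
    rw [List.map_cons] at he
    obtain ⟨g', h1, h2⟩ := actF_cons_some he
    have hb := actF_Bd hk h h1
    obtain ⟨hA, rfl, -⟩ := stepF_Bd hk hb h2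
    rw [List.pairwise_cons] at hps
    have hpk := hlt p (by simp)
    obtain ⟨i1, i2, i3⟩ := ih hps.2 (fun q hq => hlt q (by simp [hq])) h1
    have i1' := i1 (p + 1) (by omega) (fun q hq => by have := hps.1 q hq; omega)
    refine ⟨?_, ?_, ?_⟩
    · intro x hx hq z hz
      rw [← i1 x hx (fun q hq' => hq q (by simp [hq'])) z hz]
      have := hq p (by simp)
      apply mem_mv_off
      · intro e; rw [hz] at e; have := LL_inj hx (by omega) e; omega
      · intro e; rw [hz, LL_succ] at e; have := LL_inj hx (by omega) e; omega
    · intro i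
      by_cases hi : Ad k (LL k a p) g' (i + 1)
      · rw [Ad_mv_pos hi]
        have e1 := i2 i
        have e2 : g' (i + 1) + 1 ∉ Set.range f := by
          rw [← i1' _ (by push_cast; rw [hi.1, LL_succ])]; exact hi.2
        have e3 : g' (i + 1) + 1 ≠ f i := fun e => e2 ⟨i, e.symm⟩
        omega
      · rw [Ad_mv_neg hi]; exact i2 i
    · intro i
      rw [PP_mv hk hb hA, i3]
      by_cases hi : Ad k (LL k a p) g' (i + 1)
      · rw [Ad_mv_pos hi]
        have hc : ((g' (i + 1) + 1 : ℤ) : Idx k) = LL k a (p + 1) := by push_cast; rw [hi.1, LL_succ]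
        have e2 : g' (i + 1) + 1 ∉ Set.range f := by
          rw [← i1' _ hc]; exact hi.2
        rw [FF_succ k f (g' (i+1) + 1), Dg_of_not e2, i1' _ (by rw [cast_sub_n, hc])]
        simp only [hi, true_and]
        unfold Dg
        split_ifs <;> ring
      · rw [Ad_mv_neg hi, if_neg (fun hh => hi hh.1)]; ring

lemma P2le {k : ℕ} (hk : 1 ≤ k) {a : Idx k} {ps : List ℕ} (hps : ps.Pairwise (· > ·)) (hlt : ∀ p ∈ ps, p < k)
    {f g : ℕ → ℤ} (h : Bd k f) (he : actF k (ps.map (LL k a)) (some f) = some g) (i : ℕ) :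
    PP k g (i + 1) ≤ PP k f i := by
  obtain ⟨-, i2, i3⟩ := P2 hk hps hlt h he
  rw [i3]
  apply FF_mono
  · have := i2 i; omega
  · intro z hz1 hz2
    have := (run_mono hk h he (i + 1)).1
    exact h.gap_between (by omega) hz2

/-- the invariants along a word not containing `c` nor `c+1` -/
lemma Xrun {k : ℕ} (hk : 1 ≤ k) {c : Idx k} {X : Word k} (hX : ∀ d ∈ X, d ≠ c ∧ d ≠ c + 1) {f g : ℕ → ℤ} (h : Bd k f)
    (he : actF k X (some f) = some g) {x : ℤ} (hx : (x : Idx k) = c + 1) :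
    (∀ z : ℤ, (z : Idx k) = c + 1 → (z ∈ Set.range g ↔ z ∈ Set.range f)) ∧ FF k g x = FF k f x ∧
      ∀ i, f i < x → g i < x := by
  induction X generalizing g with
  | nil => cases he; exact ⟨fun _ _ => Iff.rfl, rfl, fun _ => id⟩
  | cons d X ih =>
    obtain ⟨g', h1, h2⟩ := actF_cons_some he
    have hb := actF_Bd hk h h1
    obtain ⟨hA, rfl, -⟩ := stepF_Bd hk hb h2
    obtain ⟨i1, i2, i3⟩ := ih (fun d hd => hX d (by simp [hd])) h1
    obtain ⟨d1, d2⟩ := hX d (by simp)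
    refine ⟨?_, ?_, ?_⟩
    · intro z hz
      rw [← i1 z hz]
      apply mem_mv_off
      · rw [hz]; exact fun e => d2 e.symm
      · rw [hz]; intro e; exact d1 (add_right_cancel e).symm
    · rw [FF_mv hk _ _ _ (by rw [hx]; intro e; exact d1 (add_right_cancel e).symm), i2]
    · intro i hi
      have := i3 i hi
      by_cases hi : Ad k d g' i
      · rw [Ad_mv_pos hi]
        have : g' i + 1 ≠ x := by
          intro e
          rw [← e] at hx
          push_cast at hx
          exact d1 (hi.1.symm.trans (add_right_cancel hx))
        omega
      · rw [Ad_mv_neg hi]; exact this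

lemma lemG {k : ℕ} (hk : 1 ≤ k) {c : Idx k} {X : Word k} (hX : ∀ d ∈ X, d ≠ c ∧ d ≠ c + 1) {f0 f1 f2 f3 : ℕ → ℤ}
    (h : Bd k f0) (h01 : stepF k (c + 1) (some f0) = some f1) (h12 : actF k X (some f1) = some f2)
    (h23 : stepF k c (some f2) = some f3) {i : ℕ} (hi : Low k (c + 1) f0 i) :
    Low k c f2 (i + 1) ∧ PP k f3 (i + 1) = PP k f0 i + 1 := by
  have h10 := one_ne k hk
  obtain ⟨hA1, rfl, hb1⟩ := stepF_Bd hk h h01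
  have hb2 := actF_Bd hk hb1 h12
  obtain ⟨hA2, rfl, hb3⟩ := stepF_Bd hk hb2 h23
  obtain ⟨⟨hc, hn⟩, hl⟩ := hi
  obtain ⟨i1, i2, i3⟩ := Xrun hk hX hb1 h12 hc
  set x := f0 i with hxdef
  have hx1 : x ∉ Set.range (mv k (c + 1) f0) := by
    rw [mem_mv_c hk hc]; exact fun hh => hn hh.2
  have hxn : x - (k + 1) ∈ Set.range (mv k (c + 1) f0) := by
    rw [mem_mv_c hk (by rw [cast_sub_n, hc])]
    refine ⟨h.core _ ⟨i, rfl⟩, ?_⟩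
    have : x - (k + 1) + 1 = x + 1 - (k + 1) := by ring
    rw [this]; exact hl
  have hx2 : x ∉ Set.range f2 := by rw [i1 x hc]; exact hx1
  have hxn2 : x - (k + 1) ∈ Set.range f2 := by rw [i1 _ (by rw [cast_sub_n, hc])]; exact hxn
  -- x - 1 in range f2
  have hxm : x - 1 ∈ Set.range f2 := by
    obtain ⟨j, hj⟩ := Low_exists hb2 hA2
    have hjc : ((f2 j : ℤ) : Idx k) = ((x - 1 : ℤ) : Idx k) := by
      rw [hj.1.1]; push_cast; rw [hc]; ring
    refine hb2.core_le ⟨j, rfl⟩ hjc.symm ?_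
    by_contra hlt
    push Not at hlt
    -- f2 j + 1 < x, congruent to x, so f2 j + 1 ≤ x - (k+1), in range
    have hm : ((f2 j + 1 : ℤ) : Idx k) = ((x - (k + 1) : ℤ) : Idx k) := by
      rw [cast_sub_n]; push_cast; rw [hjc]; push_cast; ring
    refine hj.1.2 (hb2.core_le hxn2 hm ?_)
    have h1 : ((x - (f2 j + 1) : ℤ) : ZMod (k+1)) = 0 := by
      rw [Int.cast_sub, hm, cast_sub_n]; ring
    rw [ZMod.intCast_zmod_eq_zero_iff_dvd] at h1
    obtain ⟨m, hm⟩ := h1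
    have : 0 < ((k + 1 : ℕ) : ℤ) * m := by rw [← hm]; omega
    have hm1 : 1 ≤ m := by
      by_contra hm0
      push Not at hm0
      have : ((k + 1 : ℕ) : ℤ) * m ≤ 0 := mul_nonpos_of_nonneg_of_nonpos (by positivity) (by omega)
      omega
    have : ((k + 1 : ℕ) : ℤ) * 1 ≤ ((k + 1 : ℕ) : ℤ) * m := mul_le_mul_of_nonneg_left hm1 (by positivity)
    push_cast at *
    omega
  obtain ⟨j, hj⟩ := hxm
  have hrow1 : f2 (i + 1) < x := by
    apply i3
    have e1 : f0 (i + 1) < x := h.anti (by omega)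
    have e2 : mv k (c + 1) f0 (i + 1) ≠ x := fun e => hx1 ⟨_, e⟩
    have e3 : mv k (c + 1) f0 (i + 1) ≤ f0 (i + 1) + 1 := by unfold mv; split_ifs <;> omega
    omega
  have hrow : x + 1 ≤ f2 i := by
    have e1 : mv k (c + 1) f0 i = x + 1 := Ad_mv_pos ⟨hc, hn⟩
    have := (run_mono hk hb1 h12 i).1
    omega
  have hji : j = i + 1 := by
    have e1 : ¬ j ≤ i := fun e => by have := hb2.anti.antitone e; omega
    have e2 : ¬ i + 1 < j := fun e => by have := hb2.anti e; omega
    omega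
  subst hji
  have hAd : Ad k c f2 (i + 1) := by
    refine ⟨by rw [hj]; push_cast; rw [hc]; ring, ?_⟩
    rw [hj]; simpa using hx2
  have hLow : Low k c f2 (i + 1) := by
    refine ⟨hAd, ?_⟩
    rw [hj]; simpa using hxn2
  refine ⟨hLow, ?_⟩
  rw [PP_mv_low hk hb2 hLow, if_pos rfl]
  congr 1
  rw [← FF_after hb2, hj]
  have : x - 1 + 1 = x := by ring
  rw [this, i2, FF_mv hk]
  · rfl
  · rw [hc]; intro e; exact h10 (left_eq_add.1 e)

/-- positions of a connected V-word -/
structure VP (k : ℕ) (ds : List ℕ) (v : ℕ) (as : List ℕ) : Prop where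
  hd : ds.Pairwise (· > ·)
  hdv : ∀ p ∈ ds, v < p
  ha : as.Pairwise (· < ·)
  hav : ∀ p ∈ as, v < p
  lt : ∀ p ∈ ds ++ v :: as, p < k
  conn : ∀ p ∈ ds ++ v :: as, v < p → p - 1 ∈ ds ++ v :: as

/-- positions of a connected anti V-word -/
structure AP (k : ℕ) (ds : List ℕ) (v : ℕ) (as : List ℕ) : Prop where
  hd : ds.Pairwise (· < ·)
  hdv : ∀ p ∈ ds, p < v
  ha : as.Pairwise (· > ·)
  hav : ∀ p ∈ as, p < v
  lt : ∀ p ∈ ds ++ v :: as, p < k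
  conn : ∀ p ∈ ds ++ v :: as, p < v → p + 1 ∈ ds ++ v :: as

lemma VP_height {k : ℕ} (hk : 1 ≤ k) {a : Idx k} {ds as : List ℕ} {v : ℕ} (H : VP k ds v as) {f g : ℕ → ℤ}
    (h : Bd k f) (he : actF k ((ds ++ v :: as).map (LL k a)) (some f) = some g) :
    {i | PP k f i < PP k g (i + 1)}.ncard = as.length := by
  have e0 : (ds ++ v :: as).map (LL k a) = (ds ++ [v]).map (LL k a) ++ as.map (LL k a) := by simp
  have he' := he
  rw [e0] at he'
  obtain ⟨ν, h1, h2⟩ := actF_append_some he'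
  have hbν := actF_Bd hk h h1
  have hlt1 : ∀ p ∈ as, p < k := fun p hp => H.lt p (by simp [hp])
  obtain ⟨J, hJ1, hJ2, hJ3⟩ := P1b hk H.ha hlt1 h h1
  have : {i | PP k f i < PP k g (i + 1)} = (J : Set ℕ) := by
    ext i
    simp only [Set.mem_ofPred_eq, Finset.mem_coe]
    constructor
    · intro hi
      have := P2le hk (ps := ds ++ [v]) (by
        rw [List.pairwise_append]
        exact ⟨H.hd, by simp, fun p hp q hq => by simp at hq; subst hq; exact H.hdv p hp⟩)
        (fun p hp => H.lt p (by simp at hp ⊢; tauto)) hbν h2 i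
      by_contra hJ
      have e := hJ2 i
      rw [if_neg hJ] at e
      omega
    · intro hi
      obtain ⟨p1, q, p2, g0, e1, e2, e3⟩ := hJ3 i hi
      subst e1
      have hvq := H.hav q (by simp)
      have hA := H.ha
      rw [List.pairwise_append, List.pairwise_cons] at hA
      have hq1 : q - 1 ∈ ds ++ v :: p1 := by
        have := H.conn q (by simp) hvq
        simp only [List.mem_append, List.mem_cons] at this ⊢
        rcases this with h | h | h | h | h
        · exact Or.inl h
        · exact Or.inr (Or.inl h)
        · exact Or.inr (Or.inr h)
        · omega
        · have := hA.2.1.1 _ h; omega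
      have hsplit : ∃ w X, ds ++ v :: p1 = w ++ (q - 1) :: X ∧ ∀ d ∈ X, d ≠ q - 1 ∧ d ≠ q := by
        by_cases c1 : q - 1 ∈ p1
        · obtain ⟨b1, b2, rfl⟩ := List.append_of_mem c1
          refine ⟨ds ++ v :: b1, b2, by simp, fun d hd => ?_⟩
          have := hA.1
          rw [List.pairwise_append, List.pairwise_cons] at this
          have t1 := this.2.1.1 d hd
          have t2 := hA.2.2 d (by simp [hd]) q (by simp)
          omega
        · by_cases c2 : q - 1 = v
          · refine ⟨ds, p1, by simp [c2], fun d hd => ?_⟩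
            have t1 := H.hav d (by simp [hd])
            have t2 := hA.2.2 d hd q (by simp)
            omega
          · have c3 : q - 1 ∈ ds := by
              simp only [List.mem_append, List.mem_cons] at hq1
              tauto
            obtain ⟨b1, b2, rfl⟩ := List.append_of_mem c3
            refine ⟨b1, b2 ++ v :: p1, by simp, fun d hd => ?_⟩
            have hD := H.hd
            rw [List.pairwise_append, List.pairwise_cons] at hD
            simp only [List.mem_append, List.mem_cons] at hd
            rcases hd with hd | hd | hd
            · have := hD.2.1.1 d hd; omega
            · omega
            · have := hA.2.2 d hd q (by simp)
              exact ⟨fun e => c1 (e ▸ hd), by omega⟩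
      obtain ⟨w, X, hw, hX⟩ := hsplit
      have hqk := H.lt q (by simp)
      have e4 : (ds ++ v :: (p1 ++ q :: p2)).map (LL k a) =
          w.map (LL k a) ++ (LL k a (q - 1) :: (X.map (LL k a) ++ (LL k a q :: p2.map (LL k a)))) := by
        have : ds ++ v :: (p1 ++ q :: p2) = (ds ++ v :: p1) ++ q :: p2 := by simp
        rw [this, hw]; simp
      rw [e4] at he
      obtain ⟨f3, r1, r2⟩ := actF_append_some he
      obtain ⟨f2, r3, r4⟩ := actF_cons_some r1
      obtain ⟨f1, r5, r6⟩ := actF_append_some r3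
      obtain ⟨f0, r7, r8⟩ := actF_cons_some r5
      rw [e2] at r7; cases r7
      have hb0 := actF_Bd hk h e2
      have hb3 := actF_Bd hk h r1
      have hlq : LL k a q = LL k a (q - 1) + 1 := by
        rw [LL_succ]; congr 1; omega
      rw [hlq] at r8 e3
      have key := (lemG hk (c := LL k a (q - 1)) (X := X.map (LL k a)) (by
        intro d hd
        obtain ⟨d', hd', rfl⟩ := List.mem_map.1 hd
        have hdk : d' < k := H.lt d' (by
          have : d' ∈ ds ++ v :: p1 := by rw [hw]; simp [hd']
          simp at this ⊢; tauto)
        have := hX d' hd'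
        rw [← hlq]
        exact ⟨fun e => this.1 (LL_inj (by omega) (by omega) e), fun e => this.2 (LL_inj (by omega) (by omega) e)⟩)
        hb0 r8 r6 r4 e3).2
      have m1 := (run_mono hk hb3 r2 (i + 1)).2.1
      have m2 := (run_mono hk h e2 i).2.1
      omega
  rw [this, Set.ncard_coe_finset, hJ1]

lemma AP_height {k : ℕ} (hk : 1 ≤ k) {a : Idx k} {ds as : List ℕ} {v : ℕ} (H : AP k ds v as) {f g : ℕ → ℤ}
    (h : Bd k f) (he : actF k ((ds ++ v :: as).map (LL k a)) (some f) = some g) :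
    {i | PP k f i < PP k g (i + 1)}.ncard = ds.length := by
  have he' := he
  rw [List.map_append] at he'
  obtain ⟨ν, h1, h2⟩ := actF_append_some he'
  have hbν := actF_Bd hk h h1
  obtain ⟨J, hJ1, hJ2, hJ3⟩ := P1b hk H.hd (fun p hp => H.lt p (by simp [hp])) hbν h2
  have key : ∀ j ∈ J, ∃ i, j = i + 1 ∧ PP k f i < PP k g (i + 1) := by
    intro j hj
    obtain ⟨d1, q, d2, g0, e1, e2, e3⟩ := hJ3 j hj
    subst e1
    have hvq := H.hdv q (by simp)
    have hD := H.hd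
    rw [List.pairwise_append, List.pairwise_cons] at hD
    have hq1 : q + 1 ∈ d2 ++ v :: as := by
      have := H.conn q (by simp) hvq
      simp only [List.mem_append, List.mem_cons] at this ⊢
      rcases this with (h | h | h) | h | h
      · have := hD.2.2 _ h q (by simp); omega
      · omega
      · exact Or.inl h
      · exact Or.inr (Or.inl h)
      · exact Or.inr (Or.inr h)
    have hsplit : ∃ X w, d2 ++ v :: as = X ++ (q + 1) :: w ∧ ∀ d ∈ X, d ≠ q ∧ d ≠ q + 1 := by
      by_cases c1 : q + 1 ∈ d2
      · obtain ⟨b1, b2, rfl⟩ := List.append_of_mem c1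
        refine ⟨b1, b2 ++ v :: as, by simp, fun d hd => ?_⟩
        have := hD.2.1.2
        rw [List.pairwise_append, List.pairwise_cons] at this
        have t1 := this.2.2 d hd (q + 1) (by simp)
        have t2 := hD.2.1.1 d (by simp [hd])
        omega
      · by_cases c2 : q + 1 = v
        · refine ⟨d2, as, by simp [c2], fun d hd => ?_⟩
          have t1 := H.hdv d (by simp [hd])
          have t2 := hD.2.1.1 d hd
          omega
        · have c3 : q + 1 ∈ as := by
            simp only [List.mem_append, List.mem_cons] at hq1
            tauto
          obtain ⟨b1, b2, rfl⟩ := List.append_of_mem c3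
          refine ⟨d2 ++ v :: b1, b2, by simp, fun d hd => ?_⟩
          have hA := H.ha
          rw [List.pairwise_append, List.pairwise_cons] at hA
          simp only [List.mem_append, List.mem_cons] at hd
          rcases hd with hd | hd | hd
          · have := hD.2.1.1 d hd
            exact ⟨by omega, fun e => c1 (e ▸ hd)⟩
          · omega
          · have := hA.2.2 d hd (q + 1) (by simp)
            omega
    obtain ⟨X, w, hw, hX⟩ := hsplit
    have hqk := H.lt q (by simp)
    have hqk1 := H.lt (q + 1) (by simp at hq1 ⊢; tauto)
    have e4 : (d1 ++ q :: d2 ++ v :: as).map (LL k a) =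
        d1.map (LL k a) ++ (LL k a q :: (X.map (LL k a) ++ (LL k a (q + 1) :: w.map (LL k a)))) := by
      have : d1 ++ q :: d2 ++ v :: as = d1 ++ q :: (d2 ++ v :: as) := by simp
      rw [this, hw]; simp
    rw [e4] at he
    obtain ⟨f3, r1, r2⟩ := actF_append_some he
    obtain ⟨f2, r3, r4⟩ := actF_cons_some r1
    have hg0 : g0 = f2 := by
      have : X.map (LL k a) ++ (LL k a (q + 1) :: w.map (LL k a)) = d2.map (LL k a) ++ (v :: as).map (LL k a) := by
        rw [← List.map_append, hw]; simp
      rw [this, actF_append, h1, e2] at r3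
      exact Option.some.inj r3
    subst hg0
    have hb2 := actF_Bd hk h r3
    obtain ⟨f1, r5, r6⟩ := actF_append_some r3
    obtain ⟨f0, r7, r8⟩ := actF_cons_some r5
    have hb0 := actF_Bd hk h r7
    have hb3 := actF_Bd hk h r1
    rw [← LL_succ] at r8
    obtain ⟨hA1, -, -⟩ := stepF_Bd hk hb0 r8
    obtain ⟨i, hi⟩ := Low_exists hb0 hA1
    obtain ⟨key1, key⟩ := (lemG hk (c := LL k a q) (X := X.map (LL k a)) (by
        intro d hd
        obtain ⟨d', hd', rfl⟩ := List.mem_map.1 hd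
        have hdk : d' < k := H.lt d' (by
          have : d' ∈ d2 ++ v :: as := by rw [hw]; simp [hd']
          simp at this ⊢; tauto)
        have := hX d' hd'
        rw [LL_succ]
        exact ⟨fun e => this.1 (LL_inj (by omega) (by omega) e), fun e => this.2 (LL_inj (by omega) (by omega) e)⟩)
        hb0 r8 r6 r4 hi)
    refine ⟨i, Low_unique hb2 e3 key1, ?_⟩
    have m1 := (run_mono hk hb3 r2 (i + 1)).2.1
    have m2 := (run_mono hk h r7 i).2.1
    omega
  have himg : Nat.succ '' {i | PP k f i < PP k g (i + 1)} = (J : Set ℕ) := by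
    ext j
    simp only [Set.mem_image, Set.mem_ofPred_eq, Finset.mem_coe]
    constructor
    · rintro ⟨i, hi, rfl⟩
      have := P2le hk (ps := v :: as) (by
        rw [List.pairwise_cons]
        exact ⟨fun p hp => H.hav p hp, H.ha⟩)
        (fun p hp => H.lt p (by simp at hp ⊢; tauto)) h h1 i
      by_contra hJ
      have e := hJ2 (i + 1)
      rw [if_neg hJ] at e
      omega
    · intro hj
      obtain ⟨i, rfl, hi⟩ := key j hj
      exact ⟨i, hi, rfl⟩
  rw [← Set.ncard_image_of_injective _ Nat.succ_injective, himg, Set.ncard_coe_finset, hJ1]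

/-- height of a difference of row diagrams -/
lemma ht_rows {l m : ℕ → ℤ} (hl : Antitone l) (hm : Antitone m) (hl0 : ∀ i, 0 ≤ l i) 
    {N : ℕ} (hN : ∀ i ≥ N, m i = 0) :
    htSkew ({c : Cell | (c.2 : ℤ) < m c.1} \ {c : Cell | (c.2 : ℤ) < l c.1}) = {i | l i < m (i + 1)}.ncard := by
  unfold htSkew
  set D := ({c : Cell | (c.2 : ℤ) < m c.1} \ {c : Cell | (c.2 : ℤ) < l c.1}) with hD
  have memD : ∀ i j : ℕ, (i, j) ∈ D ↔ (j : ℤ) < m i ∧ l i ≤ j := by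
    intro i j
    simp [hD]
  have h1 : ∀ i, (∃ j, (i, j) ∈ D) ↔ l i < m i := by
    intro i
    constructor
    · rintro ⟨j, hj⟩; rw [memD] at hj; omega
    · intro hi
      refine ⟨(l i).toNat, ?_⟩
      rw [memD]; have := hl0 i; omega
  have h2 : ∀ i, (∃ j, (i, j) ∈ D ∧ (i + 1, j) ∈ D) ↔ l i < m (i + 1) := by
    intro i
    have a1 := hl (show i ≤ i + 1 by omega)
    have a2 := hm (show i ≤ i + 1 by omega)
    constructor
    · rintro ⟨j, hj⟩; rw [memD, memD] at hj; omega
    · intro hi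
      refine ⟨(l i).toNat, ?_⟩
      rw [memD, memD]; have := hl0 i; omega
  simp only [h1, h2]
  have hfin : {i | l i < m i}.Finite := by
    refine (Set.finite_lt_nat N).subset ?_
    intro i hi
    simp only [Set.mem_ofPred_eq] at hi ⊢
    by_contra hN'
    rw [hN i (by omega)] at hi
    have := hl0 i; omega
  have hsub : {i | l i < m (i + 1)} ⊆ {i | l i < m i} := by
    intro i hi
    simp only [Set.mem_ofPred_eq] at hi ⊢
    have a2 := hm (show i ≤ i + 1 by omega)
    omega
  have hE : {i | l i < m i ∧ ¬ l i < m (i + 1)} = {i | l i < m i} \ {i | l i < m (i + 1)} := rfl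
  rw [hE, Set.ncard_sdiff hsub (hfin.subset hsub)]
  have := Set.ncard_le_ncard hsub hfin
  omega

lemma ht_pMap {k : ℕ} {f g : ℕ → ℤ} (hf : Bd k f) (hg : Bd k g) :
    htSkew (pMap k (SS g) \ pMap k (SS f)) = {i | PP k f i < PP k g (i + 1)}.ncard := by
  rw [pMap_SS hf, pMap_SS hg]
  obtain ⟨N, hN⟩ := hg.ev
  exact ht_rows (PP_anti hf) (PP_anti hg) (PP_nonneg k f) (PP_zero hN)

lemma ribbon_of {f g : ℕ → ℤ} (h : ∀ i, g (i + 1) ≤ f i) : IsRibbon (SS g \ SS f) := by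
  rintro ⟨i, j⟩ ⟨h1, -, -, h4⟩
  have a1 : ¬ ((j : ℤ) - i < f i) := h1.2
  have a2 : (((j + 1 : ℕ) : ℤ) - ((i + 1 : ℕ) : ℤ) < g (i + 1)) := h4.1
  have := h i
  push_cast at a2
  omega

lemma VP_ribbon {k : ℕ} (hk : 1 ≤ k) {a : Idx k} {ds as : List ℕ} {v : ℕ} (H : VP k ds v as) {f g : ℕ → ℤ}
    (h : Bd k f) (he : actF k ((ds ++ v :: as).map (LL k a)) (some f) = some g) :
    IsRibbon (SS g \ SS f) := by
  have e0 : (ds ++ v :: as).map (LL k a) = (ds ++ [v]).map (LL k a) ++ as.map (LL k a) := by simp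
  rw [e0] at he
  obtain ⟨ν, h1, h2⟩ := actF_append_some he
  have hbν := actF_Bd hk h h1
  apply ribbon_of
  intro i
  have a1 := P1a hk H.ha (fun p hp => H.lt p (by simp [hp])) h h1 i
  have a2 := (P2 hk (ps := ds ++ [v]) (by
        rw [List.pairwise_append]
        exact ⟨H.hd, by simp, fun p hp q hq => by simp at hq; subst hq; exact H.hdv p hp⟩)
        (fun p hp => H.lt p (by simp at hp ⊢; tauto)) hbν h2).2.1 i
  omega

lemma run_card {k : ℕ} (hk : 1 ≤ k) {u : Word k} {f g : ℕ → ℤ} (h : Bd k f) (he : actF k u (some f) = some g) :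
    pMap k (SS f) ⊆ pMap k (SS g) ∧ (pMap k (SS g) \ pMap k (SS f)).ncard = u.length := by
  have hg := actF_Bd hk h he
  constructor
  · rw [pMap_SS h, pMap_SS hg]
    rintro ⟨i, j⟩ hij
    have := (run_mono hk h he i).2.1
    simp only [Set.mem_ofPred_eq] at hij ⊢
    omega
  · induction u generalizing g with
    | nil => cases he; simp
    | cons c u ih =>
      obtain ⟨g', h1, h2⟩ := actF_cons_some he
      have hb := actF_Bd hk h h1
      obtain ⟨hA, rfl, -⟩ := stepF_Bd hk hb h2
      obtain ⟨i0, hi0⟩ := Low_exists hb hA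
      have ih' := ih h1 hb
      have hfin : (pMap k (SS g')).Finite := (pMap_bounded hb).1.1
      have n0 := PP_nonneg k g' i0
      have key : pMap k (SS (mv k c g')) \ pMap k (SS f) = insert (i0, (PP k g' i0).toNat) (pMap k (SS g') \ pMap k (SS f)) := by
        rw [pMap_SS hg, pMap_SS hb, pMap_SS h]
        ext ⟨i, j⟩
        simp only [Set.mem_sdiff, Set.mem_ofPred_eq, Set.mem_insert_iff, Prod.mk.injEq]
        rw [PP_mv_low hk hb hi0]
        have m := (run_mono hk h h1 i).2.1
        by_cases hi : i = i0
        · subst hi; simp only [if_true, true_and]; omega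
        · simp only [hi, if_false, false_and, false_or]; omega
      rw [key, Set.ncard_insert_of_notMem _ (hfin.subset Set.sdiff_subset), ih', List.length_cons]
      rw [pMap_SS hb]
      simp only [Set.mem_sdiff, Set.mem_ofPred_eq]
      omega

lemma run_supp {k : ℕ} (hk : 1 ≤ k) {u : Word k} {f g : ℕ → ℤ} (h : Bd k f) (he : actF k u (some f) = some g) :
    residSupp k (SS g \ SS f) = supp k u := by
  have key : ∀ x, (∃ c ∈ SS g \ SS f, res k c = x) ↔ x ∈ u := by
    intro x
    induction u generalizing g with
    | nil => cases he; simp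
    | cons c u ih =>
      obtain ⟨g', h1, h2⟩ := actF_cons_some he
      have hb := actF_Bd hk h h1
      obtain ⟨hA, rfl, -⟩ := stepF_Bd hk hb h2
      rw [List.mem_cons, ← ih h1]
      constructor
      · rintro ⟨⟨i, j⟩, ⟨hg, hf⟩, rfl⟩
        by_cases hc : (i, j) ∈ SS g'
        · exact Or.inr ⟨_, ⟨hc, hf⟩, rfl⟩
        · left
          have a1 : (j : ℤ) - i < mv k c g' i := hg
          have a2 : ¬ ((j : ℤ) - i < g' i) := hc
          by_cases hi : Ad k c g' i
          · rw [Ad_mv_pos hi] at a1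
            have : (j : ℤ) - i = g' i := by omega
            rw [← hi.1, ← this]; simp [res]
          · rw [Ad_mv_neg hi] at a1; exact absurd a1 a2
      · rintro (rfl | ⟨⟨i, j⟩, ⟨hg, hf⟩, rfl⟩)
        · obtain ⟨i, hi⟩ := hA
          have hlow := hb.low i
          have m := (run_mono hk h h1 i).1
          refine ⟨(i, (g' i + i).toNat), ⟨?_, ?_⟩, ?_⟩
          · show (((g' i + i).toNat : ℕ) : ℤ) - i < mv k x g' i
            rw [Ad_mv_pos hi]; omega
          · show ¬ ((((g' i + i).toNat : ℕ) : ℤ) - i < f i)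
            omega
          · rw [← hi.1]
            unfold res
            have : ((((g' i + i).toNat : ℕ) : ℤ)) = g' i + i := by omega
            have h3 : (((g' i + i).toNat : ℕ) : Idx k) = ((g' i + i : ℤ) : Idx k) := by
              rw [← this]; simp
            simp only [h3]; push_cast; ring
        · refine ⟨_, ⟨?_, hf⟩, rfl⟩
          have a1 : (j : ℤ) - i < g' i := hg
          show (j : ℤ) - i < mv k c g' i
          unfold mv; split_ifs <;> omega
  ext x
  unfold residSupp supp
  rw [Set.Finite.mem_toFinset, List.mem_toFinset, ← key]
  rfl

lemma neg_LL {k : ℕ} (hk : 1 ≤ k) (a : Idx k) {p : ℕ} (hp : p < k) : - LL k a p = LL k (-a) (k - 1 - p) := by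
  unfold LL
  have h : ((k - 1 - p : ℕ) : Idx k) = (k : Idx k) - 1 - p := by
    rw [Nat.cast_sub (by omega), Nat.cast_sub hk]; simp
  have h2 : (k : Idx k) + 1 = 0 := by
    have := ZMod.natCast_self (k + 1); push_cast at this; exact this
  rw [h]
  have : (k : Idx k) = -1 := by rw [eq_neg_iff_add_eq_zero]; exact h2
  rw [this]; ring

lemma VP_AP {k : ℕ} {ds as : List ℕ} {v : ℕ} (H : VP k ds v as) :
    AP k (ds.map (fun p => k - 1 - p)) (k - 1 - v) (as.map (fun p => k - 1 - p)) := by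
  have e : ds.map (fun p => k - 1 - p) ++ (k - 1 - v) :: as.map (fun p => k - 1 - p) =
    (ds ++ v :: as).map (fun p => k - 1 - p) := by simp
  have hv := H.lt v (by simp)
  constructor
  · rw [List.pairwise_map]
    refine H.hd.imp_of_mem ?_
    intro p q hp hq hpq
    have := H.lt p (by simp [hp]); have := H.lt q (by simp [hq]); omega
  · intro p hp
    obtain ⟨q, hq, rfl⟩ := List.mem_map.1 hp
    have := H.hdv q hq; have := H.lt q (by simp [hq]); omega
  · rw [List.pairwise_map]
    refine H.ha.imp_of_mem ?_
    intro p q hp hq hpq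
    have := H.lt p (by simp [hp]); have := H.lt q (by simp [hq]); omega
  · intro p hp
    obtain ⟨q, hq, rfl⟩ := List.mem_map.1 hp
    have := H.hav q hq; have := H.lt q (by simp [hq]); omega
  · intro p hp
    rw [e] at hp
    obtain ⟨q, hq, rfl⟩ := List.mem_map.1 hp
    omega
  · intro p hp hpv
    rw [e] at hp ⊢
    obtain ⟨q, hq, rfl⟩ := List.mem_map.1 hp
    have hqk := H.lt q hq
    refine List.mem_map.2 ⟨q - 1, H.conn q hq (by omega), by omega⟩

lemma kconj_pMap {k : ℕ} {f f' : ℕ → ℤ} (h : Bd k f) (e : SS f' = transposeSet (SS f)) :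
    kconj k (pMap k (SS f)) = pMap k (SS f') := by
  unfold kconj
  rw [pInv_pMap ((core_iff h.toBd0).2 h), e]

lemma kconds_of_run {k : ℕ} (hk : 1 ≤ k) {a : Idx k} {ds as : List ℕ} {v : ℕ} (H : VP k ds v as) {f g : ℕ → ℤ}
    (h : Bd k f) {u : Word k} (hu : u = (ds ++ v :: as).map (LL k a)) (he : actF k u (some f) = some g)
    (hc : IsKConnectedSet k (supp k u)) :
    kconds k u.length (pMap k (SS f)) (pMap k (SS g)) := by
  have hg := actF_Bd hk h he
  obtain ⟨f', g', hf', hg', ef, eg, he'⟩ := transpose_run hk h he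
  unfold kconds
  rw [kconj_pMap h ef, kconj_pMap hg eg, pInv_pMap ((core_iff h.toBd0).2 h), pInv_pMap ((core_iff hg.toBd0).2 hg),
    run_supp hk h he, ht_pMap h hg, ht_pMap hf' hg']
  refine ⟨(run_card hk h he).1, (run_card hk hf' he').1, (run_card hk h he).2, ?_, hc, ?_⟩
  · rw [hu] at he; exact VP_ribbon hk H h he
  · have hu' : u.map (fun c => -c) = (ds.map (fun p => k - 1 - p) ++ (k - 1 - v) :: as.map (fun p => k - 1 - p)).map (LL k (-a)) := by
      have e : ds.map (fun p => k - 1 - p) ++ (k - 1 - v) :: as.map (fun p => k - 1 - p) =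
        (ds ++ v :: as).map (fun p => k - 1 - p) := by simp
      rw [e, hu, List.map_map, List.map_map]
      refine List.map_congr_left fun p hp => ?_
      exact neg_LL hk a (H.lt p hp)
    rw [hu'] at he'
    rw [AP_height hk (VP_AP H) hf' he']
    rw [hu] at he
    rw [VP_height hk H h he, hu]
    simp; omega

lemma LL_pos {k : ℕ} (S : Finset (Idx k)) (i : Idx k) : LL k (gap k S) (pos k S i) = i := by
  unfold LL pos
  rw [ZMod.natCast_zmod_val]; ring

lemma pos_le {k : ℕ} (S : Finset (Idx k)) (i : Idx k) : pos k S i ≤ k := by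
  have := ZMod.val_lt (i - gap k S - 1); unfold pos; omega

lemma gap_notMem {k : ℕ} {S : Finset (Idx k)} (h : S ≠ Finset.univ) : gap k S ∉ S := by
  have hex : ∃ m : ℕ, m ≤ k ∧ (m : Idx k) ∉ S := by
    by_contra hh
    push Not at hh
    apply h
    ext x
    simp only [Finset.mem_univ, iff_true]
    have := hh x.val (by have := ZMod.val_lt x; omega)
    rwa [ZMod.natCast_zmod_val] at this
  unfold gap gapNat
  rw [dif_pos hex]
  exact (Nat.find_spec hex).2

lemma LL_k {k : ℕ} (a : Idx k) : LL k a k = a := by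
  unfold LL
  have h2 : (k : Idx k) + 1 = 0 := by
    have := ZMod.natCast_self (k + 1); push_cast at this; exact this
  linear_combination h2

lemma pos_lt {k : ℕ} {S : Finset (Idx k)} (h : S ≠ Finset.univ) {i : Idx k} (hi : i ∈ S) : pos k S i < k := by
  have := pos_le S i
  rcases this.lt_or_eq with h1 | h1
  · exact h1
  · exfalso
    have := LL_pos S i
    rw [h1, LL_k] at this
    rw [← this] at hi
    exact gap_notMem h hi

lemma pos_LL {k : ℕ} (S : Finset (Idx k)) {p : ℕ} (hp : p ≤ k) : pos k S (LL k (gap k S) p) = p := by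
  exact LL_inj (a := gap k S) (pos_le _ _) hp (LL_pos _ _)

lemma kconds_of_word {k : ℕ} (hk : 1 ≤ k) {f g : ℕ → ℤ} (h : Bd k f) {u : Word k} (hV : IsHookV k u) (hc : IsKConnected k u)
    (he : actF k u (some f) = some g) :
    kconds k u.length (pMap k (SS f)) (pMap k (SS g)) := by
  obtain ⟨hS, ds, as, v, hp, hd, ha⟩ := hV
  have hd' := List.isChain_iff_pairwise.1 hd
  have ha' := List.isChain_iff_pairwise.1 ha
  rw [List.pairwise_append] at hd'
  rw [List.pairwise_cons] at ha'
  have hmem : ∀ p, p ∈ ds ++ v :: as ↔ ∃ i ∈ supp k u, pos k (supp k u) i = p := by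
    intro p
    rw [← hp]; unfold posList
    simp [supp]
  have hu : u = (ds ++ v :: as).map (LL k (gap k (supp k u))) := by
    rw [← hp]; unfold posList
    rw [List.map_map]
    conv_lhs => rw [← List.map_id u]
    refine List.map_congr_left fun i _ => ?_
    simp [LL_pos]
  refine kconds_of_run (a := gap k (supp k u)) (ds := ds) (v := v) (as := as) hk ?_ h hu he hc
  refine ⟨hd'.1, fun p hp => hd'.2.2 p hp v (by simp), ha'.2, ha'.1, ?_, ?_⟩
  · intro p hp
    obtain ⟨i, hi, rfl⟩ := (hmem p).1 hp
    exact pos_lt hS hi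
  · intro p hp hvp
    obtain ⟨i, hi, rfl⟩ := (hmem p).1 hp
    obtain ⟨j, hj, hjv⟩ := (hmem v).1 (by simp)
    have hle := pos_le (supp k u) i
    have := pos_LL (supp k u) (p := pos k (supp k u) i - 1) (by omega)
    rw [hmem]
    refine ⟨LL k (gap k (supp k u)) (pos k (supp k u) i - 1), ?_, this⟩
    exact hc.2 j hj i hi _ (by rw [this]; omega) (by rw [this]; omega)

/-- all letters except the gap, in increasing position order -/
def RL (k : ℕ) (a : Idx k) : Word k := (List.range k).map (LL k a)

def IW (k : ℕ) (a : Idx k) (A : Finset (Idx k)) : Word k := (RL k a).filter (fun i => decide (i ∈ A))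

def DW (k : ℕ) (a : Idx k) (A : Finset (Idx k)) : Word k := (IW k a A).reverse

lemma RL_nodup {k : ℕ} (a : Idx k) : (RL k a).Nodup := by
  unfold RL
  rw [List.nodup_map_iff_inj_on List.nodup_range]
  intro p hp q hq h
  rw [List.mem_range] at hp hq
  exact LL_inj (by omega) (by omega) h

lemma exists_LL {k : ℕ} (a i : Idx k) : ∃ p ≤ k, LL k a p = i := by
  refine ⟨(i - a - 1).val, ?_, ?_⟩
  · have := ZMod.val_lt (i - a - 1); omega
  · unfold LL; rw [ZMod.natCast_zmod_val]; ring

lemma mem_RL {k : ℕ} (a i : Idx k) : i ∈ RL k a ↔ i ≠ a := by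
  unfold RL
  rw [List.mem_map]
  constructor
  · rintro ⟨p, hp, rfl⟩ e
    rw [List.mem_range] at hp
    conv_rhs at e => rw [← LL_k a]
    have := LL_inj (by omega) le_rfl e; omega
  · intro hi
    obtain ⟨p, hp, rfl⟩ := exists_LL a i
    refine ⟨p, ?_, rfl⟩
    rw [List.mem_range]
    rcases hp.lt_or_eq with h | rfl
    · exact h
    · exact absurd (LL_k a) hi

lemma IW_nodup {k : ℕ} (a : Idx k) (A) : (IW k a A).Nodup := (RL_nodup a).filter _

lemma mem_IW {k : ℕ} {a : Idx k} {A : Finset (Idx k)} (ha : a ∉ A) (i : Idx k) : i ∈ IW k a A ↔ i ∈ A := by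
  unfold IW
  rw [List.mem_filter, mem_RL]
  simp only [decide_eq_true_eq]
  constructor
  · exact fun h => h.2
  · exact fun h => ⟨fun e => ha (e ▸ h), h⟩

lemma IW_toFinset {k : ℕ} {a : Idx k} {A : Finset (Idx k)} (ha : a ∉ A) : (IW k a A).toFinset = A := by
  ext i; rw [List.mem_toFinset, mem_IW ha]

lemma IW_length {k : ℕ} {a : Idx k} {A : Finset (Idx k)} (ha : a ∉ A) : (IW k a A).length = A.card := by
  rw [← List.toFinset_card_of_nodup (IW_nodup a A), IW_toFinset ha]

lemma IW_eq_of {k : ℕ} {a : Idx k} {A : Finset (Idx k)} {ps : List ℕ} (hps : ps.Pairwise (· < ·)) (hlt : ∀ p ∈ ps, p < k)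
    (hA : ∀ p < k, LL k a p ∈ A ↔ p ∈ ps) : IW k a A = ps.map (LL k a) := by
  unfold IW RL
  rw [List.filter_map]
  congr 1
  apply List.Pairwise.eq_of_mem_iff (r := (· < ·)) (List.pairwise_lt_range.filter _) hps
  intro p
  simp only [List.mem_filter, List.mem_range, Function.comp, decide_eq_true_eq]
  constructor
  · rintro ⟨h1, h2⟩; exact (hA p h1).1 h2
  · intro h; exact ⟨hlt p h, (hA p (hlt p h)).2 h⟩

lemma iword_eq0 {k : ℕ} (A : Finset (Idx k)) : iwordOf k A = ((A.image (pos k A)).sort (· ≤ ·)).map (LL k (gap k A)) := by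
  unfold iwordOf
  generalize (A.image (pos k A)).sort (· ≤ ·) = l
  induction l with
  | nil => rfl
  | cons x l ih => simp_all [LL]

lemma dword_eq0 {k : ℕ} (A : Finset (Idx k)) : dwordOf k A = (((A.image (pos k A)).sort (· ≤ ·)).reverse).map (LL k (gap k A)) := by
  unfold dwordOf
  generalize ((A.image (pos k A)).sort (· ≤ ·)).reverse = l
  induction l with
  | nil => rfl
  | cons x l ih => simp_all [LL]

lemma iword_eq {k : ℕ} {A : Finset (Idx k)} (hA : A ≠ Finset.univ) : iwordOf k A = IW k (gap k A) A := by
  symm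
  rw [iword_eq0]
  apply IW_eq_of
  · exact Finset.sortedLT_sort _ |>.pairwise
  · intro p hp
    rw [Finset.mem_sort, Finset.mem_image] at hp
    obtain ⟨i, hi, rfl⟩ := hp
    exact pos_lt hA hi
  · intro p hp
    rw [Finset.mem_sort, Finset.mem_image]
    constructor
    · intro h; exact ⟨_, h, pos_LL A hp.le⟩
    · rintro ⟨i, hi, rfl⟩; rwa [LL_pos]

lemma dword_eq {k : ℕ} {A : Finset (Idx k)} (hA : A ≠ Finset.univ) : dwordOf k A = DW k (gap k A) A := by
  unfold DW
  rw [← iword_eq hA, iword_eq0, dword_eq0, List.map_reverse]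

lemma NA_symm {k : ℕ} {c d : Idx k} (h : NA c d) : NA d c := ⟨h.2, h.1⟩

lemma NA_LL {k : ℕ} {a : Idx k} {p q : ℕ} (hpq : p + 1 < q) (hq : q < k) : NA (LL k a p) (LL k a q) := by
  constructor
  · rw [LL_succ]; intro e; have := LL_inj (by omega) (by omega) e; omega
  · rw [LL_succ]; intro e; have := LL_inj (by omega) (by omega) e; omega

lemma RL_split {k : ℕ} (a : Idx k) {m : ℕ} (hm : m < k) :
    RL k a = (List.range m).map (LL k a) ++ LL k a m :: (List.range (k - 1 - m)).map (fun p => LL k a (m + 1 + p)) := by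
  unfold RL
  have : List.range k = List.range (m + (1 + (k - 1 - m))) := by congr 1; omega
  rw [this, List.range_add, List.range_add]
  simp only [List.map_append, List.map_map]
  congr 1
  simp only [List.range_succ, List.range_zero, List.nil_append, List.map_cons, List.map_nil, List.cons_append,
    Function.comp]
  congr 1
  refine List.map_congr_left fun p _ => ?_
  rw [show m + 1 + p = m + (1 + p) by omega]; rfl

/-- independence of the gap -/
lemma gap_indep {k : ℕ} {a a' : Idx k} {A : Finset (Idx k)} (ha : a ∉ A) (ha' : a' ∉ A) :
    ∃ X Y : Word k, IW k a A = X ++ Y ∧ IW k a' A = Y ++ X ∧ ∀ c ∈ X, ∀ d ∈ Y, NA c d := by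
  obtain ⟨m, hm, rfl⟩ := exists_LL a a'
  rcases hm.lt_or_eq with hm | hm
  · refine ⟨((List.range m).map (LL k a)).filter (fun i => decide (i ∈ A)),
      ((List.range (k - 1 - m)).map (fun p => LL k a (m + 1 + p))).filter (fun i => decide (i ∈ A)), ?_, ?_, ?_⟩
    · unfold IW
      rw [RL_split a hm, List.filter_append, List.filter_cons_of_neg (by simpa using ha')]
    · unfold IW
      rw [RL_split (LL k a m) (m := k - 1 - m) (by omega), List.filter_append, List.filter_cons_of_neg]
      · have : k - 1 - (k - 1 - m) = m := by omega
        rw [this]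
        congr 2
        · refine List.map_congr_left fun p _ => ?_
          unfold LL; push_cast; ring
        · refine List.map_congr_left fun p _ => ?_
          have h0 : LL k (LL k a m) (k - 1 - m + 1 + p) = LL k a (m + (k - 1 - m + 1) + 1 + p) := by
            unfold LL; push_cast; ring
          have : m + (k - 1 - m + 1) + 1 + p = (k + 1) + p := by omega
          rw [h0, this]
          unfold LL
          have := ZMod.natCast_self (k + 1)
          rw [Nat.cast_add (k + 1) p, this]; ring
      · have h0 : LL k (LL k a m) (k - 1 - m) = LL k a (m + 1 + (k - 1 - m)) := by
          unfold LL; push_cast; ring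
        have : m + 1 + (k - 1 - m) = k := by omega
        rw [h0, this, LL_k]
        simpa using ha
    · intro c hc d hd
      simp only [List.mem_filter, List.mem_map, List.mem_range] at hc hd
      obtain ⟨⟨p, hp, rfl⟩, -⟩ := hc
      obtain ⟨⟨q, hq, rfl⟩, -⟩ := hd
      exact NA_LL (by omega) (by omega)
  · rw [hm, LL_k]
    exact ⟨IW k a A, [], by simp, by simp, by simp⟩

lemma IW_gap {k : ℕ} {a a' : Idx k} {A : Finset (Idx k)} (ha : a ∉ A) (ha' : a' ∉ A) (o) :
    actF k (IW k a A) o = actF k (IW k a' A) o := by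
  obtain ⟨X, Y, h1, h2, h3⟩ := gap_indep ha ha'
  rw [h1, h2, actF_comm h3]

lemma DW_gap {k : ℕ} {a a' : Idx k} {A : Finset (Idx k)} (ha : a ∉ A) (ha' : a' ∉ A) (o) :
    actF k (DW k a A) o = actF k (DW k a' A) o := by
  obtain ⟨X, Y, h1, h2, h3⟩ := gap_indep ha ha'
  unfold DW
  rw [h1, h2, List.reverse_append, List.reverse_append, actF_comm]
  intro c hc d hd
  rw [List.mem_reverse] at hc hd
  exact NA_symm (h3 d hd c hc)

/-- the canonical word of a pair -/
def WW (k : ℕ) (p : Finset (Idx k) × Finset (Idx k)) : Word k :=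
  DW k (gap k (p.1 ∪ p.2)) p.1 ++ IW k (gap k (p.1 ∪ p.2)) p.2

lemma WW_act {k : ℕ} {A B : Finset (Idx k)} (h : A ∪ B ≠ Finset.univ) (o) :
    actF k (dwordOf k A ++ iwordOf k B) o = actF k (WW k (A, B)) o := by
  have hA : A ≠ Finset.univ := by rintro rfl; simp at h
  have hB : B ≠ Finset.univ := by rintro rfl; simp at h
  have hg := gap_notMem h
  simp only [Finset.mem_union, not_or] at hg
  rw [dword_eq hA, iword_eq hB, actF_append, IW_gap (gap_notMem hB) hg.2, DW_gap (gap_notMem hA) hg.1, ← actF_append]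
  rfl

/-- `c` is the bottom of a connected component of `S` -/
def Bot (k : ℕ) (S : Finset (Idx k)) (c : Idx k) : Prop :=
  c ∈ S ∧ ∀ q ∈ S, pos k S q < pos k S c → pos k S q + 1 < pos k S c

lemma tog_split {k : ℕ} {S : Finset (Idx k)} (hS : S ≠ Finset.univ) {c : Idx k} (hc : Bot k S c) :
    ∃ X Y : Word k, RL k (gap k S) = X ++ c :: Y ∧ c ∉ X ∧ c ∉ Y ∧ ∀ d ∈ X, d ∈ S → NA c d := by
  have hlt := pos_lt hS hc.1
  have h := RL_split (gap k S) hlt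
  rw [LL_pos] at h
  have hn := RL_nodup (gap k S)
  rw [h, List.nodup_append] at hn
  refine ⟨_, _, h, ?_, ?_, ?_⟩
  · intro hcx
    exact hn.2.2 c hcx c (by simp) rfl
  · exact (List.nodup_cons.1 hn.2.1).1
  · intro d hd hdS
    obtain ⟨p, hp, rfl⟩ := List.mem_map.1 hd
    rw [List.mem_range] at hp
    have h2 := pos_LL S (p := p) (by omega)
    have := hc.2 _ hdS (by rw [h2]; exact hp)
    rw [h2] at this
    have h3 := NA_LL (a := gap k S) this hlt
    rw [LL_pos] at h3
    exact NA_symm h3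

lemma filter_erase_eq {k : ℕ} {X : Word k} {c : Idx k} (h : c ∉ X) (A : Finset (Idx k)) :
    X.filter (fun i => decide (i ∈ A.erase c)) = X.filter (fun i => decide (i ∈ A)) := by
  refine List.filter_congr fun x hx => ?_
  have : x ≠ c := fun e => h (e ▸ hx)
  simp [this]

lemma filter_insert_eq {k : ℕ} {X : Word k} {c : Idx k} (h : c ∉ X) (A : Finset (Idx k)) :
    X.filter (fun i => decide (i ∈ insert c A)) = X.filter (fun i => decide (i ∈ A)) := by
  refine List.filter_congr fun x hx => ?_
  have : x ≠ c := fun e => h (e ▸ hx)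
  simp [this]

lemma WW_both {k : ℕ} (hk : 1 ≤ k) {A B : Finset (Idx k)} (hS : A ∪ B ≠ Finset.univ) {c : Idx k} (hc : Bot k (A ∪ B) c)
    (h1 : c ∈ A) (h2 : c ∈ B) (o) : actF k (WW k (A, B)) o = none := by
  obtain ⟨X, Y, e, hX, hY, hNA⟩ := tog_split hS hc
  unfold WW DW IW
  simp only
  rw [e]
  rw [List.filter_append, List.filter_append, List.filter_cons_of_pos (by simpa using h1),
    List.filter_cons_of_pos (by simpa using h2)]
  simp only [List.reverse_append, List.reverse_cons, List.append_assoc, actF_append]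
  have key : ∀ o', actF k [c] (actF k (X.filter (fun i => decide (i ∈ A))).reverse (actF k (X.filter (fun i => decide (i ∈ B))) o'))
      = actF k (X.filter (fun i => decide (i ∈ A))).reverse (actF k (X.filter (fun i => decide (i ∈ B))) (actF k [c] o')) := by
    intro o'
    rw [← actF_append, ← actF_append, ← actF_append, ← actF_append]
    have := actF_comm1 (c := c) (v := (X.filter (fun i => decide (i ∈ A))).reverse ++ X.filter (fun i => decide (i ∈ B))) (by
      intro d hd
      simp only [List.mem_append, List.mem_reverse, List.mem_filter, decide_eq_true_eq] at hd
      rcases hd with hd | hd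
      · exact hNA d hd.1 (by simp [hd.2])
      · exact hNA d hd.1 (by simp [hd.2])) o'
    simpa using this
  have e3 : actF k (c :: Y.filter (fun i => decide (i ∈ B))) o = actF k [c] (actF k (Y.filter (fun i => decide (i ∈ B))) o) := rfl
  rw [e3, key]
  have : ∀ o', actF k [c] (actF k [c] o') = none := fun o' => stepF_sq hk c o'
  rw [this]
  simp [actF_none]

lemma WW_tog {k : ℕ} {A B : Finset (Idx k)} (hS : A ∪ B ≠ Finset.univ) {c : Idx k} (hc : Bot k (A ∪ B) c)
    (h1 : c ∈ A) (h2 : c ∉ B) (o) : actF k (WW k (A, B)) o = actF k (WW k (A.erase c, insert c B)) o := by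
  obtain ⟨X, Y, e, hX, hY, hNA⟩ := tog_split hS hc
  have hU : A.erase c ∪ insert c B = A ∪ B := by
    ext x; by_cases hx : x = c
    · subst hx; simp [h1]
    · simp [hx]
  unfold WW DW IW
  simp only
  rw [hU, e]
  simp only [List.filter_append]
  rw [List.filter_cons_of_pos (by simpa using h1), List.filter_cons_of_neg (by simpa using h2),
    List.filter_cons_of_neg (by simp), List.filter_cons_of_pos (by simp), filter_erase_eq hX, filter_erase_eq hY,
    filter_insert_eq hX, filter_insert_eq hY]
  simp only [List.reverse_append, List.reverse_cons, List.append_assoc, actF_append]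
  have key : ∀ o', actF k [c] (actF k (X.filter (fun i => decide (i ∈ A))).reverse (actF k (X.filter (fun i => decide (i ∈ B))) o'))
      = actF k (X.filter (fun i => decide (i ∈ A))).reverse (actF k (X.filter (fun i => decide (i ∈ B))) (actF k [c] o')) := by
    intro o'
    rw [← actF_append, ← actF_append, ← actF_append, ← actF_append]
    have := actF_comm1 (c := c) (v := (X.filter (fun i => decide (i ∈ A))).reverse ++ X.filter (fun i => decide (i ∈ B))) (by
      intro d hd
      simp only [List.mem_append, List.mem_reverse, List.mem_filter, decide_eq_true_eq] at hd
      rcases hd with hd | hd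
      · exact hNA d hd.1 (by simp [hd.2])
      · exact hNA d hd.1 (by simp [hd.2])) o'
    simpa using this
  rw [key]
  rfl

lemma pos_inj {k : ℕ} (S : Finset (Idx k)) {i j : Idx k} (h : pos k S i = pos k S j) : i = j := by
  rw [← LL_pos S i, ← LL_pos S j, h]

def mEl (k : ℕ) (S : Finset (Idx k)) : Idx k :=
  if h : ∃ c ∈ S, ∀ q ∈ S, pos k S c ≤ pos k S q then h.choose else 0

lemma mEl_spec {k : ℕ} {S : Finset (Idx k)} (h : S.Nonempty) :
    mEl k S ∈ S ∧ ∀ q ∈ S, pos k S (mEl k S) ≤ pos k S q := by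
  have hex : ∃ c ∈ S, ∀ q ∈ S, pos k S c ≤ pos k S q := S.exists_min_image (pos k S) h
  unfold mEl
  rw [dif_pos hex]
  exact hex.choose_spec

lemma mEl_bot {k : ℕ} {S : Finset (Idx k)} (h : S.Nonempty) : Bot k S (mEl k S) := by
  obtain ⟨h1, h2⟩ := mEl_spec h
  exact ⟨h1, fun q hq hlt => absurd (h2 q hq) (by omega)⟩

def cEl (k : ℕ) (S : Finset (Idx k)) : Idx k :=
  if h : ∃ c, Bot k S c ∧ c ≠ mEl k S then h.choose else 0

lemma cEl_spec {k : ℕ} {S : Finset (Idx k)} (h : S ≠ Finset.univ) (hc : ¬ IsKConnectedSet k S) :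
    Bot k S (cEl k S) ∧ cEl k S ≠ mEl k S := by
  have hex : ∃ c, Bot k S c ∧ c ≠ mEl k S := by
    unfold IsKConnectedSet at hc
    push Not at hc
    obtain ⟨i, hi, j, hj, m, h1, h2, hm⟩ := hc h
    have hmj : pos k S m < pos k S j := by
      rcases h2.lt_or_eq with h3 | h3
      · exact h3
      · exact absurd (pos_inj S h3 ▸ hj) hm
    obtain ⟨c, hc1, hc2⟩ := (S.filter (fun q => pos k S m < pos k S q)).exists_min_image (pos k S) ⟨j, by simp [hj, hmj]⟩
    rw [Finset.mem_filter] at hc1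
    refine ⟨c, ⟨hc1.1, ?_⟩, ?_⟩
    · intro q hq hlt
      have : ¬ pos k S m < pos k S q := fun hh => by
        have := hc2 q (by simp [hq, hh]); omega
      have hne : pos k S q ≠ pos k S m := fun e => hm (pos_inj S e ▸ hq)
      omega
    · intro e
      have := (mEl_spec ⟨i, hi⟩).2 i hi
      rw [← e] at this
      omega
  unfold cEl
  rw [dif_pos hex]
  exact hex.choose_spec

abbrev Pr (k : ℕ) := Finset (Idx k) × Finset (Idx k)

def TT (k r : ℕ) : Finset (Pr k) := Finset.univ.filter (fun p => p.1.card + p.2.card = r)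

def T1 (k r : ℕ) : Finset (Pr k) := (TT k r).filter (fun p => mEl k (p.1 ∪ p.2) ∈ p.1 ∧ mEl k (p.1 ∪ p.2) ∉ p.2)

def T2 (k r : ℕ) : Finset (Pr k) := (T1 k r).filter (fun p => IsKConnectedSet k (p.1 ∪ p.2))

lemma TT_proper {k r : ℕ} (hr : r ≤ k) {p : Pr k} (h : p ∈ TT k r) : p.1 ∪ p.2 ≠ Finset.univ := by
  intro e
  have h1 := Finset.card_union_le p.1 p.2
  rw [e, Finset.card_univ, ZMod.card] at h1
  unfold TT at h
  rw [Finset.mem_filter] at h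
  omega

lemma TT_nonempty {k r : ℕ} (hr : 1 ≤ r) {p : Pr k} (h : p ∈ TT k r) : (p.1 ∪ p.2).Nonempty := by
  rw [Finset.nonempty_iff_ne_empty]
  intro e
  rw [Finset.union_eq_empty] at e
  unfold TT at h
  rw [Finset.mem_filter, e.1, e.2] at h
  simp at h; omega

lemma tog_union {k : ℕ} {A B : Finset (Idx k)} {c : Idx k} (h : c ∈ A) : A.erase c ∪ insert c B = A ∪ B := by
  ext x; by_cases hx : x = c
  · subst hx; simp [h]
  · simp [hx]

section sums
variable {R : Type*} [CommRing R]

lemma sum_pairs {k r : ℕ} (hr1 : 1 ≤ r) (hrk : r ≤ k) (φ : Pr k → R)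
    (hboth : ∀ A B c, A ∪ B ≠ Finset.univ → Bot k (A ∪ B) c → c ∈ A → c ∈ B → φ (A, B) = 0)
    (htog : ∀ A B c, A ∪ B ≠ Finset.univ → Bot k (A ∪ B) c → c ∈ A → c ∉ B → φ (A, B) = φ (A.erase c, insert c B)) :
    ∑ p ∈ TT k r, (-1 : R) ^ p.2.card * (p.1.card : R) * φ p = ∑ p ∈ T1 k r, (-1 : R) ^ p.2.card * φ p := by
  set F : Pr k → R := fun p => (-1 : R) ^ p.2.card * (p.1.card : R) * φ p with hF
  have hsplit : ∑ p ∈ TT k r, F p = ∑ p ∈ T1 k r, F p +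
      ∑ p ∈ (TT k r).filter (fun p => mEl k (p.1 ∪ p.2) ∉ p.1 ∧ mEl k (p.1 ∪ p.2) ∈ p.2), F p := by
    unfold T1
    rw [Finset.sum_filter, Finset.sum_filter, ← Finset.sum_add_distrib]
    refine Finset.sum_congr rfl fun p hp => ?_
    have hS := TT_proper hrk hp
    have hm := mEl_bot (TT_nonempty hr1 hp)
    by_cases h1 : mEl k (p.1 ∪ p.2) ∈ p.1 <;> by_cases h2 : mEl k (p.1 ∪ p.2) ∈ p.2
    · simp only [h1, h2, not_true, and_false, false_and, if_false]
      simp only [hF, hboth p.1 p.2 _ hS hm h1 h2]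
      ring
    · simp [h1, h2]
    · simp [h1, h2]
    · exfalso
      have := hm.1
      rw [Finset.mem_union] at this
      tauto
  have hbij : ∑ p ∈ (TT k r).filter (fun p => mEl k (p.1 ∪ p.2) ∉ p.1 ∧ mEl k (p.1 ∪ p.2) ∈ p.2), F p
      = ∑ p ∈ T1 k r, -((-1 : R) ^ p.2.card * ((p.1.card : R) - 1) * φ p) := by
    symm
    refine Finset.sum_bij' (fun p _ => (p.1.erase (mEl k (p.1 ∪ p.2)), insert (mEl k (p.1 ∪ p.2)) p.2))
      (fun p _ => (insert (mEl k (p.1 ∪ p.2)) p.1, p.2.erase (mEl k (p.1 ∪ p.2)))) ?_ ?_ ?_ ?_ ?_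
    · intro p hp
      unfold T1 at hp
      rw [Finset.mem_filter] at hp ⊢
      obtain ⟨h0, h1, h2⟩ := hp
      simp only
      rw [tog_union h1]
      refine ⟨?_, by simp, by simp⟩
      unfold TT at h0 ⊢
      rw [Finset.mem_filter] at h0 ⊢
      have : 0 < p.1.card := Finset.card_pos.2 ⟨_, h1⟩
      simp only [Finset.mem_univ, true_and, Finset.card_erase_of_mem h1, Finset.card_insert_of_notMem h2] at h0 ⊢
      omega
    · intro p hp
      unfold T1
      rw [Finset.mem_filter] at hp ⊢
      obtain ⟨h0, h1, h2⟩ := hp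
      have hu : insert (mEl k (p.1 ∪ p.2)) p.1 ∪ p.2.erase (mEl k (p.1 ∪ p.2)) = p.1 ∪ p.2 :=
        (Finset.union_comm _ _).trans ((tog_union h2).trans (Finset.union_comm _ _))
      simp only
      rw [hu]
      refine ⟨?_, by simp, by simp⟩
      unfold TT at h0 ⊢
      rw [Finset.mem_filter] at h0 ⊢
      have : 0 < p.2.card := Finset.card_pos.2 ⟨_, h2⟩
      simp only [Finset.mem_univ, true_and, Finset.card_erase_of_mem h2, Finset.card_insert_of_notMem h1] at h0 ⊢
      omega
    · intro p hp
      unfold T1 at hp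
      rw [Finset.mem_filter] at hp
      obtain ⟨h0, h1, h2⟩ := hp
      simp only
      rw [tog_union h1, Finset.insert_erase h1, Finset.erase_insert h2]
    · intro p hp
      rw [Finset.mem_filter] at hp
      obtain ⟨h0, h1, h2⟩ := hp
      simp only
      have : insert (mEl k (p.1 ∪ p.2)) p.1 ∪ p.2.erase (mEl k (p.1 ∪ p.2)) = p.1 ∪ p.2 := by
        rw [Finset.union_comm, tog_union h2, Finset.union_comm]
      rw [this, Finset.insert_erase h2, Finset.erase_insert h1]
    · intro p hp
      unfold T1 at hp
      rw [Finset.mem_filter] at hp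
      obtain ⟨h0, h1, h2⟩ := hp
      have hS := TT_proper hrk h0
      have hm := mEl_bot (TT_nonempty hr1 h0)
      simp only [hF]
      rw [← htog p.1 p.2 _ hS hm h1 h2, Finset.card_insert_of_notMem h2, Finset.card_erase_of_mem h1,
        Nat.cast_sub (Finset.card_pos.2 ⟨_, h1⟩), pow_succ]
      push_cast
      ring
  rw [hsplit, hbij, ← Finset.sum_add_distrib]
  refine Finset.sum_congr rfl fun p _ => ?_
  simp only [hF]; ring

def tg (k : ℕ) (c : Idx k) (p : Pr k) : Pr k :=
  if c ∈ p.1 then (if c ∈ p.2 then p else (p.1.erase c, insert c p.2)) else (insert c p.1, p.2.erase c)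

lemma tg_union {k : ℕ} {c : Idx k} {p : Pr k} (h : c ∈ p.1 ∪ p.2) : (tg k c p).1 ∪ (tg k c p).2 = p.1 ∪ p.2 := by
  unfold tg
  rw [Finset.mem_union] at h
  split_ifs with h1 h2
  · rfl
  · exact tog_union h1
  · have h2 : c ∈ p.2 := by tauto
    simp only
    rw [Finset.union_comm, tog_union h2, Finset.union_comm]

lemma tg_tg {k : ℕ} {c : Idx k} {p : Pr k} (h : c ∈ p.1 ∪ p.2) : tg k c (tg k c p) = p := by
  rw [Finset.mem_union] at h
  by_cases h1 : c ∈ p.1 <;> by_cases h2 : c ∈ p.2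
  · simp [tg, h1, h2]
  · simp [tg, h1, h2]
  · simp [tg, h1, h2]
  · tauto

lemma tg_TT {k r : ℕ} {c : Idx k} {p : Pr k} (h : c ∈ p.1 ∪ p.2) (hp : p ∈ TT k r) : tg k c p ∈ TT k r := by
  rw [Finset.mem_union] at h
  unfold TT at hp ⊢
  rw [Finset.mem_filter] at hp ⊢
  refine ⟨Finset.mem_univ _, ?_⟩
  by_cases h1 : c ∈ p.1 <;> by_cases h2 : c ∈ p.2
  · simpa [tg, h1, h2] using hp.2
  · have : 0 < p.1.card := Finset.card_pos.2 ⟨_, h1⟩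
    simp only [tg, h1, h2, if_true, if_false, Finset.card_erase_of_mem h1, Finset.card_insert_of_notMem h2]
    omega
  · have : 0 < p.2.card := Finset.card_pos.2 ⟨_, h2⟩
    simp only [tg, h1, if_false, Finset.card_erase_of_mem h2, Finset.card_insert_of_notMem h1]
    omega
  · tauto

lemma tg_mem {k : ℕ} {c m : Idx k} (hcm : m ≠ c) (p : Pr k) :
    (m ∈ (tg k c p).1 ↔ m ∈ p.1) ∧ (m ∈ (tg k c p).2 ↔ m ∈ p.2) := by
  unfold tg
  split_ifs <;> simp [hcm]

lemma sum_conn {k r : ℕ} (_hr1 : 1 ≤ r) (hrk : r ≤ k) (φ : Pr k → R)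
    (hboth : ∀ A B c, A ∪ B ≠ Finset.univ → Bot k (A ∪ B) c → c ∈ A → c ∈ B → φ (A, B) = 0)
    (htog : ∀ A B c, A ∪ B ≠ Finset.univ → Bot k (A ∪ B) c → c ∈ A → c ∉ B → φ (A, B) = φ (A.erase c, insert c B)) :
    ∑ p ∈ T1 k r, (-1 : R) ^ p.2.card * φ p = ∑ p ∈ T2 k r, (-1 : R) ^ p.2.card * φ p := by
  unfold T2
  rw [← Finset.sum_filter_add_sum_filter_not (T1 k r) (fun p => IsKConnectedSet k (p.1 ∪ p.2))]
  rw [add_eq_left]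
  have hmem : ∀ p ∈ (T1 k r).filter (fun p => ¬ IsKConnectedSet k (p.1 ∪ p.2)), p ∈ TT k r ∧ p.1 ∪ p.2 ≠ Finset.univ ∧
      Bot k (p.1 ∪ p.2) (cEl k (p.1 ∪ p.2)) ∧ cEl k (p.1 ∪ p.2) ≠ mEl k (p.1 ∪ p.2) := by
    intro p hp
    unfold T1 at hp
    rw [Finset.mem_filter, Finset.mem_filter] at hp
    have hS := TT_proper hrk hp.1.1
    exact ⟨hp.1.1, hS, cEl_spec hS hp.2⟩
  refine Finset.sum_involution (fun p _ => tg k (cEl k (p.1 ∪ p.2)) p) ?_ ?_ ?_ ?_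
  · intro p hp
    obtain ⟨h0, hS, hb, -⟩ := hmem p hp
    set c := cEl k (p.1 ∪ p.2)
    by_cases h1 : c ∈ p.1 <;> by_cases h2 : c ∈ p.2
    · have e := hboth p.1 p.2 c hS hb h1 h2
      simp [tg, h1, h2, e]
    · have e := htog p.1 p.2 c hS hb h1 h2
      simp only [tg, h1, h2, if_true, if_false]
      rw [← e, Finset.card_insert_of_notMem h2, pow_succ]
      ring
    · have hu : insert c p.1 ∪ p.2.erase c = p.1 ∪ p.2 := by
        rw [Finset.union_comm, tog_union h2, Finset.union_comm]
      have e := htog (insert c p.1) (p.2.erase c) c (by rw [hu]; exact hS) (by rw [hu]; exact hb) (by simp) (by simp)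
      rw [Finset.erase_insert h1, Finset.insert_erase h2] at e
      simp only [tg, h1, if_false]
      rw [e, Finset.card_erase_of_mem h2]
      have : p.2.card = (p.2.card - 1) + 1 := by have : 0 < p.2.card := Finset.card_pos.2 ⟨_, h2⟩; omega
      conv_lhs => enter [1]; rw [this, pow_succ]
      ring
    · have := hb.1
      rw [Finset.mem_union] at this; tauto
  · intro p hp hne
    obtain ⟨h0, hS, hb, -⟩ := hmem p hp
    set c := cEl k (p.1 ∪ p.2)
    intro e
    by_cases h1 : c ∈ p.1 <;> by_cases h2 : c ∈ p.2
    · have e := hboth p.1 p.2 c hS hb h1 h2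
      simp [e] at hne
    · simp only [tg, h1, h2, if_true, if_false] at e
      have := congrArg Prod.snd e
      simp only [Finset.insert_eq_self] at this
      exact h2 this
    · simp only [tg, h1, if_false] at e
      have := congrArg Prod.fst e
      simp only [Finset.insert_eq_self] at this
      exact h1 this
    · have := hb.1
      rw [Finset.mem_union] at this; tauto
  · intro p hp
    obtain ⟨h0, hS, hb, hm⟩ := hmem p hp
    unfold T1 at hp ⊢
    rw [Finset.mem_filter, Finset.mem_filter] at hp ⊢
    rw [tg_union hb.1, (tg_mem hm.symm p).1, (tg_mem hm.symm p).2]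
    exact ⟨⟨tg_TT hb.1 h0, hp.1.2⟩, hp.2⟩
  · intro p hp
    obtain ⟨h0, hS, hb, hm⟩ := hmem p hp
    rw [tg_union hb.1, tg_tg hb.1]

end sums

lemma asc_inc (as : List ℕ) (v : ℕ) (h : (v :: as).Pairwise (· < ·)) :
    ((v :: as).zip (v :: as).tail).countP (fun p => decide (p.1 < p.2)) = as.length := by
  induction as generalizing v with
  | nil => rfl
  | cons a as ih =>
    have h2 := ih a (List.pairwise_cons.1 h).2
    have h3 := (List.pairwise_cons.1 h).1 a (by simp)
    simp only [List.tail_cons, List.zip_cons_cons, List.countP_cons, List.length_cons] at h2 ⊢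
    rw [h2]; simp [h3]

lemma asc_hook (ds as : List ℕ) (v : ℕ) (h1 : (ds ++ [v]).Pairwise (· > ·)) (h : (v :: as).Pairwise (· < ·)) :
    ((ds ++ v :: as).zip (ds ++ v :: as).tail).countP (fun p => decide (p.1 < p.2)) = as.length := by
  induction ds with
  | nil => exact asc_inc as v h
  | cons d ds ih =>
    rw [List.cons_append, List.pairwise_cons] at h1
    have h2 := ih h1.2
    rw [List.cons_append, List.tail_cons]
    cases ds with
    | nil =>
      have h3 := h1.1 v (by simp)
      simp only [List.nil_append, List.zip_cons_cons, List.countP_cons, List.tail_cons] at h2 ⊢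
      rw [h2]
      simp; omega
    | cons e ds =>
      have h3 := h1.1 e (by simp)
      simp only [List.cons_append, List.zip_cons_cons, List.countP_cons, List.tail_cons] at h2 ⊢
      rw [h2]
      simp; omega

lemma IW_pos_sorted {k : ℕ} (S A : Finset (Idx k)) : ((IW k (gap k S) A).map (pos k S)).Pairwise (· < ·) := by
  rw [List.pairwise_map]
  unfold IW RL
  refine List.Pairwise.filter _ ?_
  rw [List.pairwise_map]
  refine List.Pairwise.imp_of_mem ?_ List.pairwise_lt_range
  intro a b ha hb hab
  rw [List.mem_range] at ha hb
  rw [pos_LL S (by omega), pos_LL S (by omega)]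
  exact hab

lemma WW_supp {k : ℕ} {p : Pr k} (h : p.1 ∪ p.2 ≠ Finset.univ) : supp k (WW k p) = p.1 ∪ p.2 := by
  have hg := gap_notMem h
  rw [Finset.mem_union] at hg
  push Not at hg
  ext x
  unfold supp WW DW
  rw [List.mem_toFinset, List.mem_append, List.mem_reverse, mem_IW hg.1, mem_IW hg.2, Finset.mem_union]

lemma WW_length {k : ℕ} {p : Pr k} (h : p.1 ∪ p.2 ≠ Finset.univ) : (WW k p).length = p.1.card + p.2.card := by
  have hg := gap_notMem h
  rw [Finset.mem_union] at hg
  push Not at hg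
  unfold WW DW
  rw [List.length_append, List.length_reverse, IW_length hg.1, IW_length hg.2]

lemma mem_T2 {k r : ℕ} {p : Pr k} : p ∈ T2 k r ↔ p.1.card + p.2.card = r ∧ mEl k (p.1 ∪ p.2) ∈ p.1 ∧
    mEl k (p.1 ∪ p.2) ∉ p.2 ∧ IsKConnectedSet k (p.1 ∪ p.2) := by
  unfold T2 T1 TT
  simp only [Finset.mem_filter, Finset.mem_univ, true_and]
  tauto

lemma WW_mem {k r : ℕ} {p : Pr k} (hp : p ∈ T2 k r) : WW k p ∈ VSetC k r (p.2.card : ℤ) := by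
  rw [mem_T2] at hp
  obtain ⟨h0, h1, h2, hc⟩ := hp
  have hS := hc.1
  have hsupp := WW_supp hS
  have hm := mEl_spec (S := p.1 ∪ p.2) ⟨_, Finset.mem_union_left _ h1⟩
  have hg := gap_notMem hS
  rw [Finset.mem_union] at hg
  push Not at hg
  have hsA := IW_pos_sorted (p.1 ∪ p.2) p.1
  have hsB := IW_pos_sorted (p.1 ∪ p.2) p.2
  have hmA := (mem_IW hg.1 (mEl k (p.1 ∪ p.2))).2 h1
  have hlB := IW_length hg.2
  have hpl : posList k (WW k p) = (((IW k (gap k (p.1 ∪ p.2)) p.1).map (pos k (p.1 ∪ p.2))).reverse) ++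
      (IW k (gap k (p.1 ∪ p.2)) p.2).map (pos k (p.1 ∪ p.2)) := by
    unfold posList
    rw [hsupp]
    unfold WW DW
    rw [List.map_append, List.map_reverse]
  have hx : ∀ q ∈ IW k (gap k (p.1 ∪ p.2)) p.2, pos k (p.1 ∪ p.2) (mEl k (p.1 ∪ p.2)) < pos k (p.1 ∪ p.2) q := by
    intro q hq
    rw [mem_IW hg.2] at hq
    refine lt_of_le_of_ne (hm.2 q (Finset.mem_union_right _ hq)) ?_
    intro e
    exact h2 (pos_inj _ e ▸ hq)
  generalize hX : IW k (gap k (p.1 ∪ p.2)) p.1 = X at *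
  cases X with
  | nil => simp at hmA
  | cons x t =>
    have hxm : x = mEl k (p.1 ∪ p.2) := by
      rw [List.map_cons, List.pairwise_cons] at hsA
      rw [List.mem_cons] at hmA
      rcases hmA with e | e
      · exact e.symm
      · exfalso
        have h3 := hsA.1 _ (List.mem_map_of_mem (f := pos k (p.1 ∪ p.2)) e)
        have hxA : x ∈ p.1 := by rw [← mem_IW hg.1, hX]; simp
        have := hm.2 x (Finset.mem_union_left _ hxA)
        omega
    rw [List.map_cons, List.reverse_cons, List.append_assoc, List.singleton_append] at hpl
    have c1 : (((t.map (pos k (p.1 ∪ p.2))).reverse) ++ [pos k (p.1 ∪ p.2) x]).Pairwise (· > ·) := by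
      rw [← List.reverse_cons, ← List.map_cons, List.pairwise_reverse]
      exact hsA
    have c2 : (pos k (p.1 ∪ p.2) x :: (IW k (gap k (p.1 ∪ p.2)) p.2).map (pos k (p.1 ∪ p.2))).Pairwise (· < ·) := by
      rw [List.pairwise_cons]
      refine ⟨?_, hsB⟩
      intro q hq
      rw [List.mem_map] at hq
      obtain ⟨q, hq, rfl⟩ := hq
      rw [hxm]; exact hx q hq
    refine ⟨⟨⟨by rw [hsupp]; exact hS, _, _, _, hpl, List.isChain_iff_pairwise.2 c1, List.isChain_iff_pairwise.2 c2⟩, ?_, ?_⟩, ?_⟩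
    · rw [WW_length hS, h0]
    · unfold asc
      rw [hpl, asc_hook _ _ _ c1 c2, List.length_map, hlB]
    · unfold IsKConnected; rw [hsupp]; exact hc

lemma WW_inj {k r : ℕ} {p q : Pr k} (hp : p ∈ T2 k r) (hq : q ∈ T2 k r) (h : WW k p = WW k q) : p = q := by
  have h1 := (WW_mem hp).1.2.2
  have h2 := (WW_mem hq).1.2.2
  rw [h, h2] at h1
  have hcB : q.2.card = p.2.card := by exact_mod_cast h1
  rw [mem_T2] at hp hq
  have hSp := hp.2.2.2.1
  have hSq := hq.2.2.2.1
  have hU : p.1 ∪ p.2 = q.1 ∪ q.2 := by rw [← WW_supp hSp, ← WW_supp hSq, h]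
  have hgp := gap_notMem hSp
  have hgq := gap_notMem hSq
  rw [Finset.mem_union] at hgp hgq
  push Not at hgp hgq
  unfold WW DW at h
  have h3 := List.append_inj h (by rw [List.length_reverse, List.length_reverse, IW_length hgp.1, IW_length hgq.1]; omega)
  apply Prod.ext
  · rw [← IW_toFinset hgp.1, ← IW_toFinset hgq.1, List.reverse_inj.1 h3.1]
  · rw [← IW_toFinset hgp.2, ← IW_toFinset hgq.2, h3.2]

lemma WW_surj {k r : ℕ} {i : ℤ} {u : Word k} (hu : u ∈ VSetC k r i) : ∃ p ∈ T2 k r, (p.2.card : ℤ) = i ∧ WW k p = u := by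
  obtain ⟨⟨hV, hl, hasc⟩, hc⟩ := hu
  obtain ⟨hS, ds, as, v, hpl, c1, c2⟩ := hV
  have c1 := List.isChain_iff_pairwise.1 c1
  have c2 := List.isChain_iff_pairwise.1 c2
  set S := supp k u with hSdef
  set a := gap k S with ha
  have hu : u = (ds ++ v :: as).map (LL k a) := by
    rw [← hpl]
    unfold posList
    rw [List.map_map]
    conv_lhs => rw [← List.map_id u]
    refine List.map_congr_left fun x _ => ?_
    simp only [Function.comp, id]
    exact (LL_pos S x).symm
  have hlt : ∀ p ∈ ds ++ v :: as, p < k := by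
    intro p hp
    rw [← hpl] at hp
    unfold posList at hp
    rw [List.mem_map] at hp
    obtain ⟨x, hx, rfl⟩ := hp
    exact pos_lt hS (by rw [hSdef]; unfold supp; rw [List.mem_toFinset]; exact hx)
  have hltA : ∀ p ∈ v :: ds.reverse, p < k := fun p hp => hlt p (by simp at hp ⊢; tauto)
  have hltB : ∀ p ∈ as, p < k := fun p hp => hlt p (by simp at hp ⊢; tauto)
  have hgen : ∀ ps : List ℕ, (∀ p ∈ ps, p < k) → ∀ p < k, LL k a p ∈ (ps.map (LL k a)).toFinset ↔ p ∈ ps := by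
    intro ps hps p hp
    rw [List.mem_toFinset, List.mem_map]
    constructor
    · rintro ⟨q, hq, e⟩
      have := LL_inj (by have := hps q hq; omega) (by omega) e
      exact this ▸ hq
    · intro h; exact ⟨p, h, rfl⟩
  set A := ((v :: ds.reverse).map (LL k a)).toFinset with hA
  set B := (as.map (LL k a)).toFinset with hB
  have hAB : A ∪ B = S := by
    rw [hSdef]; unfold supp
    rw [hA, hB]
    conv_rhs => rw [hu]
    ext x
    simp only [Finset.mem_union, List.mem_toFinset, List.mem_map, List.mem_append, List.mem_cons, List.mem_reverse]
    constructor
    · rintro (⟨q, h, e⟩ | ⟨q, h, e⟩)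
      · exact ⟨q, by tauto, e⟩
      · exact ⟨q, by tauto, e⟩
    · rintro ⟨q, h, e⟩
      rcases h with h | h | h
      · exact Or.inl ⟨q, by tauto, e⟩
      · exact Or.inl ⟨q, by tauto, e⟩
      · exact Or.inr ⟨q, by tauto, e⟩
  have c1' : (v :: ds.reverse).Pairwise (· < ·) := by
    have : (ds ++ [v]).reverse.Pairwise (· < ·) := List.pairwise_reverse.2 c1
    simpa using this
  have hIA : IW k a A = (v :: ds.reverse).map (LL k a) := IW_eq_of c1' hltA (hgen _ hltA)
  have hIB : IW k a B = as.map (LL k a) := IW_eq_of (List.pairwise_cons.1 c2).2 hltB (hgen _ hltB)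
  have hg : a ∉ A ∪ B := by rw [hAB]; exact gap_notMem hS
  rw [Finset.mem_union] at hg
  push Not at hg
  have hcA := IW_length hg.1
  have hcB := IW_length hg.2
  rw [hIA] at hcA
  rw [hIB] at hcB
  rw [List.length_map] at hcA hcB
  have hWW : WW k (A, B) = u := by
    unfold WW DW
    simp only
    rw [hAB, ← ha, hIA, hIB, hu]
    simp
  have hasB : asc k u = B.card := by
    unfold asc
    rw [hpl, asc_hook _ _ _ c1 c2, hcB]
  have hv : v < k := hlt v (by simp)
  have hvA : LL k a v ∈ A := (hgen _ hltA v hv).2 (by simp)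
  have hmE : mEl k S = LL k a v := by
    have hs := mEl_spec (S := S) ⟨LL k a v, by rw [← hAB]; exact Finset.mem_union_left _ hvA⟩
    apply pos_inj S
    apply le_antisymm
    · exact hs.2 _ (by rw [← hAB]; exact Finset.mem_union_left _ hvA)
    · rw [pos_LL S hv.le]
      have h5 := hs.1
      rw [← LL_pos S (mEl k S), ← hAB, Finset.mem_union] at h5
      have h6 := pos_lt hS hs.1
      rw [hAB] at h5
      rcases h5 with h5 | h5
      · have := (hgen _ hltA _ h6).1 h5
        rw [List.mem_cons] at this
        rcases this with e | e
        · exact e.ge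
        · exact ((List.pairwise_cons.1 c1').1 _ e).le
      · have := (hgen _ hltB _ h6).1 h5
        exact ((List.pairwise_cons.1 c2).1 _ this).le
  refine ⟨(A, B), ?_, ?_, hWW⟩
  · rw [mem_T2]
    simp only
    rw [hAB, hmE]
    refine ⟨?_, hvA, ?_, hc⟩
    · rw [← hcA, ← hcB, ← hl, hu]; simp; omega
    · intro hh
      have := (hgen _ hltB v hv).1 hh
      have := (List.pairwise_cons.1 c2).1 _ this
      omega
  · rw [← hasc, hasB]

lemma kcoeff_eq {k r : ℕ} (P : Word k → Prop) :
    kcoeff k r P = ∑ p ∈ T2 k r, (-1 : ℤ) ^ p.2.card * (if P (WW k p) then 1 else 0) := by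
  unfold kcoeff
  have hset : ∀ i : ℕ, ({u ∈ VSetC k r (i : ℤ) | P u}.ncard : ℤ) =
      ∑ p ∈ (T2 k r).filter (fun p => p.2.card = i), (if P (WW k p) then 1 else 0) := by
    intro i
    have : {u ∈ VSetC k r (i : ℤ) | P u} =
        ((((T2 k r).filter (fun p => p.2.card = i)).filter (fun p => P (WW k p))).image (WW k) : Finset (Word k)) := by
      ext u
      rw [Finset.mem_coe, Finset.mem_image]
      simp only [Finset.mem_filter]
      constructor
      · rintro ⟨h1, h2⟩
        obtain ⟨p, hp, hi, rfl⟩ := WW_surj h1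
        exact ⟨p, ⟨⟨hp, by exact_mod_cast hi⟩, h2⟩, rfl⟩
      · rintro ⟨p, ⟨⟨hp, hi⟩, h2⟩, rfl⟩
        refine ⟨?_, h2⟩
        rw [← hi]; exact WW_mem hp
    rw [this, Set.ncard_coe_finset, Finset.card_image_of_injOn, Finset.card_filter]
    · push_cast; rfl
    · intro p hp q hq e
      simp only [Finset.coe_filter, Finset.mem_filter, Set.mem_ofPred_eq] at hp hq
      exact WW_inj hp.1.1 hq.1.1 e
  rw [← Finset.sum_fiberwise_of_maps_to (s := T2 k r) (t := Finset.range r) (g := fun p => p.2.card)]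
  · refine Finset.sum_congr rfl fun i _ => ?_
    rw [hset, Finset.mul_sum]
    refine Finset.sum_congr rfl fun p hp => ?_
    rw [(Finset.mem_filter.1 hp).2]
  · intro p hp
    rw [mem_T2] at hp
    have : 0 < p.1.card := Finset.card_pos.2 ⟨_, hp.2.1⟩
    rw [Finset.mem_range]; omega

lemma sum_tri {R : Type*} [CommRing R] (X : ℕ → R) (r : ℕ) :
    ∑ i ∈ Finset.range r, ∑ t ∈ Finset.range (i + 1), X t = ∑ t ∈ Finset.range r, ((r : R) - t) * X t := by
  induction r with
  | zero => simp
  | succ r ih =>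
    rw [Finset.sum_range_succ, ih, Finset.sum_range_succ, Finset.sum_range_succ, ← add_assoc, ← Finset.sum_add_distrib]
    congr 1
    · refine Finset.sum_congr rfl fun t _ => ?_
      push_cast; ring
    · push_cast; ring

def vl {R : Type*} [CommRing R] (k : ℕ) (s : Set Cell → R) (o : Option (ℕ → ℤ)) : R :=
  o.elim 0 (fun g => s (pMap k (SS g)))

lemma dotB_vl {R : Type*} [CommRing R] {k : ℕ} (hk : 1 ≤ k) (s : Set Cell → R) {f : ℕ → ℤ} (h : Bd k f) (u : Word k) :
    ((dotB k u (pMap k (SS f))).elim 0 fun mu => s mu) = vl k s (actF k u (some f)) := by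
  rw [dotB_eq hk h]
  unfold vl
  cases actF k u (some f) <;> rfl

lemma he_eq {k : ℕ} (hk : 1 ≤ k) {R : Type*} [CommRing R] {hR eR : ℕ → R} {s : Set Cell → R}
    (hPieriH : ∀ lam : Set Cell, IsBounded k lam → ∀ r : ℕ, r ≤ k →
      hR r * s lam = ∑ A ∈ Finset.powersetCard r (Finset.univ : Finset (Idx k)),
        (dotB k (dwordOf k A) lam).elim 0 fun mu => s mu)
    (hPieriE : ∀ lam : Set Cell, IsBounded k lam → ∀ r : ℕ, r ≤ k →
      eR r * s lam = ∑ B ∈ Finset.powersetCard r (Finset.univ : Finset (Idx k)),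
        (dotB k (iwordOf k B) lam).elim 0 fun mu => s mu)
    {f : ℕ → ℤ} (hf : Bd k f) {m t : ℕ} (hmt : m + t ≤ k) :
    hR m * eR t * s (pMap k (SS f)) = ∑ B ∈ Finset.powersetCard t (Finset.univ : Finset (Idx k)),
      ∑ A ∈ Finset.powersetCard m (Finset.univ : Finset (Idx k)), vl k s (actF k (WW k (A, B)) (some f)) := by
  rw [mul_assoc, hPieriE _ (pMap_bounded hf) t (by omega), Finset.mul_sum]
  refine Finset.sum_congr rfl fun B hB => ?_
  rw [dotB_vl hk s hf]
  have hrw : ∀ A ∈ Finset.powersetCard m (Finset.univ : Finset (Idx k)), vl k s (actF k (WW k (A, B)) (some f)) =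
      vl k s (actF k (dwordOf k A) (actF k (iwordOf k B) (some f))) := by
    intro A hA
    rw [Finset.mem_powersetCard] at hA hB
    rw [← WW_act, actF_append]
    exact TT_proper (r := m + t) hmt (p := (A, B)) (by unfold TT; simp [hA.2, hB.2])
  rw [Finset.sum_congr rfl hrw]
  generalize hg : actF k (iwordOf k B) (some f) = o
  cases o with
  | none => simp [vl, actF_none]
  | some g =>
    have hgB := actF_Bd hk hf hg
    have : vl k s (some g) = s (pMap k (SS g)) := rfl
    rw [this, hPieriH _ (pMap_bounded hgB) m (by omega)]
    refine Finset.sum_congr rfl fun A _ => ?_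
    rw [dotB_vl hk s hgB]

lemma pR_eq {k : ℕ} (hk : 1 ≤ k) {R : Type*} [CommRing R] {hR eR : ℕ → R} {s : Set Cell → R}
    (hPieriH : ∀ lam : Set Cell, IsBounded k lam → ∀ r : ℕ, r ≤ k →
      hR r * s lam = ∑ A ∈ Finset.powersetCard r (Finset.univ : Finset (Idx k)),
        (dotB k (dwordOf k A) lam).elim 0 fun mu => s mu)
    (hPieriE : ∀ lam : Set Cell, IsBounded k lam → ∀ r : ℕ, r ≤ k →
      eR r * s lam = ∑ B ∈ Finset.powersetCard r (Finset.univ : Finset (Idx k)),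
        (dotB k (iwordOf k B) lam).elim 0 fun mu => s mu)
    {f : ℕ → ℤ} (hf : Bd k f) {r : ℕ} (hr1 : 1 ≤ r) (hrk : r ≤ k) :
    pR hR eR r * s (pMap k (SS f)) = ∑ p ∈ T2 k r, (-1 : R) ^ p.2.card * vl k s (actF k (WW k p) (some f)) := by
  rw [← sum_conn hr1 hrk, ← sum_pairs hr1 hrk]
  rotate_left
  · intro A B c hS hc h1 h2
    rw [WW_both hk hS hc h1 h2]; rfl
  · intro A B c hS hc h1 h2
    rw [WW_tog hS hc h1 h2]
  · intro A B c hS hc h1 h2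
    rw [WW_both hk hS hc h1 h2]; rfl
  · intro A B c hS hc h1 h2
    rw [WW_tog hS hc h1 h2]
  have e1 : pR hR eR r = ∑ t ∈ Finset.range r, ((r : R) - t) * ((-1 : R) ^ t * (hR (r - t) * eR t)) := by
    unfold pR
    rw [← sum_tri (fun t => (-1 : R) ^ t * (hR (r - t) * eR t))]
    refine Finset.sum_congr rfl fun i hi => ?_
    rw [Finset.mem_range] at hi
    rw [← Finset.sum_range_reflect (fun t => (-1 : R) ^ t * (hR (r - t) * eR t))]
    refine Finset.sum_congr rfl fun j hj => ?_
    rw [Finset.mem_range] at hj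
    have a1 : i + 1 - 1 - j = i - j := by omega
    have a2 : r - (i - j) = r - i + j := by omega
    have a3 : (-1 : R) ^ (i + j) = (-1) ^ (i - j) := by
      have : i + j = (i - j) + 2 * j := by omega
      rw [this, pow_add, pow_mul]; simp
    rw [a1, a2, ← a3, zsmul_eq_mul]
    push_cast; rfl
  rw [e1, Finset.sum_mul, ← Finset.sum_fiberwise_of_maps_to (s := TT k r) (t := Finset.range (r + 1)) (g := fun p => p.2.card)]
  · rw [Finset.sum_range_succ]
    have hz : ∑ p ∈ (TT k r).filter (fun p => p.2.card = r), (-1 : R) ^ p.2.card * (p.1.card : R) * vl k s (actF k (WW k p) (some f)) = 0 := by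
      refine Finset.sum_eq_zero fun p hp => ?_
      rw [Finset.mem_filter] at hp
      unfold TT at hp
      rw [Finset.mem_filter] at hp
      have : p.1.card = 0 := by omega
      rw [this]; simp
    rw [hz, add_zero]
    refine Finset.sum_congr rfl fun t ht => ?_
    rw [Finset.mem_range] at ht
    have e2 := he_eq hk hPieriH hPieriE hf (m := r - t) (t := t) (by omega)
    have e3 : ((r : R) - t) * ((-1 : R) ^ t * (hR (r - t) * eR t)) * s (pMap k (SS f)) =
      ((r : R) - t) * (-1 : R) ^ t * (hR (r - t) * eR t * s (pMap k (SS f))) := by ring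
    rw [e3, e2, Finset.sum_comm, ← Finset.sum_product', Finset.mul_sum]
    have hset : (TT k r).filter (fun p => p.2.card = t) =
        Finset.powersetCard (r - t) (Finset.univ : Finset (Idx k)) ×ˢ Finset.powersetCard t (Finset.univ : Finset (Idx k)) := by
      ext p
      unfold TT
      simp only [Finset.mem_filter, Finset.mem_univ, true_and, Finset.mem_product, Finset.mem_powersetCard, Finset.subset_univ]
      omega
    rw [hset]
    refine Finset.sum_congr rfl fun p hp => ?_
    simp only [Finset.mem_product, Finset.mem_powersetCard, Finset.subset_univ, true_and] at hp
    rw [hp.1, hp.2, Nat.cast_sub ht.le]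
    ring
  · intro p hp
    unfold TT at hp
    rw [Finset.mem_filter] at hp
    rw [Finset.mem_range]; omega

theorem statement12 (k : ℕ) (hk : 1 ≤ k)
    (R : Type*) [CommRing R]
    (hR eR : ℕ → R) (hR0 : hR 0 = 1) (eR0 : eR 0 = 1)
    (s : Set Cell → R) (hs0 : s ∅ = 1)
    (hPieriH : ∀ lam : Set Cell, IsBounded k lam → ∀ r : ℕ, r ≤ k →
      hR r * s lam = ∑ A ∈ Finset.powersetCard r (Finset.univ : Finset (Idx k)),
        (dotB k (dwordOf k A) lam).elim 0 fun mu => s mu)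
    (hPieriE : ∀ lam : Set Cell, IsBounded k lam → ∀ r : ℕ, r ≤ k →
      eR r * s lam = ∑ B ∈ Finset.powersetCard r (Finset.univ : Finset (Idx k)),
        (dotB k (iwordOf k B) lam).elim 0 fun mu => s mu)
    (r : ℕ) (hr1 : 1 ≤ r) (hrk : r ≤ k) (lam : Set Cell) (hlam : IsBounded k lam) :
    pR hR eR r * s lam =
      (∑ᶠ mu ∈ {mu : Set Cell | IsBounded k mu ∧ kconds k r lam mu},
        kcoeff k r (fun u => dotB k u lam = some mu) • s mu) ∧
    ∀ mu : Set Cell, IsBounded k mu → ¬kconds k r lam mu →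
      kcoeff k r (fun u => dotB k u lam = some mu) = 0 := by
  obtain ⟨f, hf, rfl⟩ := bounded_surj hlam
  -- every output of a connected hook word satisfies the conditions
  have key : ∀ p ∈ T2 k r, ∀ mu, dotB k (WW k p) (pMap k (SS f)) = some mu →
      IsBounded k mu ∧ kconds k r (pMap k (SS f)) mu := by
    intro p hp mu h
    rw [dotB_eq hk hf, Option.map_eq_some_iff] at h
    obtain ⟨g, hg, rfl⟩ := h
    have hw := WW_mem hp
    refine ⟨pMap_bounded (actF_Bd hk hf hg), ?_⟩
    have := kconds_of_word hk hf hw.1.1 hw.2 hg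
    rwa [hw.1.2.1] at this
  have hzero : ∀ mu : Set Cell, ¬ (IsBounded k mu ∧ kconds k r (pMap k (SS f)) mu) →
      kcoeff k r (fun u => dotB k u (pMap k (SS f)) = some mu) = 0 := by
    intro mu hmu
    rw [kcoeff_eq]
    refine Finset.sum_eq_zero fun p hp => ?_
    rw [if_neg, mul_zero]
    intro h
    exact hmu (key p hp mu h)
  refine ⟨?_, fun mu _ hn => hzero mu (fun h => hn h.2)⟩
  rw [pR_eq hk hPieriH hPieriE hf hr1 hrk]
  set M : Finset (Set Cell) := (T2 k r).biUnion (fun p => (dotB k (WW k p) (pMap k (SS f))).toFinset) with hM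
  have hfs : (∑ᶠ mu ∈ {mu : Set Cell | IsBounded k mu ∧ kconds k r (pMap k (SS f)) mu},
        kcoeff k r (fun u => dotB k u (pMap k (SS f)) = some mu) • s mu) =
      ∑ mu ∈ M, kcoeff k r (fun u => dotB k u (pMap k (SS f)) = some mu) • s mu := by
    have h1 : ∀ mu : Set Cell, (∑ᶠ (_ : mu ∈ {mu : Set Cell | IsBounded k mu ∧ kconds k r (pMap k (SS f)) mu}),
        kcoeff k r (fun u => dotB k u (pMap k (SS f)) = some mu) • s mu) =
        kcoeff k r (fun u => dotB k u (pMap k (SS f)) = some mu) • s mu := by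
      intro mu
      by_cases h : mu ∈ {mu : Set Cell | IsBounded k mu ∧ kconds k r (pMap k (SS f)) mu}
      · rw [finsum_eq_if, if_pos h]
      · rw [finsum_eq_if, if_neg h, hzero mu h, zero_smul]
    rw [finsum_congr h1]
    apply finsum_eq_sum_of_support_subset
    intro mu hmu
    rw [Function.mem_support] at hmu
    by_contra hc
    apply hmu
    rw [kcoeff_eq, Finset.sum_eq_zero, zero_smul]
    intro p hp
    rw [if_neg, mul_zero]
    intro h
    apply hc
    rw [Finset.mem_coe, hM, Finset.mem_biUnion]
    exact ⟨p, hp, by rw [h]; simp⟩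
  rw [hfs]
  have h2 : ∀ mu ∈ M, kcoeff k r (fun u => dotB k u (pMap k (SS f)) = some mu) • s mu =
      ∑ p ∈ T2 k r, (-1 : R) ^ p.2.card * (if dotB k (WW k p) (pMap k (SS f)) = some mu then s mu else 0) := by
    intro mu _
    rw [kcoeff_eq, Finset.sum_smul]
    refine Finset.sum_congr rfl fun p _ => ?_
    rw [zsmul_eq_mul]
    split_ifs <;> simp
  rw [Finset.sum_congr rfl h2, Finset.sum_comm]
  refine Finset.sum_congr rfl fun p hp => ?_
  rw [← Finset.mul_sum, ← dotB_vl hk s hf]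
  congr 1
  generalize ho : dotB k (WW k p) (pMap k (SS f)) = o
  cases o with
  | none => simp
  | some nu =>
    simp only [Option.elim_some, Option.some.injEq]
    rw [Finset.sum_ite_eq, if_pos]
    rw [hM, Finset.mem_biUnion]
    exact ⟨p, hp, by rw [ho]; simp⟩

end MN

end
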